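/- Suppose the Jacobi parameters (a_n), (b_n) are N-periodically modulated and that there is a positive integer r such that for every i ∈ {0, 1, …, N−1} the real sequences (a_{kN+i−1}/a_{kN+i} : k ≥ 1), (b_{kN+i}/a_{kN+i} : k ≥ 1) and (1/a_{kN+i} : k ≥ 1) belong to 𝒟_r, and that ∑_{n=0}^∞ 1/a_n = ∞. Assume |tr 𝔛_0(0)| < 2 and set τ = |tr 𝔛_0′(0)| / (N √(−discr 𝔛_0(0))). Let μ be the unique probability measure on ℝ with ∫ p_n p_m dμ = δ_{nm} for all n, m, and set ρ_n = ∑_{j=0}^n α_j/a_j. Then μ is absolutely continuous with a density w that is continuous and strictly positive on ℝ, and lim_{n→∞} (1/ρ_n) · ∑_{j=0}^n p_j(x)² = τ / (π w(x)), locally uniformly with respect to x ∈ ℝ. -/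

import Mathlib

open Filter Topology MeasureTheory Real

noncomputable section

abbrev Mat2 := Matrix (Fin 2) (Fin 2) ℝ

/-- The transfer matrix `𝔅_j(x)` built from (N-periodic) sequences `(α_n)`, `(β_n)`. -/
def frakB (α β : ℤ → ℝ) (j : ℤ) (x : ℝ) : Mat2 :=
  !![0, 1; -(α (j - 1)) / α j, (x - β j) / α j]

/-- Product in decreasing index order with integer starting point. -/
def prodDZ (C : ℤ → Mat2) (n0 : ℤ) : ℕ → Mat2
  | 0 => 1
  | (len + 1) => C (n0 + len) * prodDZ C n0 len

/-- `𝔛_0(x) = 𝔅_{N−1}(x) ⋯ 𝔅_0(x)`. -/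
def frakX0 (α β : ℤ → ℝ) (N : ℕ) (x : ℝ) : Mat2 :=
  prodDZ (fun j => frakB α β j x) 0 N

/-- Discriminant of a `2×2` matrix. -/
def discr (M : Mat2) : ℝ := (Matrix.trace M) ^ 2 - 4 * M.det

/-- The constant `τ = |tr 𝔛_0′(0)| / (N √(−discr 𝔛_0(0)))`; `τ/π` is the density at `0` of
the equilibrium measure of `{x : |tr 𝔛_0(x)| ≤ 2}`. -/
def tauC (α β : ℤ → ℝ) (N : ℕ) : ℝ :=
  |deriv (fun y => Matrix.trace (frakX0 α β N y)) 0| /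
    (N * Real.sqrt (-discr (frakX0 α β N 0)))

/-- The orthonormal polynomials `p_n` associated to `(a_n)`, `(b_n)`. -/
def opoly (a b : ℕ → ℝ) : ℕ → ℝ → ℝ
  | 0 => fun _ => 1
  | 1 => fun x => (x - b 0) / a 0
  | (n + 2) => fun x =>
      ((x - b (n + 1)) * opoly a b (n + 1) x - a n * opoly a b n x) / a (n + 1)

/-- Iterated forward difference of a sequence. -/
def iterDiff (f : ℕ → ℝ) : ℕ → ℕ → ℝ
  | 0, n => f n
  | (j + 1), n => iterDiff f j (n + 1) - iterDiff f j n

/-- Membership of a real sequence in the Stolz class `𝒟_r`. -/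
def memD (r : ℕ) (f : ℕ → ℝ) : Prop :=
  (∃ C, ∀ n, |f n| ≤ C) ∧
    ∀ m ∈ Finset.Icc 1 r, Summable fun n : ℕ => |iterDiff f m n| ^ ((r : ℝ) / m)

/-- `ρ_n = ∑_{j=0}^n α_j/a_j`. -/
def rho (a : ℕ → ℝ) (α : ℤ → ℝ) (n : ℕ) : ℝ :=
  ∑ j ∈ Finset.range (n + 1), α (j : ℤ) / a j

/-- Sequences of functions dominated by the `s`-th power of an `ℓ^r` sequence. -/
def LC {T : Type*} (r s : ℕ) (f : ℕ → T → ℂ) : Prop :=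
  ∃ D : ℕ → ℝ, (∀ n, 0 ≤ D n) ∧ Summable (fun n => D n ^ r) ∧
    ∃ C, 0 ≤ C ∧ ∀ n t, ‖f n t‖ ≤ C * D n ^ s

/-- Graded Stolz class. -/
def OC {T : Type*} (r : ℕ) : ℕ → ℕ → (ℕ → T → ℂ) → Prop
  | s, 0, f => LC r s f
  | s, (k + 1), f => LC r s f ∧ OC r (s + 1) k (fun n t => f (n + 1) t - f n t)

section classes
variable {T : Type*} {r : ℕ}

theorem LC.add {s : ℕ} {f g : ℕ → T → ℂ} (hf : LC r s f) (hg : LC r s g) :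
    LC r s (fun n t => f n t + g n t) := by
  obtain ⟨D, hD, hS, C, hC, h⟩ := hf
  obtain ⟨D', hD', hS', C', hC', h'⟩ := hg
  refine ⟨fun n => max (D n) (D' n), fun n => le_max_of_le_left (hD n), ?_, C + C',
    by positivity, ?_⟩
  · refine Summable.of_nonneg_of_le (fun n => pow_nonneg (le_max_of_le_left (hD n)) _) ?_
      (hS.add hS')
    intro n
    have h1 := pow_nonneg (hD n) r
    have h2 := pow_nonneg (hD' n) r
    dsimp only
    rcases max_choice (D n) (D' n) with h | h <;> rw [h] <;> linarith
  · intro n t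
    refine (norm_add_le _ _).trans ?_
    have h1 : D n ^ s ≤ (max (D n) (D' n)) ^ s := pow_le_pow_left₀ (hD n) (le_max_left _ _) _
    have h2 : D' n ^ s ≤ (max (D n) (D' n)) ^ s := pow_le_pow_left₀ (hD' n) (le_max_right _ _) _
    have := h n t
    have := h' n t
    nlinarith [mul_le_mul_of_nonneg_left h1 hC, mul_le_mul_of_nonneg_left h2 hC']

theorem LC.mul {s s' : ℕ} {f g : ℕ → T → ℂ} (hf : LC r s f) (hg : LC r s' g) :
    LC r (s + s') (fun n t => f n t * g n t) := by
  obtain ⟨D, hD, hS, C, hC, h⟩ := hf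
  obtain ⟨D', hD', hS', C', hC', h'⟩ := hg
  refine ⟨fun n => max (D n) (D' n), fun n => le_max_of_le_left (hD n), ?_, C * C',
    by positivity, ?_⟩
  · refine Summable.of_nonneg_of_le (fun n => pow_nonneg (le_max_of_le_left (hD n)) _) ?_
      (hS.add hS')
    intro n
    have h1 := pow_nonneg (hD n) r
    have h2 := pow_nonneg (hD' n) r
    dsimp only
    rcases max_choice (D n) (D' n) with h | h <;> rw [h] <;> linarith
  · intro n t
    rw [norm_mul]
    have h1 : D n ^ s ≤ (max (D n) (D' n)) ^ s := pow_le_pow_left₀ (hD n) (le_max_left _ _) _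
    have h2 : D' n ^ s' ≤ (max (D n) (D' n)) ^ s' :=
      pow_le_pow_left₀ (hD' n) (le_max_right _ _) _
    have e1 : ‖f n t‖ ≤ C * (max (D n) (D' n)) ^ s :=
      (h n t).trans (mul_le_mul_of_nonneg_left h1 hC)
    have e2 : ‖g n t‖ ≤ C' * (max (D n) (D' n)) ^ s' :=
      (h' n t).trans (mul_le_mul_of_nonneg_left h2 hC')
    calc ‖f n t‖ * ‖g n t‖ ≤ (C * (max (D n) (D' n)) ^ s) * (C' * (max (D n) (D' n)) ^ s') :=
          mul_le_mul e1 e2 (norm_nonneg _) ((norm_nonneg _).trans e1)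
      _ = C * C' * (max (D n) (D' n)) ^ (s + s') := by rw [pow_add]; ring

theorem LC.shift {s : ℕ} {f : ℕ → T → ℂ} (hf : LC r s f) (m : ℕ) :
    LC r s (fun n t => f (n + m) t) := by
  obtain ⟨D, hD, hS, C, hC, h⟩ := hf
  exact ⟨fun n => D (n + m), fun n => hD _, (summable_nat_add_iff (f := fun n => D n ^ r) m).2 hS,
    C, hC, fun n t => h _ t⟩

theorem LC.bdd (hr : 0 < r) {D : ℕ → ℝ} (hD : ∀ n, 0 ≤ D n) (hS : Summable (fun n => D n ^ r)) :
    ∃ M, 0 ≤ M ∧ ∀ n, D n ≤ M := by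
  have h0 : ∀ n, D n ^ r ≤ ∑' n, D n ^ r := fun n =>
    hS.le_tsum n (fun j _ => pow_nonneg (hD j) _)
  refine ⟨max 1 (∑' n, D n ^ r), by positivity, fun n => ?_⟩
  by_cases h : D n ≤ 1
  · exact h.trans (le_max_left _ _)
  · push Not at h
    refine le_trans ?_ ((h0 n).trans (le_max_right _ _))
    exact le_self_pow₀ h.le hr.ne'

theorem LC.weaken (hr : 0 < r) {s s' : ℕ} (hs : s' ≤ s) {f : ℕ → T → ℂ} (hf : LC r s f) :
    LC r s' f := by
  obtain ⟨D, hD, hS, C, hC, h⟩ := hf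
  obtain ⟨M, hM, hb⟩ := LC.bdd hr hD hS
  refine ⟨D, hD, hS, C * M ^ (s - s'), by positivity, fun n t => (h n t).trans ?_⟩
  have : D n ^ s = D n ^ (s - s') * D n ^ s' := by rw [← pow_add]; congr 1; omega
  rw [this, mul_assoc]
  refine mul_le_mul_of_nonneg_left ?_ hC
  exact mul_le_mul_of_nonneg_right (pow_le_pow_left₀ (hD n) (hb n) _) (pow_nonneg (hD n) _)

theorem LC.of_bdd {f : ℕ → T → ℂ} (hr : 0 < r) {C : ℝ} (h : ∀ n t, ‖f n t‖ ≤ C) : LC r 0 f :=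
  ⟨fun _ => 0, fun _ => le_rfl, by simp [hr.ne', summable_zero], max C 0, le_max_right _ _,
    fun n t => by simpa using Or.inl (h n t)⟩

theorem LC.zero (hr : 0 < r) (s : ℕ) : LC r s (fun (_ : ℕ) (_ : T) => (0 : ℂ)) :=
  ⟨fun n => 0, fun _ => le_rfl, by simp [hr.ne', summable_zero], 0, le_rfl, by simp⟩

theorem OC.lc {s k : ℕ} {f : ℕ → T → ℂ} (hf : OC r s k f) : LC r s f := by
  cases k with
  | zero => exact hf
  | succ k => exact hf.1

theorem OC.shift {s k : ℕ} {f : ℕ → T → ℂ} (hf : OC r s k f) (m : ℕ) :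
    OC r s k (fun n t => f (n + m) t) := by
  induction k generalizing s f with
  | zero => exact LC.shift hf m
  | succ k ih =>
    refine ⟨LC.shift hf.1 m, ?_⟩
    have := ih hf.2
    simpa only [add_right_comm] using this

theorem OC.weaken (hr : 0 < r) {s s' k k' : ℕ} (hs : s' ≤ s) (hk : k' ≤ k) {f : ℕ → T → ℂ}
    (hf : OC r s k f) : OC r s' k' f := by
  induction k' generalizing s s' k f with
  | zero => exact LC.weaken hr hs hf.lc
  | succ k' ih =>
    obtain ⟨k, rfl⟩ : ∃ j, k = j + 1 := ⟨k - 1, by omega⟩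
    exact ⟨LC.weaken hr hs hf.1, ih (by omega) (by omega) hf.2⟩

theorem OC.delta {s k : ℕ} {f : ℕ → T → ℂ} (hf : OC r s (k + 1) f) :
    OC r (s + 1) k (fun n t => f (n + 1) t - f n t) := hf.2

theorem OC.add {s k : ℕ} {f g : ℕ → T → ℂ} (hf : OC r s k f) (hg : OC r s k g) :
    OC r s k (fun n t => f n t + g n t) := by
  induction k generalizing s f g with
  | zero => exact LC.add hf hg
  | succ k ih =>
    refine ⟨LC.add hf.1 hg.1, ?_⟩
    have := ih hf.2 hg.2
    convert this using 3
    ring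

theorem OC.mul (hr : 0 < r) {s s' k : ℕ} {f g : ℕ → T → ℂ} (hf : OC r s k f)
    (hg : OC r s' k g) : OC r (s + s') k (fun n t => f n t * g n t) := by
  induction k generalizing s s' f g with
  | zero => exact LC.mul hf hg
  | succ k ih =>
    refine ⟨LC.mul hf.1 hg.1, ?_⟩
    have h1 := ih hf.2 (OC.weaken hr le_rfl (Nat.le_succ k) (hg.shift 1))
    have h2 := ih (OC.weaken hr le_rfl (Nat.le_succ k) hf) hg.2
    rw [show s + 1 + s' = s + s' + 1 by ring] at h1
    rw [show s + (s' + 1) = s + s' + 1 by ring] at h2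
    convert h1.add h2 using 3
    ring

theorem OC.zero (hr : 0 < r) (s k : ℕ) : OC r s k (fun (_ : ℕ) (_ : T) => (0 : ℂ)) := by
  induction k generalizing s with
  | zero => exact LC.zero hr s
  | succ k ih => exact ⟨LC.zero hr s, by simpa using ih (s + 1)⟩

theorem OC.const (hr : 0 < r) (k : ℕ) {c : T → ℂ} {C : ℝ} (h : ∀ t, ‖c t‖ ≤ C) :
    OC r 0 k (fun (_ : ℕ) (t : T) => c t) := by
  have h0 : LC r 0 (fun (_ : ℕ) (t : T) => c t) := LC.of_bdd hr (fun _ t => h t)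
  cases k with
  | zero => exact h0
  | succ k => exact ⟨h0, by simpa using OC.zero hr 1 k⟩

theorem OC.cst (hr : 0 < r) (k : ℕ) (c : ℂ) : OC r 0 k (fun (_ : ℕ) (_ : T) => c) :=
  OC.const hr k (C := ‖c‖) (fun _ => le_rfl)

theorem OC.mul0 (hr : 0 < r) {s k : ℕ} {f g : ℕ → T → ℂ} (hf : OC r s k f)
    (hg : OC r 0 k g) : OC r s k (fun n t => f n t * g n t) := by
  simpa using hf.mul hr hg

theorem OC.neg (hr : 0 < r) {s k : ℕ} {f : ℕ → T → ℂ} (hf : OC r s k f) :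
    OC r s k (fun n t => - f n t) := by
  simpa using hf.mul0 hr (OC.cst hr k (-1))

theorem OC.sub (hr : 0 < r) {s k : ℕ} {f g : ℕ → T → ℂ} (hf : OC r s k f)
    (hg : OC r s k g) : OC r s k (fun n t => f n t - g n t) := by
  simpa only [sub_eq_add_neg] using hf.add (hg.neg hr)

theorem OC.inv (hr : 0 < r) {k : ℕ} {f : ℕ → T → ℂ} (hf : OC r 0 k f) {c : ℝ} (hc : 0 < c)
    (h : ∀ n t, c ≤ ‖f n t‖) : OC r 0 k (fun n t => (f n t)⁻¹) := by
  have hb : LC r 0 (fun n t => (f n t)⁻¹) := LC.of_bdd hr (C := c⁻¹) (fun n t => by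
    rw [norm_inv]; exact inv_anti₀ hc (h n t))
  have hne : ∀ n t, f n t ≠ 0 := fun n t => norm_pos_iff.1 (hc.trans_le (h n t))
  induction k with
  | zero => exact hb
  | succ k ih =>
    refine ⟨hb, ?_⟩
    have h0 := ih (OC.weaken hr le_rfl (Nat.le_succ k) hf)
    have := ((hf.2.neg hr).mul0 hr h0).mul0 hr (h0.shift 1)
    convert this using 3 with n t
    have := hne n t
    have := hne (n + 1) t
    field_simp
    ring

theorem OC.sqrt (hr : 0 < r) {k : ℕ} {f : ℕ → T → ℝ} (hf : OC r 0 k (fun n t => (f n t : ℂ)))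
    {c : ℝ} (hc : 0 < c) (h : ∀ n t, c ≤ f n t) :
    OC r 0 k (fun n t => ((√(f n t) : ℝ) : ℂ)) := by
  have hb : LC r 0 (fun n t => ((√(f n t) : ℝ) : ℂ)) := by
    obtain ⟨D, hD, hS, C, hC, h'⟩ := hf.lc
    refine LC.of_bdd hr (C := √ C) (fun n t => ?_)
    rw [Complex.norm_real, Real.norm_of_nonneg (Real.sqrt_nonneg _)]
    refine Real.sqrt_le_sqrt ?_
    have := h' n t
    rw [Complex.norm_real, pow_zero, mul_one] at this
    exact (le_abs_self _).trans this
  induction k with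
  | zero => exact hb
  | succ k ih =>
    refine ⟨hb, ?_⟩
    have h0 := ih (OC.weaken hr le_rfl (Nat.le_succ k) hf)
    have hs : ∀ n t, √ c ≤ √ (f n t) := fun n t => Real.sqrt_le_sqrt (h n t)
    have hcs : 0 < √ c := Real.sqrt_pos.2 hc
    have h1 := (h0.add (h0.shift 1)).inv hr hcs (fun n t => by
      rw [← Complex.ofReal_add, Complex.norm_real]
      have := hs n t
      have := hs (n + 1) t
      rw [Real.norm_of_nonneg (by linarith)]
      linarith)
    convert hf.2.mul0 hr h1 using 3 with n t
    have e1 := hs n t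
    have e2 := hs (n + 1) t
    have e3 : √ (f n t) + √ (f (n + 1) t) ≠ 0 := by linarith
    have e4 := Real.mul_self_sqrt (hc.le.trans (h n t))
    have e5 := Real.mul_self_sqrt (hc.le.trans (h (n + 1) t))
    beta_reduce
    norm_cast
    rw [eq_mul_inv_iff_mul_eq₀ e3]
    linear_combination e5 - e4

theorem OC.of_memD (hr : 0 < r) {f : ℕ → ℝ} (hf : memD r f) :
    OC r 0 r (fun n (_ : T) => (f n : ℂ)) := by
  have key : ∀ k s, s + k = r → OC r s k (fun n (_ : T) => (iterDiff f s n : ℂ)) := by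
    have hL : ∀ s, s ≤ r → LC r s (fun n (_ : T) => (iterDiff f s n : ℂ)) := by
      intro s hs
      rcases Nat.eq_zero_or_pos s with rfl | h0
      · obtain ⟨C, hC⟩ := hf.1
        exact LC.of_bdd hr (C := C) (fun n t => by simpa [iterDiff] using hC n)
      · have h := hf.2 s (by simp; omega)
        have hs' : (s : ℝ) ≠ 0 := by positivity
        refine ⟨fun n => |iterDiff f s n| ^ ((s : ℝ)⁻¹), fun n => by positivity, ?_, 1,
          zero_le_one, fun n t => ?_⟩
        · convert h using 2 with n
          rw [← Real.rpow_natCast, ← Real.rpow_mul (abs_nonneg _)]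
          congr 1
          field_simp
        · rw [← Real.rpow_natCast, ← Real.rpow_mul (abs_nonneg _), inv_mul_cancel₀ hs']
          simp
    intro k
    induction k with
    | zero => intro s hs; exact hL s (by omega)
    | succ k ih =>
      intro s hs
      refine ⟨hL s (by omega), ?_⟩
      have := ih (s + 1) (by omega)
      simpa [iterDiff] using this
  simpa [iterDiff] using key r 0 (by omega)

end classes

/-- Uniform convergence to a constant. -/
abbrev UL {T β : Type*} [TopologicalSpace β] (F : ℕ → T → β) (c : β) : Prop :=
  Tendsto (fun p : ℕ × T => F p.1 p.2) (atTop ×ˢ ⊤) (𝓝 c)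

section newton
variable {T : Type*} {r : ℕ}

theorem UL.shift {β : Type*} [TopologicalSpace β] {F : ℕ → T → β} {c : β} (h : UL F c) (m : ℕ) :
    UL (fun n t => F (n + m) t) c := by
  have : Tendsto (fun p : ℕ × T => ((p.1 + m, p.2) : ℕ × T)) (atTop ×ˢ ⊤) (atTop ×ˢ ⊤) :=
    (tendsto_add_atTop_nat m).prodMap tendsto_id
  exact Tendsto.comp h this

theorem UL.ev {β : Type*} [TopologicalSpace β] {F : ℕ → T → β} {c : β} (h : UL F c)
    {P : β → Prop} (hP : ∀ᶠ y in 𝓝 c, P y) : ∃ m, ∀ n t, P (F (n + m) t) := by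
  have := h.eventually hP
  rw [← principal_univ, eventually_prod_principal_iff] at this
  obtain ⟨m, hm⟩ := eventually_atTop.1 this
  exact ⟨m, fun n t => hm (n + m) (by omega) t (Set.mem_univ _)⟩

theorem UL.lower {F : ℕ → T → ℂ} {c : ℂ} (h : UL F c) (hc : c ≠ 0) :
    ∃ e > 0, ∃ m, ∀ n t, e ≤ ‖F (n + m) t‖ := by
  have h0 : 0 < ‖c‖ := norm_pos_iff.2 hc
  refine ⟨‖c‖ / 2, by positivity, h.ev (P := fun y => ‖c‖ / 2 ≤ ‖y‖) ?_⟩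
  exact (continuous_norm.tendsto c).eventually (eventually_ge_nhds (by linarith))

theorem summable_pow_tendsto (hr : 0 < r) {D : ℕ → ℝ} (hD : ∀ n, 0 ≤ D n)
    (hS : Summable (fun n => D n ^ r)) : Tendsto D atTop (𝓝 0) := by
  have h := hS.tendsto_atTop_zero
  rw [Metric.tendsto_atTop] at h ⊢
  intro ε hε
  obtain ⟨n0, h0⟩ := h (ε ^ r) (by positivity)
  refine ⟨n0, fun n hn => ?_⟩
  have := h0 n hn
  rw [Real.dist_eq, sub_zero, abs_of_nonneg (pow_nonneg (hD n) _)] at this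
  rw [Real.dist_eq, sub_zero, abs_of_nonneg (hD n)]
  exact lt_of_pow_lt_pow_left₀ r hε.le this

theorem LC.ul (hr : 0 < r) {s : ℕ} (hs : 1 ≤ s) {f : ℕ → T → ℂ} (hf : LC r s f) : UL f 0 := by
  obtain ⟨D, hD, hS, C, hC, h⟩ := hf
  have h1 : Tendsto (fun n => C * D n ^ s) atTop (𝓝 0) := by
    have := ((summable_pow_tendsto hr hD hS).pow s).const_mul C
    simpa [show s ≠ 0 by omega] using this
  exact squeeze_zero_norm (fun p => h p.1 p.2) (h1.comp tendsto_fst)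

/-- The approximate Riccati solution. -/
def NW (r s k : ℕ) (A B C D : ℕ → T → ℂ) (l : ℂ) (z : ℕ → T → ℂ) : Prop :=
  OC r 0 k z ∧ UL z l ∧
    OC r s k (fun n t => z (n + 1) t - (C n t + D n t * z n t) / (A n t + B n t * z n t))

theorem NW.shift {s k : ℕ} {A B C D : ℕ → T → ℂ} {l : ℂ} {z : ℕ → T → ℂ}
    (h : NW r s k A B C D l z) (m : ℕ) :
    NW r s k (fun n => A (n + m)) (fun n => B (n + m)) (fun n => C (n + m)) (fun n => D (n + m))
      l (fun n => z (n + m)) := by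
  refine ⟨h.1.shift m, h.2.1.shift m, ?_⟩
  have := h.2.2.shift m
  simpa only [add_right_comm] using this

theorem newton_step (hr : 0 < r) {s k : ℕ} (hs : 1 ≤ s) {A B C D : ℕ → T → ℂ} {a b c d l : ℂ}
    (hA : OC r 0 (k + 1) A) (hB : OC r 0 (k + 1) B) (hC : OC r 0 (k + 1) C)
    (hD : OC r 0 (k + 1) D)
    (lA : UL A a) (lB : UL B b) (lC : UL C c) (lD : UL D d)
    (hdet : a * d - b * c = 1) (h0 : a + b * l ≠ 0) (h1 : (a + b * l) ^ 2 ≠ 1)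
    {z : ℕ → T → ℂ} (hz : NW r s (k + 1) A B C D l z) :
    ∃ m, ∃ z' : ℕ → T → ℂ, NW r (s + 1) k (fun n => A (n + m)) (fun n => B (n + m))
      (fun n => C (n + m)) (fun n => D (n + m)) l z' := by
  have lden : UL (fun n t => A n t + B n t * z n t) (a + b * l) := lA.add (lB.mul hz.2.1)
  have lj : UL (fun n t => 1 - (A n t * D n t - B n t * C n t) / (A n t + B n t * z n t) ^ 2)
      (1 - (a * d - b * c) / (a + b * l) ^ 2) :=
    tendsto_const_nhds.sub (((lA.mul lD).sub (lB.mul lC)).div (lden.pow 2) (pow_ne_zero 2 h0))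
  have hj : 1 - (a * d - b * c) / (a + b * l) ^ 2 ≠ 0 := by
    rw [hdet, sub_ne_zero, ne_comm, ne_eq, div_eq_one_iff_eq (pow_ne_zero 2 h0)]
    exact fun h => h1 h.symm
  obtain ⟨e1, he1, m1, hm1⟩ := lden.lower h0
  obtain ⟨e2, he2, m2, hm2⟩ := lj.lower hj
  have sA := hA.shift (m1 + m2)
  have sB := hB.shift (m1 + m2)
  have sC := hC.shift (m1 + m2)
  have sD := hD.shift (m1 + m2)
  have sz := hz.shift (m1 + m2)
  have kA := lA.shift (m1 + m2)
  have kB := lB.shift (m1 + m2)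
  have hm1' : ∀ n t, e1 ≤ ‖A (n + (m1 + m2)) t + B (n + (m1 + m2)) t * z (n + (m1 + m2)) t‖ := by
    intro n t
    have := hm1 (n + m2) t
    rwa [show n + m2 + m1 = n + (m1 + m2) by ring] at this
  have hm2' : ∀ n t, e2 ≤ ‖1 - (A (n + (m1 + m2)) t * D (n + (m1 + m2)) t
      - B (n + (m1 + m2)) t * C (n + (m1 + m2)) t) /
      (A (n + (m1 + m2)) t + B (n + (m1 + m2)) t * z (n + (m1 + m2)) t) ^ 2‖ := by
    intro n t
    have := hm2 (n + m1) t
    rwa [show n + m1 + m2 = n + (m1 + m2) by ring] at this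
  generalize m1 + m2 = M at *
  set A' := fun n => A (n + M)
  set B' := fun n => B (n + M)
  set C' := fun n => C (n + M)
  set D' := fun n => D (n + M)
  set y := fun n => z (n + M)
  obtain ⟨oy, ly, oe⟩ := sz
  set e : ℕ → T → ℂ := fun n t => y (n + 1) t - (C' n t + D' n t * y n t) / (A' n t + B' n t * y n t)
    with hedef
  have oden : OC r 0 (k + 1) (fun n t => A' n t + B' n t * y n t) := sA.add (sB.mul0 hr oy)
  have oinv := oden.inv hr he1 hm1'
  have odet : OC r 0 (k + 1) (fun n t => A' n t * D' n t - B' n t * C' n t) :=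
    (sA.mul0 hr sD).sub hr (sB.mul0 hr sC)
  have oj : OC r 0 (k + 1) (fun n t => 1 - (A' n t * D' n t - B' n t * C' n t) /
      (A' n t + B' n t * y n t) ^ 2) := by
    have := (OC.cst (T := T) hr (k + 1) 1).sub hr (odet.mul0 hr (oinv.mul0 hr oinv))
    convert this using 3
    rw [div_eq_mul_inv, pow_two, mul_inv]
  have ojinv := oj.inv hr he2 hm2'
  have oh := (oe.mul0 hr ojinv).neg hr
  set h : ℕ → T → ℂ := fun n t => -(e n t * (1 - (A' n t * D' n t - B' n t * C' n t) /
      (A' n t + B' n t * y n t) ^ 2)⁻¹) with hhdef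
  have lh : UL h 0 := oh.lc.ul hr hs
  have lden' : UL (fun n t => A' n t + B' n t * (y n t + h n t)) (a + b * l) := by
    have := kA.add (kB.mul (ly.add lh))
    simpa using this
  obtain ⟨e3, he3, m3, hm3⟩ := lden'.lower h0
  have oz' : OC r 0 (k + 1) (fun n t => y n t + h n t) := oy.add (oh.weaken hr (Nat.zero_le _) le_rfl)
  refine ⟨m3 + M, fun n t => y (n + m3) t + h (n + m3) t, (oz'.weaken hr le_rfl (Nat.le_succ k)).shift m3, ?_, ?_⟩
  · have := UL.shift (F := fun n t => y n t + h n t) (ly.add lh) m3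
    simpa using this
  · have wk : ∀ {f : ℕ → T → ℂ}, OC r 0 (k + 1) f → OC r 0 k (fun n t => f (n + m3) t) :=
      fun hf => (hf.weaken hr le_rfl (Nat.le_succ k)).shift m3
    have oden' : OC r 0 k (fun n t => A' (n + m3) t + B' (n + m3) t * (y (n + m3) t + h (n + m3) t)) :=
      (wk sA).add ((wk sB).mul0 hr (wk oz'))
    have oinv' := oden'.inv hr he3 hm3
    have t1 : OC r (s + 1) k (fun n t => h (n + 1 + m3) t - h (n + m3) t) := by
      have := (oh.delta).shift m3
      simpa only [add_right_comm] using this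
    have t2 : OC r (s + 1) k (fun n t => h (n + m3) t * h (n + m3) t) := by
      have := ((oh.mul hr oh).weaken hr (show s + 1 ≤ s + s by omega) (Nat.le_succ k)).shift m3
      exact this
    have t3 := t1.add (((t2.mul0 hr ((wk odet).mul0 hr (wk sB))).mul0 hr
      ((wk oinv).mul0 hr (wk oinv))).mul0 hr oinv')
    convert t3 using 3 with n t
    have E1 : A' (n + m3) t + B' (n + m3) t * y (n + m3) t ≠ 0 :=
      norm_pos_iff.1 (he1.trans_le (hm1' _ _))
    have E3 : A' (n + m3) t + B' (n + m3) t * (y (n + m3) t + h (n + m3) t) ≠ 0 :=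
      norm_pos_iff.1 (he3.trans_le (hm3 _ _))
    have E2 : 1 - (A' (n + m3) t * D' (n + m3) t - B' (n + m3) t * C' (n + m3) t) /
      (A' (n + m3) t + B' (n + m3) t * y (n + m3) t) ^ 2 ≠ 0 :=
      norm_pos_iff.1 (he2.trans_le (hm2' _ _))
    have E4 : e (n + m3) t = - h (n + m3) t * (1 - (A' (n + m3) t * D' (n + m3) t - B' (n + m3) t * C' (n + m3) t) /
      (A' (n + m3) t + B' (n + m3) t * y (n + m3) t) ^ 2) := by
      simp only [hhdef]
      rw [neg_neg, mul_assoc, inv_mul_cancel₀ E2, mul_one]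
    have E5 : y (n + 1 + m3) t = e (n + m3) t + (C' (n + m3) t + D' (n + m3) t * y (n + m3) t) /
        (A' (n + m3) t + B' (n + m3) t * y (n + m3) t) := by
      simp only [hedef]
      rw [show n + m3 + 1 = n + 1 + m3 by ring]
      ring
    have F1 : ∀ (f : ℕ → T → ℂ), f (n + (m3 + M)) t = f (n + m3 + M) t := by
      intro f; rw [add_assoc]
    simp only [F1]
    change y (n + 1 + m3) t + h (n + 1 + m3) t - (C' (n + m3) t + D' (n + m3) t * (y (n + m3) t + h (n + m3) t)) /
      (A' (n + m3) t + B' (n + m3) t * (y (n + m3) t + h (n + m3) t)) = _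
    rw [E5, E4]
    clear_value h e y A' B' C' D'
    generalize h (n + 1 + m3) t = h'
    generalize h (n + m3) t = h at *
    generalize A' (n + m3) t = A at *
    generalize B' (n + m3) t = B at *
    generalize C' (n + m3) t = C at *
    generalize D' (n + m3) t = D at *
    generalize y (n + m3) t = y at *
    clear E2 E4 E5
    field_simp
    ring

theorem newton_iter (hr : 0 < r) (k : ℕ) : ∀ {s : ℕ} (_ : 1 ≤ s) {A B C D : ℕ → T → ℂ} {a b c d l : ℂ}
    (_ : OC r 0 k A) (_ : OC r 0 k B) (_ : OC r 0 k C) (_ : OC r 0 k D)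
    (_ : UL A a) (_ : UL B b) (_ : UL C c) (_ : UL D d)
    (_ : a * d - b * c = 1) (_ : a + b * l ≠ 0) (_ : (a + b * l) ^ 2 ≠ 1)
    {z : ℕ → T → ℂ} (_ : NW r s k A B C D l z),
    ∃ m, ∃ z' : ℕ → T → ℂ, NW r (s + k) 0 (fun n => A (n + m)) (fun n => B (n + m))
      (fun n => C (n + m)) (fun n => D (n + m)) l z' := by
  induction k with
  | zero => 
    intro s hs A B C D a b c d l hA hB hC hD lA lB lC lD hdet h0 h1 z hz
    exact ⟨0, z, by simpa using hz⟩
  | succ k ih =>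
    intro s hs A B C D a b c d l hA hB hC hD lA lB lC lD hdet h0 h1 z hz
    obtain ⟨m, z', hz'⟩ := newton_step hr hs hA hB hC hD lA lB lC lD hdet h0 h1 hz
    have wk : ∀ {f : ℕ → T → ℂ}, OC r 0 (k + 1) f → OC r 0 k (fun n t => f (n + m) t) :=
      fun hf => (hf.weaken hr le_rfl (Nat.le_succ k)).shift m
    obtain ⟨m', y, hy⟩ := ih (s := s + 1) (by omega) (wk hA) (wk hB) (wk hC) (wk hD) (lA.shift m) (lB.shift m)
      (lC.shift m) (lD.shift m) hdet h0 h1 hz'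
    refine ⟨m' + m, y, ?_⟩
    rw [show s + 1 + k = s + (k + 1) by ring] at hy
    simpa only [add_assoc] using hy
end newton

/-- Fixed point in the upper half-plane of the limiting Moebius map. -/
def ellL (a b d : ℝ) : ℂ := ⟨(d - a) / (2 * b), √(4 - (a + d) ^ 2) / (2 * |b|)⟩

section elliptic
variable {a b c d : ℝ}

theorem ell_b_ne (hdet : a * d - b * c = 1) (htr : |a + d| < 2) : b ≠ 0 := by
  rintro rfl
  have := abs_lt.1 htr
  nlinarith [sq_nonneg (a - d)]

theorem ell_disc (htr : |a + d| < 2) : 0 < 4 - (a + d) ^ 2 := by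
  have := abs_lt.1 htr
  nlinarith

theorem ellL_im_pos (hdet : a * d - b * c = 1) (htr : |a + d| < 2) : 0 < (ellL a b d).im := by
  have h := ell_b_ne hdet htr
  have h2 := Real.sqrt_pos.2 (ell_disc htr)
  have := abs_pos.2 h
  simp only [ellL]
  positivity

theorem ellL_im_mul (hdet : a * d - b * c = 1) (htr : |a + d| < 2) :
    |b| * (ellL a b d).im = √(4 - (a + d) ^ 2) / 2 := by
  have h := abs_pos.2 (ell_b_ne hdet htr)
  simp only [ellL]
  field_simp

theorem ellL_normSq (hdet : a * d - b * c = 1) (htr : |a + d| < 2) :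
    b * ((ellL a b d).re ^ 2 + (ellL a b d).im ^ 2) = - c := by
  have h := (ell_b_ne hdet htr)
  simp only [ellL]
  rw [div_pow, div_pow, Real.sq_sqrt (ell_disc htr).le, mul_pow, mul_pow, sq_abs]
  field_simp
  nlinarith

theorem ellL_re (hdet : a * d - b * c = 1) (htr : |a + d| < 2) :
    2 * b * (ellL a b d).re = d - a := by
  have h := (ell_b_ne hdet htr)
  simp only [ellL]
  field_simp

theorem ellL_quad (hdet : a * d - b * c = 1) (htr : |a + d| < 2) :
    (b : ℂ) * (ellL a b d) ^ 2 + (a - d) * ellL a b d - c = 0 := by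
  have h1 := ellL_normSq hdet htr
  have h2 := ellL_re hdet htr
  apply Complex.ext
  · simp [pow_two]
    linear_combination (ellL a b d).re * h2 - h1
  · simp [pow_two]
    linear_combination (ellL a b d).im * h2

theorem ellL_den_ne (hdet : a * d - b * c = 1) (htr : |a + d| < 2) :
    (a : ℂ) + b * ellL a b d ≠ 0 := by
  intro h
  have := congrArg Complex.im h
  simp at this
  rcases this with h | h
  · exact ell_b_ne hdet htr h
  · exact (ellL_im_pos hdet htr).ne' h

theorem ellL_den_sq (hdet : a * d - b * c = 1) (htr : |a + d| < 2) :
    ((a : ℂ) + b * ellL a b d) ^ 2 ≠ 1 := by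
  intro h
  have h3 : b * (ellL a b d).im ≠ 0 := mul_ne_zero (ell_b_ne hdet htr) (ellL_im_pos hdet htr).ne'
  rcases sq_eq_sq_iff_eq_or_eq_neg.1 (h.trans (one_pow 2).symm) with h | h <;>
  · have := congrArg Complex.im h
    simp at this
    apply h3; simpa using this

end elliptic

section riccati
variable {T : Type*} {r : ℕ}

theorem riccati (hr : 0 < r) {A B C D : ℕ → T → ℝ} {a b c d : ℝ}
    (hA : OC r 0 r (fun n t => (A n t : ℂ))) (hB : OC r 0 r (fun n t => (B n t : ℂ)))
    (hC : OC r 0 r (fun n t => (C n t : ℂ))) (hD : OC r 0 r (fun n t => (D n t : ℂ)))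
    (lA : UL A a) (lB : UL B b) (lC : UL C c) (lD : UL D d)
    (hdet : a * d - b * c = 1) (htr : |a + d| < 2) :
    ∃ m, ∃ z : ℕ → T → ℂ, ∃ η : ℕ → ℝ, Summable η ∧ UL z (ellL a b d) ∧
      ∀ n t, ‖z (n + 1) t - (C (n + m) t + D (n + m) t * z n t) /
        (A (n + m) t + B (n + m) t * z n t)‖ ≤ η n := by
  have hb := ell_b_ne hdet htr
  have cst : ∀ {F : ℕ → T → ℝ} {x : ℝ}, UL F x → UL (fun n t => (F n t : ℂ)) (x : ℂ) :=
    fun h => (Complex.continuous_ofReal.tendsto _).comp h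
  have lS : UL (fun n t => 4 * (A n t * D n t - B n t * C n t) - (A n t + D n t) ^ 2)
      (4 * (a * d - b * c) - (a + d) ^ 2) :=
    (((lA.mul lD).sub (lB.mul lC)).const_mul 4).sub ((lA.add lD).pow 2)
  have hs0 : 0 < 4 * (a * d - b * c) - (a + d) ^ 2 := by
    rw [hdet, mul_one]; exact ell_disc htr
  obtain ⟨e1, he1, m1, hm1⟩ := (cst lB).lower (by exact_mod_cast hb)
  obtain ⟨m2, hm2⟩ := lS.ev (eventually_ge_nhds (half_lt_self hs0))
  have hm1' : ∀ n t, e1 ≤ ‖(B (n + (m1 + m2)) t : ℂ)‖ := by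
    intro n t
    have := hm1 (n + m2) t
    rwa [show n + m2 + m1 = n + (m1 + m2) by ring] at this
  have hm2' : ∀ n t, (4 * (a * d - b * c) - (a + d) ^ 2) / 2 ≤
      4 * (A (n + (m1 + m2)) t * D (n + (m1 + m2)) t - B (n + (m1 + m2)) t * C (n + (m1 + m2)) t)
        - (A (n + (m1 + m2)) t + D (n + (m1 + m2)) t) ^ 2 := by
    intro n t
    have := hm2 (n + m1) t
    rwa [show n + m1 + m2 = n + (m1 + m2) by ring] at this
  have sA := hA.shift (m1 + m2)
  have sB := hB.shift (m1 + m2)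
  have sC := hC.shift (m1 + m2)
  have sD := hD.shift (m1 + m2)
  have kA := lA.shift (m1 + m2)
  have kB := lB.shift (m1 + m2)
  have kC := lC.shift (m1 + m2)
  have kD := lD.shift (m1 + m2)
  have kS := lS.shift (m1 + m2)
  generalize m1 + m2 = M at *
  set A' := fun n => A (n + M)
  set B' := fun n => B (n + M)
  set C' := fun n => C (n + M)
  set D' := fun n => D (n + M)
  set S : ℕ → T → ℝ := fun n t => 4 * (A' n t * D' n t - B' n t * C' n t) - (A' n t + D' n t) ^ 2
    with hSdef
  have oS : OC r 0 r (fun n t => (S n t : ℂ)) := by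
    have := ((OC.cst (T := T) hr r 4).mul0 hr ((sA.mul0 hr sD).sub hr (sB.mul0 hr sC))).sub hr
      ((sA.add sD).mul0 hr (sA.add sD))
    convert this using 3
    simp [hSdef, pow_two, A', B', C', D']
  have oq := oS.sqrt hr (half_pos hs0) hm2'
  have oBi := sB.inv hr he1 hm1'
  obtain ⟨sg, hsg, hsb⟩ : ∃ sg : ℝ, sg ^ 2 = 1 ∧ sg * |b| = b := by
    rcases abs_choice b with h | h
    · exact ⟨1, by norm_num, by rw [h]; ring⟩
    · exact ⟨-1, by norm_num, by rw [h]; ring⟩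
  set z : ℕ → T → ℂ := fun n t => ((D' n t : ℂ) - A' n t + (sg * Complex.I) * √(S n t)) *
    ((1 / 2) * (B' n t : ℂ)⁻¹) with hz
  have oz : OC r 0 r z :=
    ((sD.sub hr sA).add ((OC.cst (T := T) hr r (sg * Complex.I)).mul0 hr oq)).mul0 hr
      ((OC.cst (T := T) hr r (1 / 2)).mul0 hr oBi)
  have lz : UL z (ellL a b d) := by
    have hl : ellL a b d = ((d : ℂ) - a + (sg * Complex.I) * √(4 * (a * d - b * c) - (a + d) ^ 2)) *
      ((1 / 2) * (b : ℂ)⁻¹) := by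
      have hbc : (b : ℂ) ≠ 0 := by exact_mod_cast hb
      have hab : |b| ≠ 0 := abs_ne_zero.2 hb
      have h3 : √(4 - (a + d) ^ 2) / (2 * |b|) = sg * √(4 - (a + d) ^ 2) / (2 * b) := by
        rw [div_eq_div_iff (by positivity) (by positivity)]
        linear_combination (-2 * √(4 - (a + d) ^ 2)) * hsb
      have : ellL a b d = (((d - a) / (2 * b) : ℝ) : ℂ) + ((√(4 - (a + d) ^ 2) / (2 * |b|) : ℝ) : ℂ) * Complex.I := by
        exact (Complex.re_add_im (ellL a b d)).symm
      rw [this, h3, hdet, mul_one]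
      push_cast
      field_simp
    rw [hl]
    have lq : UL (fun n t => √(S n t)) (√(4 * (a * d - b * c) - (a + d) ^ 2)) :=
      (Real.continuous_sqrt.tendsto _).comp kS
    exact (((cst kD).sub (cst kA)).add ((cst lq).const_mul _)).mul
      (((cst kB).inv₀ (by exact_mod_cast hb)).const_mul _)
  have fix : ∀ n t, (A' n t : ℂ) + B' n t * z n t ≠ 0 →
      ((C' n t : ℂ) + D' n t * z n t) / (A' n t + B' n t * z n t) = z n t := by
    intro n t h
    rw [div_eq_iff h]
    have hB0 : (B' n t : ℂ) ≠ 0 := norm_pos_iff.1 (he1.trans_le (hm1' n t))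
    have hq : ((√(S n t) : ℝ) : ℂ) ^ 2 = 4 * (A' n t * D' n t - B' n t * C' n t) - (A' n t + D' n t) ^ 2 := by
      rw [← Complex.ofReal_pow, Real.sq_sqrt ((half_pos hs0).le.trans (hm2' n t))]
      simp [A', B', C', D']
    have hI : (sg * Complex.I) ^ 2 = -1 := by
      rw [mul_pow, ← Complex.ofReal_pow, hsg]; simp
    have hz2 : 2 * B' n t * z n t = ((D' n t : ℂ) - A' n t + (sg * Complex.I) * √(S n t)) := by
      simp only [hz]; field_simp
    have : 4 * (B' n t : ℂ) * ((C' n t : ℂ) + D' n t * z n t - z n t * (A' n t + B' n t * z n t)) = 0 := by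
      generalize (sg * Complex.I : ℂ) = q at *
      generalize z n t = w at *
      have e1 : (2 * B' n t * w) ^ 2 = (2 * B' n t * w) ^ 2 := rfl
      have e2 : (2 * B' n t * w - (D' n t - A' n t)) ^ 2 = - ((√(S n t) : ℝ) : ℂ) ^ 2 := by
        rw [hz2]; linear_combination ((√(S n t) : ℝ) : ℂ) ^ 2 * hI
      linear_combination -e2 + hq
    have h4 : (4 * (B' n t : ℂ)) ≠ 0 := by simpa using hB0
    have := (mul_eq_zero.1 this).resolve_left h4
    linear_combination this
  have lden : UL (fun n t => (A' n t : ℂ) + B' n t * z n t) (a + b * ellL a b d) :=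
    (cst kA).add ((cst kB).mul lz)
  obtain ⟨e3, he3, m3, hm3⟩ := lden.lower (ellL_den_ne hdet htr)
  have hNW : NW r 1 (r - 1) (fun n t => (A' (n + m3) t : ℂ)) (fun n t => (B' (n + m3) t : ℂ))
      (fun n t => (C' (n + m3) t : ℂ)) (fun n t => (D' (n + m3) t : ℂ)) (ellL a b d)
      (fun n => z (n + m3)) := by
    refine ⟨(oz.weaken hr le_rfl (Nat.sub_le _ _)).shift m3, lz.shift m3, ?_⟩
    have h1 : OC r 0 (r - 1 + 1) z := by rwa [Nat.sub_add_cancel hr]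
    have := h1.delta.shift m3
    convert this using 3 with n t
    beta_reduce
    rw [fix _ _ (norm_pos_iff.1 (he3.trans_le (hm3 n t))), add_right_comm]
  have wk : ∀ {f : ℕ → T → ℂ}, OC r 0 r f → OC r 0 (r - 1) (fun n t => f (n + m3) t) :=
    fun hf => (hf.weaken hr le_rfl (Nat.sub_le _ _)).shift m3
  obtain ⟨m, y, hy⟩ := newton_iter hr (r - 1) le_rfl (wk sA) (wk sB) (wk sC) (wk sD)
    ((cst kA).shift m3) ((cst kB).shift m3) ((cst kC).shift m3) ((cst kD).shift m3)
    (by exact_mod_cast hdet) (ellL_den_ne hdet htr) (ellL_den_sq hdet htr) hNW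
  obtain ⟨-, ly, G, hG, hGs, K, hK, h⟩ := hy
  refine ⟨m + m3 + M, y, fun n => K * G n ^ r, hGs.mul_left K, ly, fun n t => ?_⟩
  have := h n t
  rw [show 1 + (r - 1) = r by omega] at this
  simpa only [A', B', C', D', add_assoc] using this
end riccati

theorem abs_log_sub_le {x y e : ℝ} (hx : 0 < x) (hy : 0 < y) (h1 : |x - y| ≤ e * x)
    (h2 : |x - y| ≤ e * y) : |Real.log x - Real.log y| ≤ e := by
  have key : ∀ {x y : ℝ}, 0 < x → 0 < y → |x - y| ≤ e * y → Real.log x - Real.log y ≤ e := by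
    intro x y hx hy h
    rw [← Real.log_div hx.ne' hy.ne']
    refine (Real.log_le_sub_one_of_pos (div_pos hx hy)).trans ?_
    rw [div_sub_one hy.ne', div_le_iff₀ hy]
    exact (le_abs_self _).trans h
  rw [abs_sub_le_iff]
  exact ⟨key hx hy h2, key hy hx (by rwa [abs_sub_comm])⟩

theorem im_mul_le_norm_Y (z : ℂ) (hz : 0 ≤ z.im) (u1 u2 : ℝ) :
    z.im * |u1| ≤ ‖(u2 : ℂ) - z * u1‖ := by
  have := Complex.abs_im_le_norm ((u2 : ℂ) - z * u1)
  simp at this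
  rwa [abs_of_nonneg hz] at this

theorem Y_ne (z : ℂ) (hz : 0 < z.im) (u1 u2 : ℝ) (hu : u1 ≠ 0 ∨ u2 ≠ 0) :
    (u2 : ℂ) - z * u1 ≠ 0 := by
  intro h
  have h1 := congrArg Complex.im h
  simp at h1
  have h2 : u1 = 0 := h1.resolve_left hz.ne'
  subst h2
  simp at h
  rcases hu with h' | h' <;> simp_all

theorem energy_step {A B C D u1 u2 W W' i0 e : ℝ} {z z' : ℂ} (hdet : 0 < A * D - B * C)
    (hi : 0 < i0) (hz : i0 ≤ z.im) (hz' : i0 ≤ z'.im) (he : e ≤ i0 / 2)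
    (hzz : ‖z' - (C + D * z) / (A + B * z)‖ ≤ e) (hW : 0 < W) (hW' : 0 < W')
    (hWW : W' * (A * D - B * C) = W) (hu : u1 ≠ 0 ∨ u2 ≠ 0) :
    |(Real.log W' + 2 * Real.log ‖((C * u1 + D * u2 : ℝ) : ℂ) - z' * ((A * u1 + B * u2 : ℝ) : ℂ)‖
        - Real.log z'.im) - (Real.log W + 2 * Real.log ‖(u2 : ℂ) - z * u1‖ - Real.log z.im)| ≤
      6 / i0 * e := by
  have hzi : 0 < z.im := hi.trans_le hz
  have hden : (A : ℂ) + B * z ≠ 0 := by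
    intro h
    have h1 := congrArg Complex.im h
    have h2 := congrArg Complex.re h
    simp at h1 h2
    have h3 : B = 0 := h1.resolve_right hzi.ne'
    subst h3
    simp at h2
    subst h2
    simp at hdet
  set zs : ℂ := (C + D * z) / (A + B * z) with hzs
  have hnd : 0 < Complex.normSq ((A : ℂ) + B * z) := Complex.normSq_pos.2 hden
  have him : zs.im = (A * D - B * C) * z.im / Complex.normSq ((A : ℂ) + B * z) := by
    rw [hzs, Complex.div_im]
    field_simp
    simp
    ring
  have hzs2 : i0 / 2 ≤ zs.im := by
    have := (Complex.abs_im_le_norm (z' - zs)).trans hzz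
    simp at this
    have := (abs_le.1 this).2
    linarith
  set v1 := A * u1 + B * u2 with hv1
  set v2 := C * u1 + D * u2 with hv2
  have hv : v1 ≠ 0 ∨ v2 ≠ 0 := by
    by_contra! h
    have e1 : (A * D - B * C) * u1 = 0 := by linear_combination D * h.1 - B * h.2
    have e2 : (A * D - B * C) * u2 = 0 := by linear_combination A * h.2 - C * h.1
    have := (mul_eq_zero.1 e1).resolve_left hdet.ne'
    have := (mul_eq_zero.1 e2).resolve_left hdet.ne'
    tauto
  have hY0 := Y_ne z hzi u1 u2 hu
  have hY1 := Y_ne z' (by linarith) v1 v2 hv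
  have hYs := Y_ne zs (by linarith) v1 v2 hv
  have hrel : ((v2 : ℂ) - zs * v1) * (A + B * z) = ((A * D - B * C : ℝ) : ℂ) * (u2 - z * u1) := by
    have h1 : zs * (A + B * z) = C + D * z := by rw [hzs]; exact div_mul_cancel₀ _ hden
    rw [hv1, hv2]
    push_cast
    linear_combination (-((A : ℂ) * u1 + B * u2)) * h1
  have hlog1 : 2 * Real.log ‖(v2 : ℂ) - zs * v1‖ + Real.log (Complex.normSq ((A : ℂ) + B * z))
      = 2 * Real.log (A * D - B * C) + 2 * Real.log ‖(u2 : ℂ) - z * u1‖ := by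
    have h1 := congrArg (fun c => Real.log ‖c‖) hrel
    simp only [norm_mul, Complex.norm_real, Real.norm_eq_abs, abs_of_pos hdet] at h1
    rw [Real.log_mul (norm_ne_zero_iff.2 hYs) (norm_ne_zero_iff.2 hden),
      Real.log_mul hdet.ne' (norm_ne_zero_iff.2 hY0)] at h1
    rw [Complex.normSq_eq_norm_sq, Real.log_pow]
    push_cast
    linarith
  have hlog2 : Real.log zs.im = Real.log (A * D - B * C) + Real.log z.im -
      Real.log (Complex.normSq ((A : ℂ) + B * z)) := by
    rw [him, Real.log_div (by positivity) hnd.ne', Real.log_mul hdet.ne' hzi.ne']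
  have hlog3 : Real.log W = Real.log W' + Real.log (A * D - B * C) := by
    rw [← hWW, Real.log_mul hW'.ne' hdet.ne']
  have heq : (Real.log W' + 2 * Real.log ‖(v2 : ℂ) - z' * v1‖
        - Real.log z'.im) - (Real.log W + 2 * Real.log ‖(u2 : ℂ) - z * u1‖ - Real.log z.im) =
      2 * (Real.log ‖(v2 : ℂ) - z' * v1‖ - Real.log ‖(v2 : ℂ) - zs * v1‖) -
        (Real.log z'.im - Real.log zs.im) := by
    linarith
  rw [heq]
  have he0 : 0 ≤ e := (norm_nonneg _).trans hzz
  have g1 : |‖(v2 : ℂ) - z' * v1‖ - ‖(v2 : ℂ) - zs * v1‖| ≤ e * |v1| := by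
    refine (abs_norm_sub_norm_le _ _).trans ?_
    have : (v2 : ℂ) - z' * v1 - (v2 - zs * v1) = -((z' - zs) * v1) := by ring
    rw [this, norm_neg, norm_mul, Complex.norm_real, Real.norm_eq_abs]
    gcongr
  have g2 : ∀ {w : ℂ}, i0 / 2 ≤ w.im → e * |v1| ≤ (2 / i0 * e) * ‖(v2 : ℂ) - w * v1‖ := by
    intro w hw
    have h1 := im_mul_le_norm_Y w (by linarith) v1 v2
    have h2 : i0 / 2 * |v1| ≤ ‖(v2 : ℂ) - w * v1‖ := le_trans (by gcongr) h1
    calc e * |v1| = (2 / i0 * e) * (i0 / 2 * |v1|) := by field_simp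
      _ ≤ _ := by gcongr
  have k1 := abs_log_sub_le (norm_pos_iff.2 hY1) (norm_pos_iff.2 hYs)
    (g1.trans (g2 (by linarith))) (g1.trans (g2 hzs2))
  have g3 : |z'.im - zs.im| ≤ e := by
    have := (Complex.abs_im_le_norm (z' - zs)).trans hzz
    simpa using this
  have g4 : ∀ {y : ℝ}, i0 / 2 ≤ y → e ≤ (2 / i0 * e) * y := by
    intro y hy
    calc e = (2 / i0 * e) * (i0 / 2) := by field_simp
      _ ≤ _ := by gcongr
  have k2 := abs_log_sub_le (show 0 < z'.im by linarith) (show 0 < zs.im by linarith)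
    (g3.trans (g4 (by linarith))) (g3.trans (g4 hzs2))
  have : 6 / i0 * e = 2 * (2 / i0 * e) + 2 / i0 * e := by ring
  rw [this]
  rw [abs_le] at *
  constructor <;> linarith [k1.1, k1.2, k2.1, k2.2]

section energy
variable {T : Type*} {r : ℕ}

theorem energy (hr : 0 < r) {A B C D : ℕ → T → ℝ} {a b c d : ℝ}
    (hA : OC r 0 r (fun n t => (A n t : ℂ))) (hB : OC r 0 r (fun n t => (B n t : ℂ)))
    (hC : OC r 0 r (fun n t => (C n t : ℂ))) (hD : OC r 0 r (fun n t => (D n t : ℂ)))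
    (lA : UL A a) (lB : UL B b) (lC : UL C c) (lD : UL D d)
    (hdet : a * d - b * c = 1) (htr : |a + d| < 2)
    (W : ℕ → ℝ) (u1 u2 : ℕ → T → ℝ) (hW : ∀ n, 0 < W n)
    (hpos : ∀ n t, 0 < A n t * D n t - B n t * C n t)
    (hWW : ∀ n t, W (n + 1) * (A n t * D n t - B n t * C n t) = W n)
    (h1 : ∀ n t, u1 (n + 1) t = A n t * u1 n t + B n t * u2 n t)
    (h2 : ∀ n t, u2 (n + 1) t = C n t * u1 n t + D n t * u2 n t)
    (hu : ∀ n t, u1 n t ≠ 0 ∨ u2 n t ≠ 0) :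
    ∃ e : T → ℝ, TendstoUniformly
      (fun n t => Real.log (W n) + 2 * Real.log ‖(u2 n t : ℂ) - ellL a b d * u1 n t‖) e atTop := by
  obtain ⟨m, z, η, hη, hz, hst⟩ := riccati hr hA hB hC hD lA lB lC lD hdet htr
  have hi := ellL_im_pos hdet htr
  set l := ellL a b d with hl
  set i0 := l.im / 2 with hi0
  have hi0p : 0 < i0 := by positivity
  obtain ⟨m1, hm1⟩ := hz.ev ((Complex.continuous_im.tendsto l).eventually
    (eventually_ge_nhds (half_lt_self hi)))
  obtain ⟨m2, hm2⟩ := (hη.tendsto_atTop_zero.eventually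
    (eventually_le_nhds (half_pos hi0p))).exists_forall_of_atTop
  set q := m1 + m2 with hq
  have zi : ∀ n t, i0 ≤ (z (n + q) t).im := fun n t => by
    have := hm1 (n + m2) t
    rwa [show n + m2 + m1 = n + q by omega] at this
  have hηi : ∀ n, η (n + q) ≤ i0 / 2 := fun n => hm2 _ (by omega)
  let L : ℕ → T → ℝ := fun n t => Real.log (W (n + q + m)) +
    2 * Real.log ‖(u2 (n + q + m) t : ℂ) - z (n + q) t * u1 (n + q + m) t‖
      - Real.log (z (n + q) t).im
  have hL : ∀ n t, |L (n + 1) t - L n t| ≤ 6 / i0 * η (n + q) := by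
    intro n t
    have := energy_step (hpos (n + q + m) t) hi0p (zi n t) (zi (n + 1) t) (hηi n)
      (by have := hst (n + q) t; rwa [show n + q + 1 = n + 1 + q by ring] at this)
      (hW _) (hW (n + q + m + 1)) (hWW _ t) (hu (n + q + m) t)
    rw [← h1, ← h2] at this
    simp only [L]
    rwa [show n + 1 + q + m = n + q + m + 1 by ring]
  have hsum : Summable fun n => 6 / i0 * η (n + q) :=
    ((summable_nat_add_iff q).2 hη).mul_left _
  have hu1 := tendstoUniformly_tsum_nat hsum (f := fun n t => L (n + 1) t - L n t)
    (fun n t => hL n t)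
  have hu2 : TendstoUniformly L (fun t => L 0 t + ∑' n, (L (n + 1) t - L n t)) atTop := by
    rw [Metric.tendstoUniformly_iff] at hu1 ⊢
    intro ε hε
    filter_upwards [hu1 ε hε] with n hn t
    have := hn t
    rw [Finset.sum_range_sub (fun n => L n t)] at this
    rw [Real.dist_eq] at this ⊢
    convert this using 2
    ring
  refine ⟨fun t => L 0 t + ∑' n, (L (n + 1) t - L n t) + Real.log l.im, ?_⟩
  rw [Metric.tendstoUniformly_iff] at hu2 ⊢
  intro ε hε
  have hsmall : ∀ᶠ n in atTop, ∀ t, ‖z n t - l‖ < ε * i0 / 6 := by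
    have h3 := hz.ev (Metric.ball_mem_nhds l (show 0 < ε * i0 / 6 by positivity))
    obtain ⟨m3, h3⟩ := h3
    filter_upwards [eventually_ge_atTop m3] with n hn t
    have := h3 (n - m3) t
    rwa [Nat.sub_add_cancel hn, dist_eq_norm] at this
  have hfin : ∀ᶠ n in atTop, ∀ t, dist (L 0 t + ∑' n, (L (n + 1) t - L n t) + Real.log l.im)
      (Real.log (W (n + (q + m))) + 2 * Real.log ‖(u2 (n + (q + m)) t : ℂ) -
        l * u1 (n + (q + m)) t‖) < ε := by
    filter_upwards [hu2 (ε / 4) (by positivity), (tendsto_add_atTop_nat q).eventually hsmall]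
      with n hn hs t
    have f1 := hn t
    have f2 := hs t
    have f3 := zi n t
    rw [← add_assoc]
    rw [Real.dist_eq] at f1 ⊢
    simp only [L] at f1
    generalize (L 0 t + ∑' n, (L (n + 1) t - L n t)) = S at *
    generalize hv1 : u1 (n + q + m) t = v1 at *
    generalize hv2 : u2 (n + q + m) t = v2 at *
    have hv : v1 ≠ 0 ∨ v2 ≠ 0 := by rw [← hv1, ← hv2]; exact hu _ _
    generalize z (n + q) t = y at *
    have g1 : |‖(v2 : ℂ) - y * v1‖ - ‖(v2 : ℂ) - l * v1‖| ≤ (ε * i0 / 6) * |v1| := by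
      refine (abs_norm_sub_norm_le _ _).trans ?_
      have : (v2 : ℂ) - y * v1 - (v2 - l * v1) = -((y - l) * v1) := by ring
      rw [this, norm_neg, norm_mul, Complex.norm_real, Real.norm_eq_abs]
      gcongr
    have g2 : ∀ {w : ℂ}, i0 ≤ w.im → (ε * i0 / 6) * |v1| ≤ (ε / 6) * ‖(v2 : ℂ) - w * v1‖ := by
      intro w hw
      have h1 := im_mul_le_norm_Y w (by linarith) v1 v2
      have h2 : i0 * |v1| ≤ ‖(v2 : ℂ) - w * v1‖ := le_trans (by gcongr) h1
      calc (ε * i0 / 6) * |v1| = (ε / 6) * (i0 * |v1|) := by ring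
        _ ≤ _ := by gcongr
    have hli : i0 ≤ l.im := by linarith
    have k1 := abs_log_sub_le (norm_pos_iff.2 (Y_ne y (by linarith) v1 v2 hv))
      (norm_pos_iff.2 (Y_ne l hi v1 v2 hv)) (g1.trans (g2 f3)) (g1.trans (g2 hli))
    have g3 : |y.im - l.im| ≤ ε * i0 / 6 := by
      have := (Complex.abs_im_le_norm (y - l)).trans f2.le
      simpa using this
    have g4 : ∀ {w : ℝ}, i0 ≤ w → ε * i0 / 6 ≤ (ε / 6) * w := by
      intro w hw
      calc ε * i0 / 6 = ε / 6 * i0 := by ring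
        _ ≤ _ := by gcongr
    have k2 := abs_log_sub_le (show 0 < y.im by linarith) hi (g3.trans (g4 f3)) (g3.trans (g4 hli))
    rw [abs_le] at k1 k2
    rw [abs_lt] at f1 ⊢
    constructor <;> linarith [k1.1, k1.2, k2.1, k2.2, f1.1, f1.2]
  rw [eventually_atTop] at hfin ⊢
  obtain ⟨n0, hn0⟩ := hfin
  refine ⟨n0 + (q + m), fun n hn t => ?_⟩
  have := hn0 (n - (q + m)) (by omega) t
  rwa [Nat.sub_add_cancel (by omega)] at this

end energy

/-- Bundle of the hypotheses on the Jacobi parameters. -/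
structure JM (N r : ℕ) (a b : ℕ → ℝ) (α β : ℤ → ℝ) : Prop where
  hN : 0 < N
  hr : 0 < r
  ha : ∀ n, 0 < a n
  hα : ∀ n, 0 < α n
  hαper : ∀ n : ℤ, α (n + N) = α n
  hβper : ∀ n : ℤ, β (n + N) = β n
  hmod_a : Tendsto a atTop atTop
  hmod_r : Tendsto (fun n : ℕ =>
      |a n / a (n + 1) - α (n : ℤ) / α ((n : ℤ) + 1)|) atTop (𝓝 0)
  hmod_b : Tendsto (fun n : ℕ =>
      |b n / a n - β (n : ℤ) / α (n : ℤ)|) atTop (𝓝 0)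
  hD1 : ∀ i < N, memD r (fun k => a ((k + 1) * N + i - 1) / a ((k + 1) * N + i))
  hD2 : ∀ i < N, memD r (fun k => b ((k + 1) * N + i) / a ((k + 1) * N + i))
  hD3 : ∀ i < N, memD r (fun k => 1 / a ((k + 1) * N + i))
  hCarleman : Tendsto (fun n : ℕ => ∑ k ∈ Finset.range n, 1 / a k) atTop atTop
  htr : |Matrix.trace (frakX0 α β N 0)| < 2

theorem opoly_rec {a b : ℕ → ℝ} (ha : ∀ n, 0 < a n) (n : ℕ) (x : ℝ) :
    a (n + 1) * opoly a b (n + 2) x =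
      (x - b (n + 1)) * opoly a b (n + 1) x - a n * opoly a b n x := by
  rw [opoly, mul_div_cancel₀ _ (ha _).ne']

theorem opoly_rec' {a b : ℕ → ℝ} (ha : ∀ n, 0 < a n) {n : ℕ} (hn : 0 < n) (x : ℝ) :
    opoly a b (n + 1) x =
      -(a (n - 1) / a n) * opoly a b (n - 1) x + (x - b n) / a n * opoly a b n x := by
  obtain ⟨n, rfl⟩ : ∃ m, n = m + 1 := ⟨n - 1, by omega⟩
  have := opoly_rec (b := b) ha n x
  have h := (ha (n + 1)).ne'
  simp only [Nat.add_sub_cancel]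
  field_simp
  linarith

theorem opoly_cont (a b : ℕ → ℝ) (n : ℕ) : Continuous (opoly a b n) := by
  induction n using Nat.strong_induction_on with
  | _ n ih =>
    match n, ih with
    | 0, _ => exact continuous_const
    | 1, _ => show Continuous fun x => (x - b 0) / a 0
              fun_prop
    | n + 2, ih =>
      have h1 := ih n (by omega)
      have h2 := ih (n + 1) (by omega)
      show Continuous fun x => ((x - b (n + 1)) * opoly a b (n + 1) x - a n * opoly a b n x) / a (n + 1)
      fun_prop

theorem opoly_ne {a b : ℕ → ℝ} (ha : ∀ n, 0 < a n) (n : ℕ) (x : ℝ) :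
    opoly a b n x ≠ 0 ∨ opoly a b (n + 1) x ≠ 0 := by
  induction n with
  | zero => left; simp [opoly]
  | succ n ih =>
    by_contra! h
    have := opoly_rec (b := b) ha n x
    rw [h.1, h.2] at this
    simp [(ha n).ne'] at this
    rcases ih with h' | h'
    · exact h' this
    · exact h' h.1

def tp (a b : ℕ → ℝ) (N k : ℕ) (x : ℝ) : ℕ → Mat2
  | 0 => 1
  | (len + 1) => !![0, 1; -(a ((k + 1) * N + len - 1) / a ((k + 1) * N + len)),
      (x - b ((k + 1) * N + len)) / a ((k + 1) * N + len)] * tp a b N k x len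

/-- The limiting transfer matrix. -/
def lm (α β : ℤ → ℝ) (len : ℕ) : Mat2 := prodDZ (fun j => frakB α β j 0) 0 len

section tp
variable {N r : ℕ} {a b : ℕ → ℝ} {α β : ℤ → ℝ}

theorem tp_zero_row (k : ℕ) (x : ℝ) (len : ℕ) (j : Fin 2) :
    tp a b N k x (len + 1) 0 j = tp a b N k x len 1 j := by
  simp [tp, Matrix.mul_apply, Fin.sum_univ_two]

theorem tp_one_row (k : ℕ) (x : ℝ) (len : ℕ) (j : Fin 2) :
    tp a b N k x (len + 1) 1 j =
      -(a ((k + 1) * N + len - 1) / a ((k + 1) * N + len)) * tp a b N k x len 0 j +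
      (x - b ((k + 1) * N + len)) / a ((k + 1) * N + len) * tp a b N k x len 1 j := by
  simp [tp, Matrix.mul_apply, Fin.sum_univ_two]

theorem lm_zero_row (len : ℕ) (j : Fin 2) :
    lm α β (len + 1) 0 j = lm α β len 1 j := by
  simp [lm, prodDZ, frakB, Matrix.mul_apply, Fin.sum_univ_two]

theorem lm_one_row (len : ℕ) (j : Fin 2) :
    lm α β (len + 1) 1 j = -(α ((len : ℤ) - 1) / α len) * lm α β len 0 j +
      (0 - β len / α len) * lm α β len 1 j := by
  simp [lm, prodDZ, frakB, Matrix.mul_apply, Fin.sum_univ_two]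
  ring

theorem JM.αk (h : JM N r a b α β) (k : ℕ) (n : ℤ) : α (n + (k * N : ℕ)) = α n := by
  have := (Function.Periodic.nat_mul (f := α) (c := (N : ℤ)) h.hαper k) n
  push_cast
  exact this

theorem JM.βk (h : JM N r a b α β) (k : ℕ) (n : ℤ) : β (n + (k * N : ℕ)) = β n := by
  have := (Function.Periodic.nat_mul (f := β) (c := (N : ℤ)) h.hβper k) n
  push_cast
  exact this

theorem JM.kN (h : JM N r a b α β) (i : ℕ) : Tendsto (fun k : ℕ => (k + 1) * N + i) atTop atTop := by
  refine tendsto_atTop_mono (fun k => ?_) tendsto_id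
  have := h.hN
  show k ≤ (k + 1) * N + i
  nlinarith

theorem JM.kN1 (h : JM N r a b α β) (i : ℕ) :
    Tendsto (fun k : ℕ => (k + 1) * N + i - 1) atTop atTop := by
  refine tendsto_atTop_mono (fun k => ?_) tendsto_id
  have := h.hN
  show k ≤ (k + 1) * N + i - 1
  have : k + 1 ≤ (k + 1) * N + i := by nlinarith
  omega

theorem JM.kNpos (h : JM N r a b α β) (k : ℕ) : 0 < (k + 1) * N := by
  have := h.hN; positivity

theorem JM.lim_a (h : JM N r a b α β) (i : ℕ) :
    Tendsto (fun k : ℕ => a ((k + 1) * N + i - 1) / a ((k + 1) * N + i)) atTop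
      (𝓝 (α ((i : ℤ) - 1) / α i)) := by
  have h1 := (tendsto_zero_iff_abs_tendsto_zero _).2 h.hmod_r
  have h2 := (h1.comp (h.kN1 i)).add_const (α ((i : ℤ) - 1) / α i)
  rw [zero_add] at h2
  refine h2.congr fun k => ?_
  have hp := h.kNpos k
  have e1 : (((k + 1) * N + i - 1 : ℕ) : ℤ) = ((i : ℤ) - 1) + ((k + 1) * N : ℕ) := by
    push_cast [Nat.cast_sub (show 1 ≤ (k + 1) * N + i by omega)]
    ring
  have e2 : (((k + 1) * N + i - 1 : ℕ) : ℤ) + 1 = (i : ℤ) + ((k + 1) * N : ℕ) := by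
    rw [e1]; ring
  simp only [Function.comp]
  rw [e2, h.αk, e1, h.αk, show (k + 1) * N + i - 1 + 1 = (k + 1) * N + i by omega]
  ring

theorem JM.lim_b (h : JM N r a b α β) (i : ℕ) :
    Tendsto (fun k : ℕ => b ((k + 1) * N + i) / a ((k + 1) * N + i)) atTop
      (𝓝 (β i / α i)) := by
  have h1 := (tendsto_zero_iff_abs_tendsto_zero _).2 h.hmod_b
  have h2 := (h1.comp (h.kN i)).add_const (β i / α i)
  rw [zero_add] at h2
  refine h2.congr fun k => ?_
  have e1 : (((k + 1) * N + i : ℕ) : ℤ) = (i : ℤ) + ((k + 1) * N : ℕ) := by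
    push_cast; ring
  simp only [Function.comp]
  rw [e1, h.αk, h.βk]
  ring

theorem JM.lim_inv (h : JM N r a b α β) (i : ℕ) :
    Tendsto (fun k : ℕ => 1 / a ((k + 1) * N + i)) atTop (𝓝 0) := by
  have := (tendsto_inv_atTop_zero.comp h.hmod_a).comp (h.kN i)
  simpa [Function.comp_def] using this

theorem tp_OC (h : JM N r a b α β) (M : ℝ) (len : ℕ) (hl : len ≤ N) (i j : Fin 2) :
    OC r 0 r (fun k (t : {x : ℝ // |x| ≤ M}) => (tp a b N k t len i j : ℂ)) := by
  induction len generalizing i j with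
  | zero => exact OC.cst h.hr r (((1 : Mat2) i j : ℝ) : ℂ)
  | succ len ih =>
    have hlt : len < N := hl
    have ih := ih hlt.le
    match i with
    | 0 => simp only [tp_zero_row]; exact ih 1 j
    | 1 =>
      simp only [tp_one_row]
      have o1 := OC.of_memD (T := {x : ℝ // |x| ≤ M}) h.hr (h.hD1 len hlt)
      have o2 := OC.of_memD (T := {x : ℝ // |x| ≤ M}) h.hr (h.hD2 len hlt)
      have o3 := OC.of_memD (T := {x : ℝ // |x| ≤ M}) h.hr (h.hD3 len hlt)
      have oc : OC r 0 r (fun (_ : ℕ) (t : {x : ℝ // |x| ≤ M}) => ((t : ℝ) : ℂ)) :=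
        OC.const h.hr r (C := M) (fun t => by simpa using t.2)
      have := ((o1.neg h.hr).mul0 h.hr (ih 0 j)).add
        (((oc.mul0 h.hr o3).sub h.hr o2).mul0 h.hr (ih 1 j))
      convert this using 3
      push_cast
      ring

theorem UL.of_tendsto {T : Type*} {f : ℕ → ℝ} {c : ℝ} (h : Tendsto f atTop (𝓝 c)) :
    UL (fun n (_ : T) => f n) c := h.comp tendsto_fst

theorem tp_UL (h : JM N r a b α β) (M : ℝ) (len : ℕ) (i j : Fin 2) :
    UL (fun k (t : {x : ℝ // |x| ≤ M}) => tp a b N k t len i j) (lm α β len i j) := by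
  induction len generalizing i j with
  | zero => exact tendsto_const_nhds
  | succ len ih =>
    match i with
    | 0 => simp only [tp_zero_row, lm_zero_row]; exact ih 1 j
    | 1 =>
      simp only [tp_one_row, lm_one_row]
      have o1 := UL.of_tendsto (T := {x : ℝ // |x| ≤ M}) (h.lim_a len)
      have o2 := UL.of_tendsto (T := {x : ℝ // |x| ≤ M}) (h.lim_b len)
      have o3 : UL (fun k (t : {x : ℝ // |x| ≤ M}) => (t : ℝ) * (1 / a ((k + 1) * N + len))) 0 := by
        have h1 := UL.of_tendsto (T := {x : ℝ // |x| ≤ M}) ((h.lim_inv len).const_mul M)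
        rw [mul_zero] at h1
        refine squeeze_zero_norm (fun p => ?_) h1
        rw [norm_mul, Real.norm_eq_abs, Real.norm_eq_abs,
          abs_of_pos (one_div_pos.2 (h.ha ((p.1 + 1) * N + len)))]
        have := (one_div_pos.2 (h.ha ((p.1 + 1) * N + len))).le
        exact mul_le_mul_of_nonneg_right p.2.2 this
      have := (o1.neg.mul (ih 0 j)).add ((o3.sub o2).mul (ih 1 j))
      refine Tendsto.congr (fun p => ?_) this
      ring

theorem tp_det (h : JM N r a b α β) (k : ℕ) (x : ℝ) (len : ℕ) :
    (tp a b N k x len).det = a ((k + 1) * N - 1) / a ((k + 1) * N + len - 1) := by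
  have hp := h.kNpos k
  induction len with
  | zero =>
    rw [add_zero, div_self (h.ha _).ne']; simp [tp]
  | succ len ih =>
    rw [tp, Matrix.det_mul, ih, Matrix.det_fin_two_of,
      show (k + 1) * N + (len + 1) - 1 = (k + 1) * N + len by omega]
    have h1 := (h.ha ((k + 1) * N + len)).ne'
    have h2 := (h.ha ((k + 1) * N + len - 1)).ne'
    field_simp
    ring

theorem lm_det (h : JM N r a b α β) (len : ℕ) :
    (lm α β len).det = α (-1) / α ((len : ℤ) - 1) := by
  induction len with
  | zero => simp [lm, prodDZ, div_self (h.hα (-1)).ne']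
  | succ len ih =>
    have h1 := (h.hα len).ne'
    have h2 := (h.hα ((len : ℤ) - 1)).ne'
    have : (lm α β (len + 1)) = frakB α β (0 + len) 0 * lm α β len := rfl
    rw [this, Matrix.det_mul, ih, frakB, Matrix.det_fin_two_of]
    push_cast
    rw [zero_add, add_sub_cancel_right]
    field_simp
    ring

theorem lm_det_N (h : JM N r a b α β) : (lm α β N).det = 1 := by
  rw [lm_det h, show ((N : ℤ) - 1) = -1 + N by ring, h.hαper, div_self (h.hα _).ne']

theorem tp_mul (h : JM N r a b α β) (k : ℕ) (x : ℝ) (len : ℕ) :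
    tp a b N k x len 0 0 * opoly a b ((k + 1) * N - 1) x +
      tp a b N k x len 0 1 * opoly a b ((k + 1) * N) x = opoly a b ((k + 1) * N + len - 1) x ∧
    tp a b N k x len 1 0 * opoly a b ((k + 1) * N - 1) x +
      tp a b N k x len 1 1 * opoly a b ((k + 1) * N) x = opoly a b ((k + 1) * N + len) x := by
  have hp := h.kNpos k
  induction len with
  | zero => simp [tp]
  | succ len ih =>
    simp only [tp_zero_row, tp_one_row]
    rw [show (k + 1) * N + (len + 1) - 1 = (k + 1) * N + len by omega,
      show (k + 1) * N + (len + 1) = (k + 1) * N + len + 1 by omega,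
      opoly_rec' (b := b) h.ha (show 0 < (k + 1) * N + len by omega), ← ih.1, ← ih.2]
    exact ⟨rfl, by ring⟩

/-- fixed point for the application -/
def ell (α β : ℤ → ℝ) (N : ℕ) : ℂ := ellL (lm α β N 0 0) (lm α β N 0 1) (lm α β N 1 1)

theorem JM.det' (h : JM N r a b α β) :
    lm α β N 0 0 * lm α β N 1 1 - lm α β N 0 1 * lm α β N 1 0 = 1 := by
  rw [← Matrix.det_fin_two]; exact lm_det_N h

theorem JM.tr' (h : JM N r a b α β) : |lm α β N 0 0 + lm α β N 1 1| < 2 := by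
  rw [← Matrix.trace_fin_two]; exact h.htr

theorem JM.ell_im (h : JM N r a b α β) : 0 < (ell α β N).im := ellL_im_pos h.det' h.tr'

def yy (a b : ℕ → ℝ) (α β : ℤ → ℝ) (N k : ℕ) (x : ℝ) : ℂ :=
  (opoly a b ((k + 1) * N) x : ℂ) - ell α β N * opoly a b ((k + 1) * N - 1) x

theorem yy_ne (h : JM N r a b α β) (k : ℕ) (x : ℝ) : yy a b α β N k x ≠ 0 := by
  refine Y_ne _ h.ell_im _ _ ?_
  have := opoly_ne (b := b) h.ha ((k + 1) * N - 1) x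
  rwa [Nat.sub_add_cancel (h.kNpos k)] at this

theorem log_conv (h : JM N r a b α β) (M : ℝ) : ∃ e : {x : ℝ // |x| ≤ M} → ℝ, TendstoUniformly
      (fun k (t : {x : ℝ // |x| ≤ M}) => Real.log (a ((k + 1) * N - 1)) +
        2 * Real.log ‖yy a b α β N k t‖) e atTop := by
  have hk : ∀ k, (k + 1) * N + N = (k + 1 + 1) * N := fun k => by ring
  refine energy h.hr (tp_OC h M N le_rfl 0 0) (tp_OC h M N le_rfl 0 1)
    (tp_OC h M N le_rfl 1 0) (tp_OC h M N le_rfl 1 1) (tp_UL h M N 0 0) (tp_UL h M N 0 1)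
    (tp_UL h M N 1 0) (tp_UL h M N 1 1) h.det' h.tr' (fun k => a ((k + 1) * N - 1))
    (fun k t => opoly a b ((k + 1) * N - 1) t) (fun k t => opoly a b ((k + 1) * N) t)
    (fun _ => h.ha _) ?_ ?_ ?_ ?_ ?_
  · intro n t
    rw [← Matrix.det_fin_two, tp_det h]
    exact div_pos (h.ha _) (h.ha _)
  · intro n t
    rw [← Matrix.det_fin_two, tp_det h, hk, mul_div_cancel₀ _ (h.ha _).ne']
  · intro n t
    have := (tp_mul h n t N).1
    rw [hk] at this
    exact this.symm
  · intro n t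
    have := (tp_mul h n t N).2
    rw [hk] at this
    exact this.symm
  · intro n t
    have := opoly_ne (b := b) h.ha ((n + 1) * N - 1) t
    rwa [Nat.sub_add_cancel (h.kNpos n)] at this

end tp

/-- Continuous convergence. -/
def CC (F : ℕ → ℝ → ℝ) (g : ℝ → ℝ) : Prop :=
  ∀ x, Tendsto (fun p : ℕ × ℝ => F p.1 p.2) (atTop ×ˢ 𝓝 x) (𝓝 (g x))

theorem CC.of_tlu {F : ℕ → ℝ → ℝ} {g : ℝ → ℝ} (h : TendstoLocallyUniformly F g atTop)
    (hg : Continuous g) : CC F g := by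
  intro x
  rw [tendstoLocallyUniformly_iff_forall_tendsto] at h
  exact Filter.Tendsto.congr_uniformity (((hg.tendsto x).comp tendsto_snd)) (h x)

theorem CC.to_tlu {F : ℕ → ℝ → ℝ} {g : ℝ → ℝ} (h : CC F g)
    (hg : Continuous g) : TendstoLocallyUniformly F g atTop := by
  rw [tendstoLocallyUniformly_iff_forall_tendsto]
  intro x
  exact ((((hg.tendsto x).comp tendsto_snd)).prodMk_nhds (h x)).mono_right (nhds_le_uniformity _)

theorem main_conv {N r : ℕ} {a b : ℕ → ℝ} {α β : ℤ → ℝ} (h : JM N r a b α β) :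
    ∃ g : ℝ → ℝ, Continuous g ∧ (∀ x, 0 < g x) ∧
      CC (fun k x => a ((k + 1) * N - 1) * ‖yy a b α β N k x‖ ^ 2 / (ell α β N).im) g := by
  choose e he using log_conv h
  set F : ℕ → ℝ → ℝ := fun k t => Real.log (a ((k + 1) * N - 1)) + 2 * Real.log ‖yy a b α β N k t‖
    with hF
  set G : ℝ → ℝ := fun x => e |x| ⟨x, le_rfl⟩ with hG
  have hp : ∀ x, Tendsto (fun n => F n x) atTop (𝓝 (G x)) := fun x =>
    (he |x|).tendsto_at ⟨x, le_rfl⟩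
  have heq : ∀ M (t : {x : ℝ // |x| ≤ M}), e M t = G t := fun M t =>
    tendsto_nhds_unique ((he M).tendsto_at t) (hp t)
  have hcF : ∀ n, Continuous (F n) := by
    intro n
    have : Continuous fun x => yy a b α β N n x := by
      have h1 := opoly_cont a b ((n + 1) * N)
      have h2 := opoly_cont a b ((n + 1) * N - 1)
      unfold yy
      fun_prop
    have h3 : ∀ x, ‖yy a b α β N n x‖ ≠ 0 := fun x => norm_ne_zero_iff.2 (yy_ne h n x)
    simp only [hF]
    exact continuous_const.add (continuous_const.mul (this.norm.log h3))
  have hT : TendstoLocallyUniformly F G atTop := by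
    rw [Metric.tendstoLocallyUniformly_iff]
    intro ε hε x
    refine ⟨Metric.ball x 1, Metric.ball_mem_nhds x one_pos, ?_⟩
    filter_upwards [Metric.tendstoUniformly_iff.1 (he (|x| + 1)) ε hε] with n hn y hy
    have hy' : |y| ≤ |x| + 1 := by
      rw [Metric.mem_ball, Real.dist_eq] at hy
      have := abs_sub_abs_le_abs_sub y x
      linarith
    have := hn ⟨y, hy'⟩
    rwa [heq] at this
  have hGc : Continuous G := hT.continuous (Frequently.of_forall hcF)
  have hC := CC.of_tlu hT hGc
  refine ⟨fun x => Real.exp (G x) / (ell α β N).im, by fun_prop, fun x => ?_, fun x => ?_⟩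
  · exact div_pos (Real.exp_pos _) h.ell_im
  · refine Tendsto.congr (fun p => ?_) (((Real.continuous_exp.tendsto _).comp (hC x)).div_const _)
    simp only [Function.comp, hF]
    rw [Real.exp_add, Real.exp_log (h.ha _), mul_comm 2, Real.exp_mul,
      Real.exp_log (norm_pos_iff.2 (yy_ne h _ _))]
    norm_num

/-- The orthonormal polynomials at complex arguments. -/
def cpoly (a b : ℕ → ℝ) : ℕ → ℂ → ℂ
  | 0 => fun _ => 1
  | 1 => fun x => (x - b 0) / a 0
  | (n + 2) => fun x =>
      ((x - b (n + 1)) * cpoly a b (n + 1) x - a n * cpoly a b n x) / a (n + 1)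

section cp
variable {a b : ℕ → ℝ}

theorem cpoly_ofReal (n : ℕ) (x : ℝ) : cpoly a b n x = (opoly a b n x : ℂ) := by
  induction n using Nat.strong_induction_on with
  | _ n ih =>
    match n, ih with
    | 0, _ => simp [cpoly, opoly]
    | 1, _ => simp [cpoly, opoly]
    | n + 2, ih =>
      simp only [cpoly, opoly, ih n (by omega), ih (n + 1) (by omega)]
      push_cast
      rfl

theorem cpoly_rec (ha : ∀ n, 0 < a n) (n : ℕ) (z : ℂ) :
    a (n + 1) * cpoly a b (n + 2) z =
      (z - b (n + 1)) * cpoly a b (n + 1) z - a n * cpoly a b n z := by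
  rw [cpoly, mul_div_cancel₀]
  exact_mod_cast (ha _).ne'

theorem cpoly_diff (n : ℕ) : Differentiable ℂ (cpoly a b n) := by
  induction n using Nat.strong_induction_on with
  | _ n ih =>
    match n, ih with
    | 0, _ => exact differentiable_const _
    | 1, _ => show Differentiable ℂ fun x : ℂ => (x - b 0) / a 0
              fun_prop
    | n + 2, ih =>
      have h1 := ih n (by omega)
      have h2 := ih (n + 1) (by omega)
      show Differentiable ℂ fun x : ℂ =>
        ((x - b (n + 1)) * cpoly a b (n + 1) x - a n * cpoly a b n x) / a (n + 1)
      fun_prop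

theorem cpoly_ne (ha : ∀ n, 0 < a n) (n : ℕ) (x : ℂ) :
    cpoly a b n x ≠ 0 ∨ cpoly a b (n + 1) x ≠ 0 := by
  induction n with
  | zero => left; simp [cpoly]
  | succ n ih =>
    by_contra! h
    have := cpoly_rec (b := b) ha n x
    rw [h.1, h.2] at this
    simp [(ha n).ne'] at this
    rcases ih with h' | h'
    · exact h' this
    · exact h' h.1

theorem cpoly_CD (ha : ∀ n, 0 < a n) (n : ℕ) (z : ℂ) :
    a n * (cpoly a b (n + 1) z * (starRingEnd ℂ) (cpoly a b n z)).im =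
      z.im * ∑ j ∈ Finset.range (n + 1), Complex.normSq (cpoly a b j z) := by
  induction n with
  | zero =>
    have := (ha 0).ne'
    simp [cpoly]
    field_simp
  | succ n ih =>
    rw [Finset.sum_range_succ, mul_add, ← ih]
    have h1 := cpoly_rec (b := b) ha n z
    have h2 : (a (n + 1) : ℂ) * (cpoly a b (n + 2) z * (starRingEnd ℂ) (cpoly a b (n + 1) z)) =
        (z - b (n + 1)) * (cpoly a b (n + 1) z * (starRingEnd ℂ) (cpoly a b (n + 1) z)) -
        a n * (cpoly a b n z * (starRingEnd ℂ) (cpoly a b (n + 1) z)) := by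
      linear_combination ((starRingEnd ℂ) (cpoly a b (n + 1) z)) * h1
    have h3 := congrArg Complex.im h2
    rw [Complex.im_ofReal_mul, Complex.sub_im, Complex.im_ofReal_mul, Complex.mul_conj,
      Complex.im_mul_ofReal] at h3
    rw [h3]
    simp [Complex.mul_im]
    ring

theorem cE_ne (ha : ∀ n, 0 < a n) (n : ℕ) (z : ℂ) (hz : 0 ≤ z.im) (l : ℂ) (hl : l.im < 0) :
    cpoly a b (n + 1) z - l * cpoly a b n z ≠ 0 := by
  intro h
  have h0 : cpoly a b (n + 1) z = l * cpoly a b n z := by linear_combination h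
  have h1 := cpoly_CD (b := b) ha n z
  rw [h0, mul_assoc, Complex.mul_conj, Complex.im_mul_ofReal] at h1
  have h2 : 0 ≤ z.im * ∑ j ∈ Finset.range (n + 1), Complex.normSq (cpoly a b j z) :=
    mul_nonneg hz (Finset.sum_nonneg fun _ _ => Complex.normSq_nonneg _)
  have h3 : cpoly a b n z ≠ 0 := by
    intro h4
    rw [h4, mul_zero] at h0
    rcases cpoly_ne (b := b) ha n z with h | h <;> contradiction
  have h4 : a n * (l.im * Complex.normSq (cpoly a b n z)) < 0 :=
    mul_neg_of_pos_of_neg (ha n) (mul_neg_of_neg_of_pos hl (Complex.normSq_pos.2 h3))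
  linarith

theorem cpoly_growth (ha : ∀ n, 0 < a n) (n : ℕ) :
    ∃ R, 1 ≤ R ∧ ∀ j ≤ n, ∀ z : ℂ, R ≤ ‖z‖ →
      ‖z‖ * ‖cpoly a b j z‖ ≤ 2 * a j * ‖cpoly a b (j + 1) z‖ := by
  induction n with
  | zero =>
    refine ⟨1 + 2 * |b 0|, by linarith [abs_nonneg (b 0)], fun j hj z hz => ?_⟩
    obtain rfl : j = 0 := by omega
    have := ha 0
    simp only [cpoly, norm_one, mul_one, norm_div, Complex.norm_real, Real.norm_eq_abs,
      abs_of_pos this]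
    have h1 := norm_sub_norm_le z (b 0 : ℂ)
    rw [Complex.norm_real, Real.norm_eq_abs] at h1
    rw [mul_assoc, mul_div_cancel₀ _ this.ne']
    have := norm_nonneg z
    linarith
  | succ n ih =>
    obtain ⟨R, hR, h⟩ := ih
    have ha1 := ha n
    refine ⟨R + 4 * |b (n + 1)| + 4 * a n, by linarith [abs_nonneg (b (n + 1))],
      fun j hj z hz => ?_⟩
    have hb := abs_nonneg (b (n + 1))
    rcases Nat.lt_or_ge n j with hlt | hle
    · obtain rfl : j = n + 1 := by omega
      have hprev := h n le_rfl z (by linarith)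
      have h1 : ‖(a (n + 1) : ℂ) * cpoly a b (n + 2) z‖ ≥
          ‖(z - b (n + 1)) * cpoly a b (n + 1) z‖ - ‖(a n : ℂ) * cpoly a b n z‖ := by
        rw [cpoly_rec ha]; exact norm_sub_norm_le _ _
      simp only [norm_mul, Complex.norm_real, Real.norm_eq_abs, abs_of_pos (ha _)] at h1
      have h2 := norm_sub_norm_le z (b (n + 1) : ℂ)
      rw [Complex.norm_real, Real.norm_eq_abs] at h2
      have hp := norm_nonneg (cpoly a b (n + 1) z)
      have h3 : (‖z‖ - |b (n + 1)|) * ‖cpoly a b (n + 1) z‖ ≤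
        ‖z - b (n + 1)‖ * ‖cpoly a b (n + 1) z‖ := by gcongr
      have hz1 : 4 * a n ≤ ‖z‖ := by linarith
      have h4 : a n * ‖cpoly a b n z‖ ≤ ‖z‖ / 4 * ‖cpoly a b (n + 1) z‖ := by
        have e1 : 4 * a n * ‖cpoly a b n z‖ ≤ 2 * a n * ‖cpoly a b (n + 1) z‖ :=
          le_trans (by gcongr) hprev
        have e2 : a n * ‖cpoly a b (n + 1) z‖ ≤ ‖z‖ / 4 * ‖cpoly a b (n + 1) z‖ := by
          gcongr; linarith
        linarith [mul_nonneg (norm_nonneg z) hp]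
      have h5 : |b (n + 1)| * ‖cpoly a b (n + 1) z‖ ≤ ‖z‖ / 4 * ‖cpoly a b (n + 1) z‖ := by
        gcongr; linarith
      show _ ≤ 2 * a (n + 1) * ‖cpoly a b (n + 2) z‖
      linarith
    · exact h j hle z (by linarith)

/-- comparison of all lower polynomials with the top one -/
theorem cpoly_le (ha : ∀ n, 0 < a n) (n : ℕ) :
    ∃ R C, 1 ≤ R ∧ 0 < C ∧ ∀ j < n, ∀ z : ℂ, R ≤ ‖z‖ →
      ‖z‖ * ‖cpoly a b j z‖ ≤ C * ‖cpoly a b n z‖ := by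
  induction n with
  | zero => exact ⟨1, 1, le_rfl, one_pos, fun j hj => absurd hj (by omega)⟩
  | succ n ih =>
    obtain ⟨R, C, hR, hC, h⟩ := ih
    obtain ⟨R', hR', h'⟩ := cpoly_growth (b := b) ha n
    have ha1 := ha n
    refine ⟨max R R', 2 * a n * (C + 1), le_max_of_le_left hR, by positivity, fun j hj z hz => ?_⟩
    have g := h' n le_rfl z ((le_max_right _ _).trans hz)
    have hz1 : 1 ≤ ‖z‖ := hR.trans ((le_max_left _ _).trans hz)
    have hn := norm_nonneg (cpoly a b n z)
    have g1 : ‖cpoly a b n z‖ ≤ 2 * a n * ‖cpoly a b (n + 1) z‖ := by nlinarith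
    have hn1 := norm_nonneg (cpoly a b (n + 1) z)
    rcases Nat.lt_or_ge j n with hlt | hle
    · have := h j hlt z ((le_max_left _ _).trans hz)
      have e1 : C * ‖cpoly a b n z‖ ≤ C * (2 * a n * ‖cpoly a b (n + 1) z‖) := by gcongr
      have : 0 ≤ 2 * a n * ‖cpoly a b (n + 1) z‖ := by positivity
      linarith
    · obtain rfl : j = n := by omega
      have : 0 ≤ C * (2 * a j * ‖cpoly a b (j + 1) z‖) := by positivity
      linarith

theorem cE_ge (ha : ∀ n, 0 < a n) (n : ℕ) (l : ℂ) :
    ∃ R C, 1 ≤ R ∧ 0 < C ∧ ∀ z : ℂ, R ≤ ‖z‖ →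
      ‖z‖ * ‖cpoly a b n z‖ ≤ C * ‖cpoly a b (n + 1) z - l * cpoly a b n z‖ ∧
      ‖cpoly a b (n + 1) z‖ ≤ C * ‖cpoly a b (n + 1) z - l * cpoly a b n z‖ ∧
      ∀ j < n, ‖z‖ ^ 2 * ‖cpoly a b j z‖ ≤ C * ‖cpoly a b (n + 1) z - l * cpoly a b n z‖ := by
  obtain ⟨R, hR, h⟩ := cpoly_growth (b := b) ha n
  obtain ⟨R', C, hR', hC, h'⟩ := cpoly_le (b := b) ha n
  have ha1 := ha n
  have hl := norm_nonneg l
  refine ⟨max (max R R') (4 * a n * ‖l‖), 4 * a n + 2 + C * (4 * a n), ?_, by positivity,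
    fun z hz => ?_⟩
  · exact le_max_of_le_left (le_max_of_le_left hR)
  · have z1 : R ≤ ‖z‖ := (le_max_left _ _).trans ((le_max_left _ _).trans hz)
    have z2 : R' ≤ ‖z‖ := (le_max_right _ _).trans ((le_max_left _ _).trans hz)
    have z3 : 4 * a n * ‖l‖ ≤ ‖z‖ := (le_max_right _ _).trans hz
    have hz0 : 0 ≤ ‖z‖ := norm_nonneg z
    have g := h n le_rfl z z1
    have hE : ‖cpoly a b (n + 1) z‖ - ‖l‖ * ‖cpoly a b n z‖ ≤
        ‖cpoly a b (n + 1) z - l * cpoly a b n z‖ := by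
      rw [← norm_mul]; exact norm_sub_norm_le _ _
    have h' := fun j hj => h' j hj z z2
    generalize ‖cpoly a b (n + 1) z - l * cpoly a b n z‖ = e at *
    have hn := norm_nonneg (cpoly a b n z)
    have g2 : 4 * a n * ‖l‖ * ‖cpoly a b n z‖ ≤ ‖z‖ * ‖cpoly a b n z‖ := by gcongr
    have hA : ‖z‖ * ‖cpoly a b n z‖ ≤ 4 * a n * e := by nlinarith
    have hB : ‖cpoly a b (n + 1) z‖ ≤ 2 * e := by
      have : 4 * a n * (‖l‖ * ‖cpoly a b n z‖) ≤ 2 * a n * ‖cpoly a b (n + 1) z‖ := by linarith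
      have : 2 * a n * (2 * (‖l‖ * ‖cpoly a b n z‖)) ≤ 2 * a n * ‖cpoly a b (n + 1) z‖ := by linarith
      have := le_of_mul_le_mul_left this (by positivity)
      linarith
    have he : 0 ≤ e := by linarith [norm_nonneg (cpoly a b (n + 1) z)]
    have p1 : 0 ≤ C * (4 * a n) * e := by positivity
    have p2 : 0 ≤ 4 * a n * e := by positivity
    refine ⟨by linarith, by linarith, fun j hj => ?_⟩
    have := h' j hj
    have : ‖z‖ * (‖z‖ * ‖cpoly a b j z‖) ≤ ‖z‖ * (C * ‖cpoly a b n z‖) := by gcongr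
    have : C * (‖z‖ * ‖cpoly a b n z‖) ≤ C * (4 * a n * e) := by gcongr
    nlinarith
end cp

theorem integrable_of_sq_bound {f : ℝ → ℂ} (hf : Continuous f) {C R : ℝ}
    (h : ∀ x : ℝ, R ≤ |x| → ‖f x‖ * x ^ 2 ≤ C) : Integrable f := by
  refine hf.locallyIntegrable.integrable_of_isBigO_cocompact (g := fun x : ℝ => (1 + x ^ 2)⁻¹) ?_
    (integrable_inv_one_add_sq.integrableAtFilter _)
  refine Asymptotics.IsBigO.of_bound (2 * C) ?_
  have h1 : ∀ᶠ x : ℝ in cocompact ℝ, max R 1 ≤ ‖x‖ :=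
    tendsto_norm_cocompact_atTop.eventually (eventually_ge_atTop _)
  filter_upwards [h1] with x hx
  have hx1 : 1 ≤ |x| := (le_max_right _ _).trans hx
  have h2 := h x ((le_max_left _ _).trans hx)
  have h3 : 1 ≤ x ^ 2 := by rw [← sq_abs]; nlinarith
  rw [Real.norm_eq_abs, abs_of_pos (by positivity), ← div_eq_mul_inv, le_div_iff₀ (by positivity)]
  nlinarith [norm_nonneg (f x)]

theorem contour_zero {G : ℂ → ℂ} (hd : ∀ z : ℂ, 0 ≤ z.im → DifferentiableAt ℂ G z) {C R : ℝ}
    (h : ∀ z : ℂ, 0 ≤ z.im → R ≤ ‖z‖ → ‖G z‖ * ‖z‖ ^ 2 ≤ C) :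
    Integrable (fun x : ℝ => G x) ∧ ∫ x : ℝ, G x = 0 := by
  have hcont : Continuous fun x : ℝ => G x := by
    rw [continuous_iff_continuousAt]
    intro x
    exact ContinuousAt.comp (f := fun x : ℝ => (x : ℂ)) (hd x (by simp)).continuousAt
      Complex.continuous_ofReal.continuousAt
  have hInt : Integrable (fun x : ℝ => G x) := by
    refine integrable_of_sq_bound hcont (C := C) (R := R) fun x hx => ?_
    have := h x (by simp) (by simpa using hx)
    simpa using this
  refine ⟨hInt, ?_⟩
  have hlim := intervalIntegral_tendsto_integral hInt tendsto_neg_atTop_atBot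
    (tendsto_id (α := ℝ))
  have hbd : ∀ᶠ ρ : ℝ in atTop, ‖∫ x in (-ρ)..(id ρ), G x‖ ≤ 4 * C / ρ := by
    filter_upwards [eventually_ge_atTop (max R 1)] with ρ hρ
    have hρR : R ≤ ρ := (le_max_left _ _).trans hρ
    have hρ1 : 1 ≤ ρ := (le_max_right _ _).trans hρ
    have hρ0 : 0 < ρ := by linarith
    have key := Complex.integral_boundary_rect_eq_zero_of_differentiableOn G (-ρ : ℂ)
      (ρ + ρ * Complex.I) (fun z hz => by
        refine (hd z ?_).differentiableWithinAt
        have := hz.2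
        simp [Set.uIcc_of_le hρ0.le] at this
        exact this.1)
    simp at key
    have hbound : ∀ z : ℂ, 0 ≤ z.im → ρ ≤ ‖z‖ → ‖G z‖ ≤ C / ρ ^ 2 := by
      intro z hz hzr
      have := h z hz (hρR.trans hzr)
      rw [le_div_iff₀ (by positivity)]
      refine le_trans ?_ this
      gcongr
    have k1 : ‖∫ x in (-ρ)..ρ, G (x + ρ * Complex.I)‖ ≤ C / ρ ^ 2 * |ρ - (-ρ)| := by
      refine intervalIntegral.norm_integral_le_of_norm_le_const fun x _ => hbound _ (by simp [hρ0.le]) ?_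
      refine le_trans ?_ (Complex.abs_im_le_norm _)
      simp [abs_of_pos hρ0]
    have k2 : ‖∫ y in (0 : ℝ)..ρ, G (ρ + y * Complex.I)‖ ≤ C / ρ ^ 2 * |ρ - 0| := by
      refine intervalIntegral.norm_integral_le_of_norm_le_const fun y hy => hbound _ ?_ ?_
      · rw [Set.uIoc_of_le hρ0.le] at hy; simp [hy.1.le]
      refine le_trans ?_ (Complex.abs_re_le_norm _)
      simp [abs_of_pos hρ0]
    have k3 : ‖∫ y in (0 : ℝ)..ρ, G (-ρ + y * Complex.I)‖ ≤ C / ρ ^ 2 * |ρ - 0| := by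
      refine intervalIntegral.norm_integral_le_of_norm_le_const fun y hy => hbound _ ?_ ?_
      · rw [Set.uIoc_of_le hρ0.le] at hy; simp [hy.1.le]
      refine le_trans ?_ (Complex.abs_re_le_norm _)
      simp [abs_of_pos hρ0]
    have e : (∫ x in (-ρ)..ρ, G x) = (∫ x in (-ρ)..ρ, G (x + ρ * Complex.I)) -
        Complex.I * (∫ y in (0 : ℝ)..ρ, G (ρ + y * Complex.I)) +
        Complex.I * ∫ y in (0 : ℝ)..ρ, G (-ρ + y * Complex.I) := by
      linear_combination key
    simp only [id]
    rw [e]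
    refine (norm_add_le _ _).trans ((add_le_add_left (norm_sub_le _ _) _).trans ?_)
    rw [norm_mul, norm_mul, Complex.norm_I, one_mul, one_mul]
    refine (add_le_add (add_le_add k1 k2) k3).trans (le_of_eq ?_)
    rw [abs_of_pos (by linarith), abs_of_pos (by linarith)]
    field_simp
    ring
  have h0 : Tendsto (fun ρ : ℝ => 4 * C / ρ) atTop (𝓝 0) := tendsto_const_nhds.div_atTop tendsto_id
  have := squeeze_zero_norm' hbd h0
  exact tendsto_nhds_unique hlim this

/-- Bernstein-Szego type density. -/
def dn (a b : ℕ → ℝ) (l : ℂ) (n : ℕ) (x : ℝ) : ℝ :=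
  l.im / (π * a n * ‖(opoly a b (n + 1) x : ℂ) - l * opoly a b n x‖ ^ 2)

section dn
variable {a b : ℕ → ℝ}

/-- zero free denominator -/
def cE (a b : ℕ → ℝ) (l : ℂ) (n : ℕ) (z : ℂ) : ℂ :=
  cpoly a b (n + 1) z - (starRingEnd ℂ) l * cpoly a b n z

theorem cE_conj (l : ℂ) (n : ℕ) (x : ℝ) :
    (starRingEnd ℂ) (cE a b l n x) = (opoly a b (n + 1) x : ℂ) - l * opoly a b n x := by
  simp [cE, cpoly_ofReal]

theorem cE_norm (l : ℂ) (n : ℕ) (x : ℝ) :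
    ‖(opoly a b (n + 1) x : ℂ) - l * opoly a b n x‖ = ‖cE a b l n x‖ := by
  rw [← cE_conj, RCLike.norm_conj]

theorem cE_ne0 (ha : ∀ n, 0 < a n) {l : ℂ} (hl : 0 < l.im) (n : ℕ) (z : ℂ) (hz : 0 ≤ z.im) :
    cE a b l n z ≠ 0 := cE_ne ha n z hz _ (by simpa using hl)

theorem cE_diff (l : ℂ) (n : ℕ) : Differentiable ℂ (cE a b l n) :=
  (cpoly_diff _).sub ((cpoly_diff _).const_mul _)

theorem dn_pos (ha : ∀ n, 0 < a n) {l : ℂ} (hl : 0 < l.im) (n : ℕ) (x : ℝ) : 0 < dn a b l n x := by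
  have := norm_pos_iff.2 (cE_ne0 (b := b) ha hl n x (by simp))
  have h2 := ha n
  rw [dn, cE_norm]
  positivity

theorem dn_cont (ha : ∀ n, 0 < a n) {l : ℂ} (hl : 0 < l.im) (n : ℕ) : Continuous (dn a b l n) := by
  have h1 := opoly_cont a b n
  have h2 := opoly_cont a b (n + 1)
  unfold dn
  refine continuous_const.div (by fun_prop) fun x => ?_
  have := norm_pos_iff.2 (cE_ne0 (b := b) ha hl n x (by simp))
  have h2 := ha n
  rw [cE_norm]
  positivity

theorem quot_eq (ha : ∀ n, 0 < a n) {l : ℂ} (hl : 0 < l.im) (n m : ℕ) (x : ℝ) :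
    opoly a b m x * opoly a b n x * dn a b l n x = -(1 / (π * a n)) * (cpoly a b m x / cE a b l n x).im ∧
    opoly a b m x * opoly a b (n + 1) x * dn a b l n x =
      l.im / (π * a n) * (cpoly a b m x / cE a b l n x).re -
        l.re / (π * a n) * (cpoly a b m x / cE a b l n x).im := by
  have h0 := (cE_ne0 (b := b) ha hl n x (by simp))
  have h1 : cpoly a b m x / cE a b l n x = ((opoly a b m x / ‖cE a b l n x‖ ^ 2 : ℝ) : ℂ) *
      ((opoly a b (n + 1) x : ℂ) - l * opoly a b n x) := by
    rw [← cE_conj, cpoly_ofReal, div_eq_iff h0]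
    push_cast
    rw [div_mul_eq_mul_div, div_mul_eq_mul_div, mul_assoc, mul_comm ((starRingEnd ℂ) _), Complex.mul_conj,
      Complex.normSq_eq_norm_sq]
    have : (‖cE a b l n x‖ : ℂ) ≠ 0 := by exact_mod_cast norm_ne_zero_iff.2 h0
    push_cast
    field_simp
  have h2 := norm_pos_iff.2 h0
  have h3 := (ha n).ne'
  rw [h1, Complex.re_ofReal_mul, Complex.im_ofReal_mul, dn, cE_norm]
  simp
  constructor
  · field_simp
  · field_simp
    ring

theorem quot_lower (ha : ∀ n, 0 < a n) {l : ℂ} (hl : 0 < l.im) {n m : ℕ} (hm : m < n) :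
    Integrable (fun x : ℝ => cpoly a b m x / cE a b l n x) ∧
      ∫ x : ℝ, cpoly a b m x / cE a b l n x = 0 := by
  obtain ⟨R, C, hR, hC, h⟩ := cE_ge (b := b) ha n ((starRingEnd ℂ) l)
  refine contour_zero (G := fun z => cpoly a b m z / cE a b l n z) (C := C) (R := R) ?_ ?_
  · intro z hz
    exact (cpoly_diff m z).div (cE_diff l n z) (cE_ne0 ha hl n z hz)
  · intro z hz hzR
    have h0 := norm_pos_iff.2 (cE_ne0 (b := b) ha hl n z hz)
    rw [norm_div, div_mul_eq_mul_div, div_le_iff₀ h0, mul_comm]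
    exact (h z hzR).2.2 m hm

theorem cpoly_next (ha : ∀ n, 0 < a n) (n : ℕ) :
    ∃ R C, 0 < C ∧ ∀ z : ℂ, R ≤ ‖z‖ →
      ‖a n * cpoly a b (n + 1) z - z * cpoly a b n z‖ ≤ C * ‖cpoly a b n z‖ := by
  rcases n with _ | n
  · refine ⟨0, |b 0| + 1, by positivity, fun z _ => ?_⟩
    have h1 : (a 0 : ℂ) ≠ 0 := by exact_mod_cast (ha 0).ne'
    simp only [cpoly]
    rw [mul_div_cancel₀ _ h1]
    simp
  · obtain ⟨R, C, hR, hC, h⟩ := cpoly_le (b := b) ha (n + 1)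
    have ha1 := ha n
    refine ⟨R, |b (n + 1)| + a n * C, by positivity, fun z hz => ?_⟩
    rw [cpoly_rec ha, show ((z - b (n + 1)) * cpoly a b (n + 1) z - a n * cpoly a b n z -
      z * cpoly a b (n + 1) z) = -(b (n + 1) * cpoly a b (n + 1) z + a n * cpoly a b n z) by ring,
      norm_neg]
    refine (norm_add_le _ _).trans ?_
    rw [norm_mul, norm_mul, Complex.norm_real, Complex.norm_real, Real.norm_eq_abs, Real.norm_eq_abs,
      abs_of_pos ha1, add_mul, mul_assoc]
    have := h n (by omega) z hz
    have h2 : ‖cpoly a b n z‖ ≤ ‖z‖ * ‖cpoly a b n z‖ :=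
      le_mul_of_one_le_left (norm_nonneg _) (hR.trans hz)
    gcongr
    exact h2.trans this

theorem quot_top (ha : ∀ n, 0 < a n) {l : ℂ} (hl : 0 < l.im) (n : ℕ) :
    Integrable (fun x : ℝ => cpoly a b n x / cE a b l n x - a n / (x + Complex.I)) ∧
      ∫ x : ℝ, (cpoly a b n x / cE a b l n x - a n / (x + Complex.I)) = 0 := by
  obtain ⟨R, C, hR, hC, h⟩ := cE_ge (b := b) ha n ((starRingEnd ℂ) l)
  obtain ⟨R', C', hC', h'⟩ := cpoly_next (b := b) ha n
  have hI : ∀ z : ℂ, 0 ≤ z.im → z + Complex.I ≠ 0 := by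
    intro z hz h0
    have := congrArg Complex.im h0
    simp at this
    linarith
  have ha1 := ha n
  refine contour_zero (G := fun z => cpoly a b n z / cE a b l n z - a n / (z + Complex.I))
    (C := (1 + C' + a n * ‖l‖) * C) (R := max R R') ?_ ?_
  · intro z hz
    refine ((cpoly_diff n z).div (cE_diff l n z) (cE_ne0 ha hl n z hz)).sub ?_
    exact (differentiableAt_const _).div (differentiableAt_id.add_const _) (hI z hz)
  · intro z hz hzR
    have z1 := (le_max_left _ _).trans hzR
    have z2 := (le_max_right _ _).trans hzR
    have h0 := (cE_ne0 (b := b) ha hl n z hz)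
    have h1 := hI z hz
    have hz1 : ‖z‖ ≤ ‖z + Complex.I‖ := by
      rw [← sq_le_sq₀ (norm_nonneg _) (norm_nonneg _), ← Complex.normSq_eq_norm_sq,
        ← Complex.normSq_eq_norm_sq, Complex.normSq_apply, Complex.normSq_apply]
      simp
      nlinarith
    rw [div_sub_div _ _ h0 h1, norm_div, norm_mul, div_mul_eq_mul_div, div_le_iff₀
      (mul_pos (norm_pos_iff.2 h0) (norm_pos_iff.2 h1))]
    have e1 : cpoly a b n z * (z + Complex.I) - cE a b l n z * a n =
        (Complex.I * cpoly a b n z - (a n * cpoly a b (n + 1) z - z * cpoly a b n z)) +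
          a n * ((starRingEnd ℂ) l * cpoly a b n z) := by rw [cE]; ring
    have e2 : ‖cpoly a b n z * (z + Complex.I) - cE a b l n z * a n‖ ≤
        (1 + C' + a n * ‖l‖) * ‖cpoly a b n z‖ := by
      rw [e1]
      refine (norm_add_le _ _).trans ((add_le_add_left (norm_sub_le _ _) _).trans ?_)
      simp only [norm_mul, Complex.norm_I, RCLike.norm_conj, Complex.norm_real, Real.norm_eq_abs, abs_of_pos ha1]
      linarith [h' z z2]
    have e3 := (h z z1).1
    calc _ ≤ (1 + C' + a n * ‖l‖) * ‖cpoly a b n z‖ * ‖z‖ ^ 2 := by gcongr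
      _ = (1 + C' + a n * ‖l‖) * (‖z‖ * ‖cpoly a b n z‖) * ‖z‖ := by ring
      _ ≤ (1 + C' + a n * ‖l‖) * (C * ‖cE a b l n z‖) * ‖z + Complex.I‖ :=
        mul_le_mul (mul_le_mul_of_nonneg_left e3 (by positivity)) hz1 (norm_nonneg _) (by positivity)
      _ = _ := by ring

theorem dn_int (ha : ∀ n, 0 < a n) {l : ℂ} (hl : 0 < l.im) {n i j : ℕ} (hi : i ≤ n) (hj : j ≤ n) :
    Integrable (fun x : ℝ => opoly a b i x * opoly a b j x * dn a b l n x) := by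
  obtain ⟨R, C, hR, hC, h⟩ := cE_ge (b := b) ha n ((starRingEnd ℂ) l)
  have ha1 := ha n
  have hb : ∀ i ≤ n, ∀ z : ℂ, R ≤ ‖z‖ → ‖z‖ * ‖cpoly a b i z‖ ≤ C * ‖cE a b l n z‖ := by
    intro i hi z hz
    rcases hi.lt_or_eq with hlt | rfl
    · have := (h z hz).2.2 i hlt
      refine le_trans ?_ this
      have h1 : 1 ≤ ‖z‖ := hR.trans hz
      have := norm_nonneg (cpoly a b i z)
      have : ‖z‖ ≤ ‖z‖ ^ 2 := by nlinarith
      gcongr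
    · exact (h z hz).1
  have key : Integrable (fun x : ℝ => ((opoly a b i x * opoly a b j x * dn a b l n x : ℝ) : ℂ)) := by
    have h1 := opoly_cont a b i
    have h2 := opoly_cont a b j
    have h3 := dn_cont (b := b) ha hl n
    refine integrable_of_sq_bound (by fun_prop) (C := l.im / (π * a n) * C ^ 2) (R := R)
      fun x hx => ?_
    have g1 := hb i hi x (by simpa using hx)
    have g2 := hb j hj x (by simpa using hx)
    have h0 := norm_pos_iff.2 (cE_ne0 (b := b) ha hl n x (by simp))
    rw [cpoly_ofReal, Complex.norm_real, Complex.norm_real, Real.norm_eq_abs, Real.norm_eq_abs] at g1 g2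
    rw [Complex.norm_real, Real.norm_eq_abs, abs_mul, abs_mul, abs_of_pos (dn_pos ha hl n x), dn, cE_norm,
      ← sq_abs x]
    have : |opoly a b i x| * |opoly a b j x| * (l.im / (π * a n * ‖cE a b l n x‖ ^ 2)) * |x| ^ 2 =
      l.im / (π * a n) * ((|x| * |opoly a b i x|) * (|x| * |opoly a b j x|)) / ‖cE a b l n x‖ ^ 2 := by
      field_simp
    rw [this, div_le_iff₀ (by positivity)]
    calc _ ≤ l.im / (π * a n) * ((C * ‖cE a b l n x‖) * (C * ‖cE a b l n x‖)) := by gcongr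
      _ = _ := by ring
  simpa using key.re

theorem dn_top (ha : ∀ n, 0 < a n) {l : ℂ} (hl : 0 < l.im) (n : ℕ) :
    ∫ x : ℝ, opoly a b n x * opoly a b n x * dn a b l n x = 1 := by
  obtain ⟨h1, h2⟩ := quot_top (b := b) ha hl n
  have h3 := Complex.imCLM.integral_comp_comm h1
  rw [h2] at h3
  have hp : ∀ x : ℝ, Complex.imCLM (cpoly a b n x / cE a b l n x - a n / (x + Complex.I)) =
      -(π * a n) * (opoly a b n x * opoly a b n x * dn a b l n x) + a n * (1 + x ^ 2)⁻¹ := by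
    intro x
    have := ha n
    rw [(quot_eq ha hl n n x).1]
    simp [Complex.div_im, Complex.normSq_apply]
    field_simp
    ring
  simp_rw [hp] at h3
  rw [integral_add ((dn_int ha hl le_rfl le_rfl).const_mul _) (integrable_inv_one_add_sq.const_mul _),
    integral_const_mul, integral_const_mul, integral_univ_inv_one_add_sq] at h3
  have := ha n
  simp at h3
  have h4 : (π * a n) * (∫ x : ℝ, opoly a b n x * opoly a b n x * dn a b l n x - 0) = π * a n * 1 := by
    simp; linarith
  have := mul_left_cancel₀ (by positivity) h4
  simpa using this

theorem dn_low (ha : ∀ n, 0 < a n) {l : ℂ} (hl : 0 < l.im) {n m : ℕ} (hm : m < n) :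
    Integrable (fun x : ℝ => opoly a b m x * opoly a b (n + 1) x * dn a b l n x) ∧
    ∫ x : ℝ, opoly a b m x * opoly a b n x * dn a b l n x = 0 ∧
    ∫ x : ℝ, opoly a b m x * opoly a b (n + 1) x * dn a b l n x = 0 := by
  obtain ⟨h1, h2⟩ := quot_lower (b := b) ha hl hm
  have h3 := Complex.imCLM.integral_comp_comm h1
  have h4 := Complex.reCLM.integral_comp_comm h1
  rw [h2] at h3 h4
  simp only [Complex.imCLM_apply, Complex.reCLM_apply, Complex.zero_re, Complex.zero_im] at h3 h4
  have i3 : Integrable (fun x : ℝ => (cpoly a b m x / cE a b l n x).im) := h1.im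
  have i4 : Integrable (fun x : ℝ => (cpoly a b m x / cE a b l n x).re) := h1.re
  simp_rw [(quot_eq ha hl n m _).1, (quot_eq ha hl n m _).2]
  refine ⟨(i4.const_mul _).sub (i3.const_mul _), ?_, ?_⟩
  · rw [integral_const_mul, h3, mul_zero]
  · rw [integral_sub (i4.const_mul _) (i3.const_mul _), integral_const_mul, integral_const_mul, h3, h4]
    simp

theorem opoly_x (ha : ∀ n, 0 < a n) (n : ℕ) : ∃ c e : ℝ, ∀ x,
    x * opoly a b n x = a n * opoly a b (n + 1) x + c * opoly a b n x + e * opoly a b (n - 1) x := by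
  rcases n with _ | n
  · refine ⟨b 0, 0, fun x => ?_⟩
    have := (ha 0).ne'
    simp [opoly]
    field_simp
    ring
  · refine ⟨b (n + 1), a n, fun x => ?_⟩
    have := opoly_rec (b := b) ha n x
    simp only [Nat.add_sub_cancel]
    show _ = a (n + 1) * opoly a b (n + 2) x + _ + _
    linarith

theorem dn_orth_aux (ha : ∀ n, 0 < a n) {l : ℂ} (hl : 0 < l.im) (n k m : ℕ) (hk : m + k = n) :
    (∀ j < m, Integrable (fun x : ℝ => opoly a b j x * opoly a b (m + 1) x * dn a b l n x)) ∧
    (∀ j < m, ∫ x : ℝ, opoly a b j x * opoly a b m x * dn a b l n x = 0) ∧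
    (∀ j < m, ∫ x : ℝ, opoly a b j x * opoly a b (m + 1) x * dn a b l n x = 0) ∧
    ∫ x : ℝ, opoly a b m x * opoly a b m x * dn a b l n x = 1 := by
  induction k generalizing m with
  | zero =>
    obtain rfl : m = n := by omega
    exact ⟨fun j hj => (dn_low ha hl hj).1, fun j hj => (dn_low ha hl hj).2.1,
      fun j hj => (dn_low ha hl hj).2.2, dn_top ha hl m⟩
  | succ k ih =>
    obtain ⟨i1, i2, i3, i4⟩ := ih (m + 1) (by omega)
    have gen : ∀ j ≤ m, ∃ c e : ℝ, a m * ∫ x : ℝ, opoly a b j x * opoly a b m x * dn a b l n x =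
        a j * (∫ x : ℝ, opoly a b (j + 1) x * opoly a b (m + 1) x * dn a b l n x) +
        c * (∫ x : ℝ, opoly a b j x * opoly a b (m + 1) x * dn a b l n x) +
        e * (∫ x : ℝ, opoly a b (j - 1) x * opoly a b (m + 1) x * dn a b l n x) -
        a (m + 1) * (∫ x : ℝ, opoly a b j x * opoly a b (m + 2) x * dn a b l n x) := by
      intro j hj
      obtain ⟨c, e, hce⟩ := opoly_x (b := b) ha j
      refine ⟨c - b (m + 1), e, ?_⟩
      have I1 := (dn_int (b := b) ha hl (show j + 1 ≤ n by omega) (show m + 1 ≤ n by omega)).const_mul (a j)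
      have I2 := (dn_int (b := b) ha hl (show j ≤ n by omega) (show m + 1 ≤ n by omega)).const_mul (c - b (m + 1))
      have I3 := (dn_int (b := b) ha hl (show j - 1 ≤ n by omega) (show m + 1 ≤ n by omega)).const_mul e
      have I4 := (i1 j (by omega)).const_mul (a (m + 1))
      have e1 := integral_add I1 I2
      have e2 := integral_add (I1.add I2) I3
      have e3 := integral_sub ((I1.add I2).add I3) I4
      simp only [Pi.add_apply] at e1 e2 e3
      rw [← integral_const_mul, ← integral_const_mul, ← integral_const_mul, ← integral_const_mul,
        ← integral_const_mul, ← e1, ← e2, ← e3]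
      congr 1
      ext x
      have h1 := hce x
      have h2 := opoly_rec (b := b) ha m x
      linear_combination (opoly a b (m + 1) x * dn a b l n x) * h1 +
        (opoly a b j x * dn a b l n x) * h2
    have ham := (ha m).ne'
    refine ⟨fun j hj => dn_int ha hl (by omega) (by omega), fun j hj => ?_, fun j hj => i2 j (by omega), ?_⟩
    · obtain ⟨c, e, h⟩ := gen j hj.le
      rw [i2 (j + 1) (by omega), i2 j (by omega), i2 (j - 1) (by omega), i3 j (by omega)] at h
      simpa [ham] using h
    · obtain ⟨c, e, h⟩ := gen m le_rfl
      rw [i4, i2 m (by omega), i2 (m - 1) (by omega), i3 m (by omega)] at h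
      simpa [ham] using h

theorem dn_orth (ha : ∀ n, 0 < a n) {l : ℂ} (hl : 0 < l.im) {n i j : ℕ} (hi : i ≤ n) (hj : j ≤ n) :
    ∫ x : ℝ, opoly a b i x * opoly a b j x * dn a b l n x = if i = j then 1 else 0 := by
  have hi' := dn_orth_aux (b := b) ha hl n (n - i) i (by omega)
  have hj' := dn_orth_aux (b := b) ha hl n (n - j) j (by omega)
  rcases lt_trichotomy i j with h | rfl | h
  · rw [if_neg h.ne]; exact hj'.2.1 i h
  · rw [if_pos rfl]; exact hi'.2.2.2
  · rw [if_neg h.ne']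
    simp_rw [mul_comm (opoly a b i _)]
    exact hi'.2.1 j h

end dn

section bcf
open scoped BoundedContinuousFunction

theorem stieltjes_im (x t y : ℝ) :
    (1 / ((x : ℂ) - (t + y * Complex.I))).im = y / ((x - t) ^ 2 + y ^ 2) := by
  rw [one_div, Complex.inv_im, Complex.normSq_apply]
  simp
  ring_nf

theorem poisson_subst (x y : ℝ) (hy : 0 < y) (φ : ℝ → ℝ) :
    ∫ t, y / ((x - t) ^ 2 + y ^ 2) * φ t = ∫ s, (1 + s ^ 2)⁻¹ * φ (x + y * s) := by
  have h1 := Measure.integral_comp_mul_left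
    (fun t => y / ((x - (x + t)) ^ 2 + y ^ 2) * φ (x + t)) y
  have h2 := integral_add_left_eq_self (μ := volume) (fun t => y / ((x - t) ^ 2 + y ^ 2) * φ t) x
  rw [h2, abs_of_pos (inv_pos.2 hy), smul_eq_mul] at h1
  rw [show (∫ t, y / ((x - t) ^ 2 + y ^ 2) * φ t) = y * (y⁻¹ * ∫ t, y / ((x - t) ^ 2 + y ^ 2) * φ t) by
    field_simp, ← h1, ← integral_const_mul]
  congr 1
  ext s
  have : y ^ 2 * (1 + s ^ 2) ≠ 0 := by positivity
  have e : (x - (x + y * s)) ^ 2 + y ^ 2 = y ^ 2 * (1 + s ^ 2) := by ring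
  rw [e]
  field_simp

theorem poisson_integrable (x y : ℝ) (hy : 0 < y) (g : ℝ →ᵇ ℝ) :
    Integrable (fun t => y / ((x - t) ^ 2 + y ^ 2) * g t) := by
  have key : Integrable (fun t : ℝ => ((y / ((x - t) ^ 2 + y ^ 2) * g t : ℝ) : ℂ)) := by
    have hg := g.continuous
    have hc : Continuous fun t : ℝ => y / ((x - t) ^ 2 + y ^ 2) * g t :=
      (continuous_const.div (by fun_prop) fun t => by positivity).mul hg
    refine integrable_of_sq_bound (Complex.continuous_ofReal.comp hc) (C := 4 * y * ‖g‖)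
      (R := 2 * |x|) fun t ht => ?_
    have h1 := g.norm_coe_le_norm t
    rw [Complex.norm_real, norm_mul, Real.norm_of_nonneg (by positivity), div_mul_eq_mul_div,
      div_mul_eq_mul_div, div_le_iff₀ (by positivity)]
    have h3 : t ^ 2 ≤ 4 * (x - t) ^ 2 := by
      have : |t| ≤ 2 * |x - t| := by
        have := abs_sub_abs_le_abs_sub t x
        rw [abs_sub_comm] at this
        linarith
      rw [← sq_abs t, ← sq_abs (x - t)]
      nlinarith [abs_nonneg t]
    calc y * ‖g t‖ * t ^ 2 ≤ y * ‖g‖ * (4 * (x - t) ^ 2) := by gcongr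
      _ ≤ _ := by nlinarith [mul_nonneg (mul_nonneg hy.le (norm_nonneg g)) (sq_nonneg y)]
  exact key.re

theorem poisson_bound (x y : ℝ) (g : ℝ →ᵇ ℝ) :
    |∫ s, (1 + s ^ 2)⁻¹ * g (x + y * s)| ≤ π * ‖g‖ := by
  rw [← Real.norm_eq_abs]
  refine (norm_integral_le_of_norm_le (integrable_inv_one_add_sq.mul_const ‖g‖) ?_).trans
    (le_of_eq ?_)
  · refine Eventually.of_forall fun s => ?_
    rw [norm_mul, Real.norm_of_nonneg (by positivity)]
    gcongr
    exact g.norm_coe_le_norm _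
  · rw [integral_mul_const, integral_univ_inv_one_add_sq]

theorem poisson_fubini (σ : Measure ℝ) [IsFiniteMeasure σ] (y : ℝ) (hy : 0 < y) (g : ℝ →ᵇ ℝ) :
    ∫ x, (∫ s, (1 + s ^ 2)⁻¹ * g (x + y * s)) ∂σ =
      ∫ t : ℝ, (∫ x : ℝ, (1 / ((x : ℂ) - (t + y * Complex.I))).im ∂σ) * g t := by
  simp_rw [← poisson_subst _ y hy, stieltjes_im, ← integral_mul_const]
  rw [integral_integral_swap]
  have hg := g.continuous
  have hc : Continuous (Function.uncurry fun x t : ℝ => y / ((x - t) ^ 2 + y ^ 2) * g t) := by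
    have : Continuous (fun p : ℝ × ℝ => y / ((p.1 - p.2) ^ 2 + y ^ 2)) :=
      continuous_const.div (by fun_prop) fun t => by positivity
    exact this.mul (hg.comp continuous_snd)
  have hm : AEStronglyMeasurable (Function.uncurry fun x t : ℝ => y / ((x - t) ^ 2 + y ^ 2) * g t)
      (σ.prod volume) := hc.aestronglyMeasurable
  rw [integrable_prod_iff hm]
  refine ⟨Eventually.of_forall fun x => poisson_integrable x y hy g, ?_⟩
  refine Integrable.of_bound hm.norm.integral_prod_right' (π * ‖g‖) (Eventually.of_forall fun x => ?_)
  have : ∀ t : ℝ, ‖Function.uncurry (fun x t : ℝ => y / ((x - t) ^ 2 + y ^ 2) * g t) (x, t)‖ =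
      y / ((x - t) ^ 2 + y ^ 2) * ‖g t‖ := by
    intro t
    simp only [Function.uncurry]
    rw [norm_mul, Real.norm_of_nonneg (by positivity)]
  simp_rw [this]
  rw [poisson_subst x y hy (fun t => ‖g t‖)]
  refine (norm_integral_le_of_norm_le (integrable_inv_one_add_sq.mul_const ‖g‖) ?_).trans
    (le_of_eq ?_)
  · refine Eventually.of_forall fun s => ?_
    rw [norm_mul, norm_norm, Real.norm_of_nonneg (by positivity)]
    gcongr
    exact g.norm_coe_le_norm _
  · rw [integral_mul_const, integral_univ_inv_one_add_sq]

theorem poisson_lim (σ : Measure ℝ) [IsFiniteMeasure σ] (g : ℝ →ᵇ ℝ) :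
    Tendsto (fun n : ℕ => ∫ x, (∫ s, (1 + s ^ 2)⁻¹ * g (x + (1 / ((n : ℝ) + 1)) * s)) ∂σ) atTop
      (𝓝 (∫ x, π * g x ∂σ)) := by
  have hg := g.continuous
  refine tendsto_integral_of_dominated_convergence (fun _ => π * ‖g‖) ?_ (integrable_const _) ?_ ?_
  · intro n
    have hc : Continuous (fun p : ℝ × ℝ => (1 + p.2 ^ 2)⁻¹ * g (p.1 + (1 / ((n : ℝ) + 1)) * p.2)) := by
      refine Continuous.mul (Continuous.inv₀ (by fun_prop) fun p => by positivity) (by fun_prop)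
    exact (hc.aestronglyMeasurable (μ := σ.prod volume)).integral_prod_right'
  · exact fun n => Eventually.of_forall fun x => poisson_bound _ _ g
  · refine Eventually.of_forall fun x => ?_
    have e : π * g x = ∫ s : ℝ, (1 + s ^ 2)⁻¹ * g x := by
      rw [integral_mul_const, integral_univ_inv_one_add_sq]
    rw [e]
    refine tendsto_integral_of_dominated_convergence (fun s => (1 + s ^ 2)⁻¹ * ‖g‖) ?_
      (integrable_inv_one_add_sq.mul_const _) ?_ ?_
    · intro n
      refine Continuous.aestronglyMeasurable ?_
      refine Continuous.mul (Continuous.inv₀ (by fun_prop) fun p => by positivity) (by fun_prop)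
    · intro n
      refine Eventually.of_forall fun s => ?_
      rw [norm_mul, Real.norm_of_nonneg (by positivity)]
      gcongr
      exact g.norm_coe_le_norm _
    · refine Eventually.of_forall fun s => ?_
      refine Tendsto.const_mul _ ((hg.tendsto _).comp ?_)
      have := (tendsto_one_div_add_atTop_nhds_zero_nat (𝕜 := ℝ)).mul_const s |>.const_add x
      simpa using this

theorem stieltjes_unique (σ₁ σ₂ : Measure ℝ) [IsFiniteMeasure σ₁] [IsFiniteMeasure σ₂]
    (h : ∀ z : ℂ, 0 < z.im → ∫ x : ℝ, 1 / ((x : ℂ) - z) ∂σ₁ = ∫ x : ℝ, 1 / ((x : ℂ) - z) ∂σ₂) :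
    σ₁ = σ₂ := by
  refine ext_of_forall_integral_eq_of_IsFiniteMeasure fun g => ?_
  have hInt : ∀ (σ : Measure ℝ) [IsFiniteMeasure σ] (t y : ℝ), 0 < y →
      Integrable (fun x : ℝ => 1 / ((x : ℂ) - (t + y * Complex.I))) σ := by
    intro σ _ t y hy
    have hne : ∀ x : ℝ, (x : ℂ) - (t + y * Complex.I) ≠ 0 := by
      intro x h0
      have := congrArg Complex.im h0
      simp at this
      exact hy.ne' this
    refine Integrable.of_bound (Continuous.aestronglyMeasurable
      (continuous_const.div (by fun_prop) hne)) (1 / y) (Eventually.of_forall fun x => ?_)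
    rw [norm_div, norm_one]
    refine one_div_le_one_div_of_le hy ?_
    refine le_trans ?_ (Complex.abs_im_le_norm _)
    simp [abs_of_pos hy]
  have him : ∀ t y : ℝ, 0 < y → ∫ x : ℝ, (1 / ((x : ℂ) - (t + y * Complex.I))).im ∂σ₁ =
      ∫ x : ℝ, (1 / ((x : ℂ) - (t + y * Complex.I))).im ∂σ₂ := by
    intro t y hy
    have e1 := Complex.imCLM.integral_comp_comm (hInt σ₁ t y hy)
    have e2 := Complex.imCLM.integral_comp_comm (hInt σ₂ t y hy)
    rw [h _ (by simpa using hy)] at e1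
    exact e1.trans e2.symm
  have hl1 := poisson_lim σ₁ g
  have hl2 := poisson_lim σ₂ g
  have heq : (fun n : ℕ => ∫ x, (∫ s, (1 + s ^ 2)⁻¹ * g (x + (1 / ((n : ℝ) + 1)) * s)) ∂σ₁) =
      (fun n : ℕ => ∫ x, (∫ s, (1 + s ^ 2)⁻¹ * g (x + (1 / ((n : ℝ) + 1)) * s)) ∂σ₂) := by
    ext n
    have hy : 0 < 1 / ((n : ℝ) + 1) := by positivity
    rw [poisson_fubini σ₁ _ hy g, poisson_fubini σ₂ _ hy g]
    simp_rw [him _ _ hy]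
  rw [heq] at hl1
  have := tendsto_nhds_unique hl1 hl2
  rw [integral_const_mul, integral_const_mul] at this
  exact mul_left_cancel₀ Real.pi_ne_zero this
end bcf

/-- orthonormality of the first polynomials with respect to a measure -/
def ONm (a b : ℕ → ℝ) (σ : Measure ℝ) (n : ℕ) : Prop :=
  ∀ i ≤ n, ∀ j ≤ n, Integrable (fun x => opoly a b i x * opoly a b j x) σ ∧
    ∫ x, opoly a b i x * opoly a b j x ∂σ = if i = j then 1 else 0

section on
variable {a b : ℕ → ℝ} {σ : Measure ℝ} [IsProbabilityMeasure σ] {n : ℕ}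

theorem ONm.int (h : ONm a b σ n) {j : ℕ} (hj : j ≤ n) : Integrable (opoly a b j) σ := by
  have := (h 0 (Nat.zero_le _) j hj).1
  simpa [opoly] using this

theorem ONm.int_mul (h : ONm a b σ n) {j : ℕ} (hj : j ≤ n) {f : ℝ → ℝ} (hf : Continuous f) {C : ℝ}
    (hb : ∀ x, |f x| ≤ C) : Integrable (fun x => opoly a b j x * f x) σ :=
  (h.int hj).mul_bdd hf.aestronglyMeasurable (Eventually.of_forall hb)

theorem bessel (h : ONm a b σ n) {f : ℝ → ℝ} (hf : Continuous f) {C : ℝ}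
    (hb : ∀ x, |f x| ≤ C) :
    ∑ j ∈ Finset.range (n + 1), (∫ x, opoly a b j x * f x ∂σ) ^ 2 ≤ C ^ 2 := by
  set c : ℕ → ℝ := fun j => ∫ x, opoly a b j x * f x ∂σ with hc
  have hI : ∀ j ∈ Finset.range (n + 1), Integrable (fun x => c j * (opoly a b j x * f x)) σ :=
    fun j hj => (h.int_mul (by simpa [Nat.lt_succ_iff] using hj) hf hb).const_mul _
  have hJ : ∀ i ∈ Finset.range (n + 1), ∀ j ∈ Finset.range (n + 1),
      Integrable (fun x => (c i * c j) * (opoly a b i x * opoly a b j x)) σ :=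
    fun i hi j hj => ((h i (by simpa [Nat.lt_succ_iff] using hi) j
      (by simpa [Nat.lt_succ_iff] using hj)).1).const_mul _
  have e1 : ∫ x, (∑ j ∈ Finset.range (n + 1), c j * (opoly a b j x * f x)) ∂σ =
      ∑ j ∈ Finset.range (n + 1), c j ^ 2 := by
    rw [integral_finsetSum _ hI]
    refine Finset.sum_congr rfl fun j _ => ?_
    rw [integral_const_mul, pow_two]
  have e2 : ∫ x, (∑ i ∈ Finset.range (n + 1), ∑ j ∈ Finset.range (n + 1),
      (c i * c j) * (opoly a b i x * opoly a b j x)) ∂σ = ∑ j ∈ Finset.range (n + 1), c j ^ 2 := by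
    rw [integral_finsetSum _ fun i hi => integrable_finsetSum _ (hJ i hi)]
    refine Finset.sum_congr rfl fun i hi => ?_
    rw [integral_finsetSum _ (hJ i hi), Finset.sum_eq_single i]
    · rw [integral_const_mul, (h i (by simpa [Nat.lt_succ_iff] using hi) i
        (by simpa [Nat.lt_succ_iff] using hi)).2, if_pos rfl, mul_one, pow_two]
    · intro j hj hji
      rw [integral_const_mul, (h i (by simpa [Nat.lt_succ_iff] using hi) j
        (by simpa [Nat.lt_succ_iff] using hj)).2, if_neg hji.symm, mul_zero]
    · exact fun h' => absurd hi h'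
  have hff : Integrable (fun x => f x ^ 2) σ := by
    refine Integrable.of_bound (hf.pow 2).aestronglyMeasurable (C ^ 2) (Eventually.of_forall fun x => ?_)
    rw [norm_pow, Real.norm_eq_abs]
    exact pow_le_pow_left₀ (abs_nonneg _) (hb x) 2
  have hff2 : ∫ x, f x ^ 2 ∂σ ≤ C ^ 2 := by
    have : ∫ x, f x ^ 2 ∂σ ≤ ∫ _x, C ^ 2 ∂σ := by
      refine integral_mono hff (integrable_const _) fun x => ?_
      show f x ^ 2 ≤ C ^ 2
      rw [← sq_abs]
      exact pow_le_pow_left₀ (abs_nonneg _) (hb x) 2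
    simpa using this
  have I1 := integrable_finsetSum _ hI
  have I2 := integrable_finsetSum _ fun i hi => integrable_finsetSum (Finset.range (n + 1)) (hJ i hi)
  have hpos : 0 ≤ ∫ x, (f x ^ 2 - 2 * (∑ j ∈ Finset.range (n + 1), c j * (opoly a b j x * f x)) +
      (∑ i ∈ Finset.range (n + 1), ∑ j ∈ Finset.range (n + 1),
      (c i * c j) * (opoly a b i x * opoly a b j x))) ∂σ := by
    refine integral_nonneg fun x => ?_
    have : f x ^ 2 - 2 * (∑ j ∈ Finset.range (n + 1), c j * (opoly a b j x * f x)) +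
      (∑ i ∈ Finset.range (n + 1), ∑ j ∈ Finset.range (n + 1),
      (c i * c j) * (opoly a b i x * opoly a b j x)) =
        (f x - ∑ j ∈ Finset.range (n + 1), c j * opoly a b j x) ^ 2 := by
      rw [sub_sq, pow_two (∑ j ∈ Finset.range (n + 1), c j * opoly a b j x), Finset.sum_mul_sum,
        mul_assoc, Finset.mul_sum (f := fun j => c j * opoly a b j x)]
      congr 1
      · congr 2
        exact Finset.sum_congr rfl fun j _ => by ring
      · exact Finset.sum_congr rfl fun i _ => Finset.sum_congr rfl fun j _ => by ring
    show 0 ≤ _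
    rw [this]
    positivity
  have hfin := integral_add (hff.sub (I1.const_mul 2)) I2
  have hfin2 := integral_sub hff (I1.const_mul 2)
  simp only [Pi.sub_apply] at hfin hfin2
  rw [hfin, hfin2, integral_const_mul, e1, e2] at hpos
  linarith

/-- Cauchy transform coefficients -/
def cs (a b : ℕ → ℝ) (σ : Measure ℝ) (z : ℂ) (j : ℕ) : ℂ :=
  ∫ x : ℝ, (opoly a b j x : ℂ) * (1 / ((x : ℂ) - z)) ∂σ

theorem res_ne {z : ℂ} (hz : 0 < z.im) (x : ℝ) : (x : ℂ) - z ≠ 0 := by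
  intro h0
  have := congrArg Complex.im h0
  simp at this
  exact hz.ne' this

theorem res_cont {z : ℂ} (hz : 0 < z.im) : Continuous fun x : ℝ => 1 / ((x : ℂ) - z) :=
  continuous_const.div (by fun_prop) (res_ne hz)

theorem res_bd {z : ℂ} (hz : 0 < z.im) (x : ℝ) : ‖1 / ((x : ℂ) - z)‖ ≤ 1 / z.im := by
  rw [norm_div, norm_one]
  refine one_div_le_one_div_of_le hz ?_
  refine le_trans ?_ (Complex.abs_im_le_norm _)
  simp [abs_of_pos hz]

theorem ONm.int_res (h : ONm a b σ n) {j : ℕ} (hj : j ≤ n) {z : ℂ} (hz : 0 < z.im) :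
    Integrable (fun x : ℝ => (opoly a b j x : ℂ) * (1 / ((x : ℂ) - z))) σ :=
  (h.int hj).ofReal.mul_bdd (res_cont hz).aestronglyMeasurable
    (Eventually.of_forall (res_bd hz))

theorem cs_bessel (h : ONm a b σ n) {z : ℂ} (hz : 0 < z.im) :
    ∑ j ∈ Finset.range (n + 1), ‖cs a b σ z j‖ ^ 2 ≤ 2 * (1 / z.im) ^ 2 := by
  have b1 := bessel h (Complex.continuous_re.comp (res_cont hz)) (C := 1 / z.im)
    (fun x => (Complex.abs_re_le_norm _).trans (res_bd hz x))
  have b2 := bessel h (Complex.continuous_im.comp (res_cont hz)) (C := 1 / z.im)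
    (fun x => (Complex.abs_im_le_norm _).trans (res_bd hz x))
  rw [two_mul]
  refine le_trans (le_of_eq ?_) (add_le_add b1 b2)
  rw [← Finset.sum_add_distrib]
  refine Finset.sum_congr rfl fun j hj => ?_
  have hi := h.int_res (j := j) (by simpa [Nat.lt_succ_iff] using hj) hz
  have e1 := Complex.reCLM.integral_comp_comm hi
  have e2 := Complex.imCLM.integral_comp_comm hi
  simp only [Complex.reCLM_apply, Complex.imCLM_apply, Complex.re_ofReal_mul,
    Complex.im_ofReal_mul] at e1 e2
  simp only [Function.comp]
  rw [e1, e2, ← Complex.normSq_eq_norm_sq, Complex.normSq_apply, cs]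
  ring

theorem cs_rec (ha : ∀ n, 0 < a n) (h : ONm a b σ n) {z : ℂ} (hz : 0 < z.im) {j : ℕ} (hj : j + 2 ≤ n) :
    a (j + 1) * cs a b σ z (j + 2) = (z - b (j + 1)) * cs a b σ z (j + 1) - a j * cs a b σ z j := by
  have i0 := (h.int_res (j := j) (by omega) hz).const_mul (a j : ℂ)
  have i1 := (h.int_res (j := j + 1) (by omega) hz).const_mul (z - b (j + 1))
  have i2 : Integrable (fun x => (opoly a b (j + 1) x : ℂ)) σ := (h.int (j := j + 1) (by omega)).ofReal
  have e0 : ∫ x, (opoly a b (j + 1) x : ℂ) ∂σ = 0 := by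
    have := (h 0 (by omega) (j + 1) (by omega)).2
    simp [opoly] at this
    rw [integral_complex_ofReal, this]; simp
  have s1 := integral_sub i1 i0
  have s2 := integral_add (i1.sub i0) i2
  simp only [Pi.sub_apply] at s1 s2
  rw [s1] at s2
  simp only [cs]
  rw [← integral_const_mul, ← integral_const_mul, ← integral_const_mul]
  rw [e0, add_zero] at s2
  rw [← s2]
  congr 1
  ext x
  have h1 : ((a (j + 1) * opoly a b (j + 2) x : ℝ) : ℂ) =
    (((x - b (j + 1)) * opoly a b (j + 1) x - a j * opoly a b j x : ℝ) : ℂ) := by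
    rw [opoly_rec ha]
  push_cast at h1
  have h2 := res_ne hz x
  have h3 : ((x : ℂ) - z) * (1 / ((x : ℂ) - z)) = 1 := mul_one_div_cancel h2
  linear_combination (1 / ((x : ℂ) - z)) * h1 + (opoly a b (j + 1) x : ℂ) * h3

theorem cs_rec0 (ha : ∀ n, 0 < a n) (h : ONm a b σ n) {z : ℂ} (hz : 0 < z.im) (hj : 1 ≤ n) :
    a 0 * cs a b σ z 1 = (z - b 0) * cs a b σ z 0 + 1 := by
  have i1 := (h.int_res (j := 0) (by omega) hz).const_mul (z - b 0)
  have s2 := integral_add i1 (integrable_const (1 : ℂ))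
  simp only [cs]
  rw [← integral_const_mul, ← integral_const_mul]
  rw [integral_const] at s2
  simp only [probReal_univ, one_smul] at s2
  rw [← s2]
  congr 1
  ext x
  have h2 := res_ne hz x
  have h3 : ((x : ℂ) - z) * (1 / ((x : ℂ) - z)) = 1 := mul_one_div_cancel h2
  have h4 : (a 0 : ℂ) ≠ 0 := by exact_mod_cast (ha 0).ne'
  simp only [opoly]
  push_cast
  rw [← mul_assoc, mul_div_cancel₀ _ h4]
  linear_combination h3

theorem cs_diff (ha : ∀ n, 0 < a n) {σ' : Measure ℝ} [IsProbabilityMeasure σ']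
    (h : ONm a b σ n) (h' : ONm a b σ' n) {z : ℂ} (hz : 0 < z.im) (j : ℕ) (hj : j ≤ n) :
    cs a b σ z j - cs a b σ' z j = (cs a b σ z 0 - cs a b σ' z 0) * cpoly a b j z := by
  induction j using Nat.strong_induction_on with
  | _ j ih =>
    match j, ih, hj with
    | 0, _, _ => simp [cpoly]
    | 1, _, hj =>
      have h1 := cs_rec0 ha h hz hj
      have h2 := cs_rec0 ha h' hz hj
      have h4 : (a 0 : ℂ) ≠ 0 := by exact_mod_cast (ha 0).ne'
      apply mul_left_cancel₀ h4
      simp only [cpoly]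
      field_simp
      linear_combination h1 - h2
    | j + 2, ih, hj =>
      have h1 := cs_rec ha h hz hj
      have h2 := cs_rec ha h' hz hj
      have h3 := cpoly_rec (b := b) ha j z
      have h4 : (a (j + 1) : ℂ) ≠ 0 := by exact_mod_cast (ha (j + 1)).ne'
      have h5 := ih j (by omega) (by omega)
      have h6 := ih (j + 1) (by omega) (by omega)
      apply mul_left_cancel₀ h4
      linear_combination h1 - h2 + (z - b (j + 1)) * h6 - a j * h5 -
        (cs a b σ z 0 - cs a b σ' z 0) * h3

theorem cs_close (ha : ∀ n, 0 < a n) {σ' : Measure ℝ} [IsProbabilityMeasure σ']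
    (h : ONm a b σ n) (h' : ONm a b σ' n) {z : ℂ} (hz : 0 < z.im) :
    ‖cs a b σ z 0 - cs a b σ' z 0‖ ^ 2 * (z.im * ∑ k ∈ Finset.range n, 1 / a k) ≤
      8 * (1 / z.im) ^ 2 := by
  have hS : z.im * ∑ k ∈ Finset.range n, 1 / a k ≤
      ∑ j ∈ Finset.range (n + 1), ‖cpoly a b j z‖ ^ 2 := by
    have hterm : ∀ k, z.im * (1 / a k) ≤ (‖cpoly a b k z‖ ^ 2 + ‖cpoly a b (k + 1) z‖ ^ 2) / 2 := by
      intro k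
      have h1 := cpoly_CD (b := b) ha k z
      have h2 : 1 ≤ ∑ j ∈ Finset.range (k + 1), Complex.normSq (cpoly a b j z) := by
        have := Finset.single_le_sum (f := fun j => Complex.normSq (cpoly a b j z))
          (fun j _ => Complex.normSq_nonneg _) (Finset.mem_range.2 (Nat.succ_pos k))
        simpa [cpoly] using this
      have h3 : (cpoly a b (k + 1) z * (starRingEnd ℂ) (cpoly a b k z)).im ≤
          ‖cpoly a b (k + 1) z‖ * ‖cpoly a b k z‖ := by
        refine (le_abs_self _).trans ((Complex.abs_im_le_norm _).trans (le_of_eq ?_))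
        rw [norm_mul, RCLike.norm_conj]
      have hak := ha k
      rw [mul_one_div, div_le_iff₀ hak]
      have h4 : z.im * 1 ≤ a k * (cpoly a b (k + 1) z * (starRingEnd ℂ) (cpoly a b k z)).im := by
        rw [h1]; gcongr
      have h5 : a k * (cpoly a b (k + 1) z * (starRingEnd ℂ) (cpoly a b k z)).im ≤
        a k * ((‖cpoly a b k z‖ ^ 2 + ‖cpoly a b (k + 1) z‖ ^ 2) / 2) := by
        gcongr
        nlinarith [sq_nonneg (‖cpoly a b (k + 1) z‖ - ‖cpoly a b k z‖)]
      linarith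
    rw [Finset.mul_sum]
    refine (Finset.sum_le_sum fun k _ => hterm k).trans ?_
    rw [← Finset.sum_div, Finset.sum_add_distrib]
    have g1 := Finset.sum_range_succ (fun j => ‖cpoly a b j z‖ ^ 2) n
    have g2 := Finset.sum_range_succ' (fun j => ‖cpoly a b j z‖ ^ 2) n
    have p1 : 0 ≤ ‖cpoly a b n z‖ ^ 2 := by positivity
    have p2 : 0 ≤ ‖cpoly a b 0 z‖ ^ 2 := by positivity
    linarith
  calc _ ≤ ‖cs a b σ z 0 - cs a b σ' z 0‖ ^ 2 * ∑ j ∈ Finset.range (n + 1), ‖cpoly a b j z‖ ^ 2 := by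
        gcongr
    _ = ∑ j ∈ Finset.range (n + 1), ‖cs a b σ z j - cs a b σ' z j‖ ^ 2 := by
        rw [Finset.mul_sum]
        refine Finset.sum_congr rfl fun j hj => ?_
        rw [cs_diff ha h h' hz j (by simpa [Nat.lt_succ_iff] using hj), norm_mul, mul_pow]
    _ ≤ ∑ j ∈ Finset.range (n + 1), (2 * ‖cs a b σ z j‖ ^ 2 + 2 * ‖cs a b σ' z j‖ ^ 2) := by
        refine Finset.sum_le_sum fun j _ => ?_
        have := norm_sub_le (cs a b σ z j) (cs a b σ' z j)
        nlinarith [norm_nonneg (cs a b σ z j - cs a b σ' z j),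
          sq_nonneg (‖cs a b σ z j‖ - ‖cs a b σ' z j‖)]
    _ ≤ _ := by
        rw [Finset.sum_add_distrib, ← Finset.mul_sum, ← Finset.mul_sum]
        linarith [cs_bessel h hz, cs_bessel h' hz]
end on

theorem ONm_of_orth {a b : ℕ → ℝ} {μ : Measure ℝ}
    (horth : ∀ n m : ℕ, ∫ x, opoly a b n x * opoly a b m x ∂μ = if n = m then 1 else 0) (n : ℕ) :
    ONm a b μ n := by
  intro i _ j _
  refine ⟨?_, horth i j⟩
  have hsq : ∀ i, Integrable (fun x => opoly a b i x * opoly a b i x) μ := by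
    intro i
    by_contra hn
    have := integral_undef hn
    rw [horth] at this
    simp at this
  refine ((hsq i).add (hsq j)).mono'
    ((opoly_cont a b i).mul (opoly_cont a b j)).aestronglyMeasurable
    (Eventually.of_forall fun x => ?_)
  rw [Real.norm_eq_abs, abs_le]
  simp only [Pi.add_apply]
  constructor <;> nlinarith [sq_nonneg (opoly a b i x + opoly a b j x),
    sq_nonneg (opoly a b i x - opoly a b j x), sq_nonneg (opoly a b i x),
    sq_nonneg (opoly a b j x)]

/-- measure with a continuous density -/
def dM (d : ℝ → ℝ) : Measure ℝ := volume.withDensity (fun x => ENNReal.ofReal (d x))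

theorem dM_int {E : Type*} [NormedAddCommGroup E] [NormedSpace ℝ E] {d : ℝ → ℝ} (hd : Continuous d)
    (h0 : ∀ x, 0 ≤ d x) (g : ℝ → E) : ∫ x, g x ∂(dM d) = ∫ x, d x • g x := by
  unfold dM
  rw [integral_withDensity_eq_integral_toReal_smul (by fun_prop)
    (Eventually.of_forall fun x => ENNReal.ofReal_lt_top)]
  simp only [ENNReal.toReal_ofReal (h0 _)]

theorem dM_integrable {E : Type*} [NormedAddCommGroup E] [NormedSpace ℝ E] {d : ℝ → ℝ}
    (hd : Continuous d) (h0 : ∀ x, 0 ≤ d x) (g : ℝ → E) :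
    Integrable g (dM d) ↔ Integrable (fun x => d x • g x) := by
  unfold dM
  rw [integrable_withDensity_iff_integrable_smul' (by fun_prop)
    (Eventually.of_forall fun x => ENNReal.ofReal_lt_top)]
  simp only [ENNReal.toReal_ofReal (h0 _)]

theorem dM_prob {d : ℝ → ℝ} (h0 : ∀ x, 0 ≤ d x) (hi : Integrable d)
    (h1 : ∫ x, d x = 1) : IsProbabilityMeasure (dM d) := by
  constructor
  unfold dM
  rw [withDensity_apply _ MeasurableSet.univ, Measure.restrict_univ,
    ← ofReal_integral_eq_lintegral_ofReal hi (Eventually.of_forall h0), h1, ENNReal.ofReal_one]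

theorem dn_integral {a b : ℕ → ℝ} (ha : ∀ n, 0 < a n) {l : ℂ} (hl : 0 < l.im) (n : ℕ) :
    Integrable (dn a b l n) ∧ ∫ x, dn a b l n x = 1 := by
  have h1 := dn_int (b := b) ha hl (Nat.zero_le n) (Nat.zero_le n)
  have h2 := dn_orth (b := b) ha hl (Nat.zero_le n) (Nat.zero_le n)
  simp [opoly] at h1 h2
  exact ⟨h1, h2⟩

theorem dn_ONm {a b : ℕ → ℝ} (ha : ∀ n, 0 < a n) {l : ℂ} (hl : 0 < l.im) (n : ℕ) :
    ONm a b (dM (dn a b l n)) n := by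
  intro i hi j hj
  have h0 := fun x => (dn_pos (b := b) ha hl n x).le
  have hc := dn_cont (b := b) ha hl n
  rw [dM_integrable hc h0, dM_int hc h0]
  simp only [smul_eq_mul, mul_comm (dn a b l n _)]
  exact ⟨dn_int ha hl hi hj, dn_orth ha hl hi hj⟩

theorem lim_density_int {d : ℕ → ℝ → ℝ} {w : ℝ → ℝ} (h0 : ∀ k x, 0 ≤ d k x)
    (hc : ∀ k, Continuous (d k)) (hi : ∀ k, Integrable (d k)) (h1 : ∀ k, ∫ x, d k x = 1)
    (hw : Continuous w) (hw0 : ∀ x, 0 ≤ w x) (hp : ∀ x, Tendsto (fun k => d k x) atTop (𝓝 (w x))) :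
    Integrable w ∧ ∫ x, w x ≤ 1 := by
  have hL : ∫⁻ x, ENNReal.ofReal (w x) ≤ 1 := by
    have := lintegral_liminf_le (μ := volume) (u := atTop)
      (f := fun k x => ENNReal.ofReal (d k x)) (fun k => by have := hc k; fun_prop)
    have e1 : ∀ x, liminf (fun k => ENNReal.ofReal (d k x)) atTop = ENNReal.ofReal (w x) :=
      fun x => (ENNReal.tendsto_ofReal (hp x)).liminf_eq
    have e2 : ∀ k, ∫⁻ x, ENNReal.ofReal (d k x) = 1 := fun k => by
      rw [← ofReal_integral_eq_lintegral_ofReal (hi k) (Eventually.of_forall (h0 k)), h1 k,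
        ENNReal.ofReal_one]
    simp only [e1, e2] at this
    simpa using this
  have hI : Integrable w := by
    refine ⟨hw.aestronglyMeasurable, ?_⟩
    rw [hasFiniteIntegral_iff_ofReal (Eventually.of_forall hw0)]
    exact lt_of_le_of_lt hL ENNReal.one_lt_top
  refine ⟨hI, ?_⟩
  rw [← ofReal_integral_eq_lintegral_ofReal hI (Eventually.of_forall hw0)] at hL
  simpa using hL

theorem tail_bd {d : ℝ → ℝ} (h0 : ∀ x, 0 ≤ d x) (hi : Integrable d)
    (h1 : ∫ x, d x ≤ 1) {f : ℝ → ℂ} {K : Set ℝ} (hK : MeasurableSet K) {ε : ℝ} (hε : 0 ≤ ε)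
    (hf : ∀ x ∉ K, ‖f x‖ ≤ ε) : ‖∫ x in Kᶜ, d x • f x‖ ≤ ε := by
  calc ‖∫ x in Kᶜ, d x • f x‖ ≤ ∫ x in Kᶜ, ε * d x := by
        refine norm_integral_le_of_norm_le (hi.const_mul ε).integrableOn ?_
        refine (ae_restrict_iff' hK.compl).2 (Eventually.of_forall fun x hx => ?_)
        rw [norm_smul, Real.norm_of_nonneg (h0 x), mul_comm]
        exact mul_le_mul_of_nonneg_right (hf x hx) (h0 x)
    _ ≤ ∫ x, ε * d x := setIntegral_le_integral (hi.const_mul ε)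
        (Eventually.of_forall fun x => mul_nonneg hε (h0 x))
    _ = ε * ∫ x, d x := integral_const_mul _ _
    _ ≤ ε * 1 := by gcongr
    _ = ε := mul_one _

theorem weak_lim {d : ℕ → ℝ → ℝ} {w : ℝ → ℝ} (h0 : ∀ k x, 0 ≤ d k x)
    (hc : ∀ k, Continuous (d k)) (hi : ∀ k, Integrable (d k)) (h1 : ∀ k, ∫ x, d k x = 1)
    (hw : Continuous w) (hw0 : ∀ x, 0 ≤ w x) (hcc : TendstoLocallyUniformly d w atTop)
    {f : ℝ → ℂ} (hf : Continuous f) {C : ℝ} (hb : ∀ x, ‖f x‖ ≤ C)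
    (hf0 : Tendsto f (cocompact ℝ) (𝓝 0)) :
    Tendsto (fun k => ∫ x, d k x • f x) atTop (𝓝 (∫ x, w x • f x)) := by
  have hp : ∀ x, Tendsto (fun k => d k x) atTop (𝓝 (w x)) := fun x => (tendstoLocallyUniformlyOn_univ.2 hcc).tendsto_at (Set.mem_univ x)
  obtain ⟨wi, w1⟩ := lim_density_int h0 hc hi h1 hw hw0 hp
  rw [Metric.tendsto_atTop]
  intro ε hε
  obtain ⟨K, hK, hKf⟩ : ∃ K : Set ℝ, IsCompact K ∧ ∀ x ∉ K, ‖f x‖ ≤ ε / 4 := by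
    have := (Metric.tendsto_nhds.1 hf0) (ε / 4) (by positivity)
    obtain ⟨K, hK, hKs⟩ := mem_cocompact.1 this
    exact ⟨K, hK, fun x hx => by
      have := hKs hx
      simp only [dist_zero_right, Set.mem_setOf_eq] at this
      exact this.le⟩
  have hKm := hK.measurableSet
  have hU := (tendstoLocallyUniformly_iff_forall_isCompact.1 hcc) K hK
  have hev := (Metric.tendstoUniformlyOn_iff.1 hU) 1 one_pos
  have hlim : Tendsto (fun k => ∫ x in K, d k x • f x) atTop (𝓝 (∫ x in K, w x • f x)) := by
    refine tendsto_integral_filter_of_dominated_convergence (fun x => (w x + 1) * ‖f x‖) ?_ ?_ ?_ ?_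
    · exact Eventually.of_forall fun k => ((hc k).smul hf).aestronglyMeasurable
    · filter_upwards [hev] with k hk
      refine (ae_restrict_iff' hKm).2 (Eventually.of_forall fun x hx => ?_)
      rw [norm_smul, Real.norm_of_nonneg (h0 k x)]
      have := hk x hx
      rw [Real.dist_eq, abs_lt] at this
      gcongr
      linarith [this.1]
    · exact ((hw.add continuous_const).mul hf.norm).continuousOn.integrableOn_compact hK
    · exact Eventually.of_forall fun x => (hp x).smul_const _
  obtain ⟨k₀, hk₀⟩ := (Metric.tendsto_atTop.1 hlim) (ε / 4) (by positivity)
  refine ⟨k₀, fun k hk => ?_⟩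
  have hA : ∀ h : ℝ → ℝ, Integrable h → Integrable (fun x => h x • f x) := fun h hh =>
    (hh.smul_bdd C hf.aestronglyMeasurable (Eventually.of_forall hb))
  rw [← integral_add_compl hKm (hA _ (hi k)), ← integral_add_compl hKm (hA _ wi), dist_eq_norm]
  have t1 := tail_bd (h0 k) (hi k) (h1 k).le hKm (by positivity) hKf
  have t2 := tail_bd hw0 wi w1 hKm (by positivity) hKf
  have t3 := hk₀ k hk
  rw [dist_eq_norm] at t3
  calc _ = ‖((∫ x in K, d k x • f x) - ∫ x in K, w x • f x) +
        ((∫ x in Kᶜ, d k x • f x) - ∫ x in Kᶜ, w x • f x)‖ := by congr 1; ring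
    _ ≤ ‖(∫ x in K, d k x • f x) - ∫ x in K, w x • f x‖ +
        (‖∫ x in Kᶜ, d k x • f x‖ + ‖∫ x in Kᶜ, w x • f x‖) :=
        (norm_add_le _ _).trans (by gcongr; exact norm_sub_le _ _)
    _ < ε := by linarith

theorem res_zero {z : ℂ} : Tendsto (fun x : ℝ => 1 / ((x : ℂ) - z)) (cocompact ℝ) (𝓝 0) := by
  simp only [one_div]
  refine tendsto_inv₀_cobounded.comp ?_
  rw [← Metric.cobounded_eq_cocompact]
  rw [← tendsto_norm_atTop_iff_cobounded]
  refine tendsto_atTop_mono (f := fun x : ℝ => ‖x‖ - ‖z‖) (fun x => ?_) ?_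
  · have := norm_sub_norm_le (x : ℂ) z
    simpa using this
  · exact tendsto_atTop_add_const_right _ _ tendsto_norm_cobounded_atTop

theorem ident {N r : ℕ} {a b : ℕ → ℝ} {α β : ℤ → ℝ} (h : JM N r a b α β) {g : ℝ → ℝ}
    (hg : Continuous g) (hg0 : ∀ x, 0 < g x)
    (hcc : CC (fun k x => a ((k + 1) * N - 1) * ‖yy a b α β N k x‖ ^ 2 / (ell α β N).im) g)
    (μ : Measure ℝ) [IsProbabilityMeasure μ]
    (horth : ∀ n m : ℕ, ∫ x, opoly a b n x * opoly a b m x ∂μ = if n = m then 1 else 0) :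
    μ = volume.withDensity (fun x => ENNReal.ofReal (1 / (π * g x))) := by
  set l := ell α β N with hl
  have hli : 0 < l.im := h.ell_im
  set nn : ℕ → ℕ := fun k => (k + 1) * N - 1 with hnn
  set d : ℕ → ℝ → ℝ := fun k => dn a b l (nn k) with hd
  set w : ℝ → ℝ := fun x => 1 / (π * g x) with hw
  have hwc : Continuous w := continuous_const.div (by fun_prop) fun x => by
    have := hg0 x; positivity
  have hw0 : ∀ x, 0 ≤ w x := fun x => by have := hg0 x; simp only [hw]; positivity
  have hd0 : ∀ k x, 0 ≤ d k x := fun k x => (dn_pos h.ha hli _ x).le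
  have hdc : ∀ k, Continuous (d k) := fun k => dn_cont h.ha hli _
  have hdi : ∀ k, Integrable (d k) := fun k => (dn_integral h.ha hli _).1
  have hd1 : ∀ k, ∫ x, d k x = 1 := fun k => (dn_integral h.ha hli _).2
  have hnk : ∀ k, nn k + 1 = (k + 1) * N := fun k => Nat.sub_add_cancel (h.kNpos k)
  have hcc' : CC d w := by
    intro x
    have h1 := ((hcc x).const_mul π).inv₀ (by have := hg0 x; positivity)
    refine (h1.congr fun p => ?_).trans (by simp only [hw, one_div]; exact le_rfl)
    simp only [hd, dn, hnk, yy]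
    rw [← mul_div_assoc, inv_div, mul_assoc]
  have htl := hcc'.to_tlu hwc
  obtain ⟨wi, w1⟩ := lim_density_int hd0 hdc hdi hd1 hwc hw0 (fun x => (tendstoLocallyUniformlyOn_univ.2 htl).tendsto_at (Set.mem_univ x))
  have : IsFiniteMeasure (dM w) := by
    constructor
    unfold dM
    rw [withDensity_apply _ MeasurableSet.univ, Measure.restrict_univ,
      ← ofReal_integral_eq_lintegral_ofReal wi (Eventually.of_forall hw0)]
    exact ENNReal.ofReal_lt_top
  show μ = dM w
  refine stieltjes_unique μ (dM w) fun z hz => ?_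
  rw [dM_int hwc hw0]
  have lim1 := weak_lim hd0 hdc hdi hd1 hwc hw0 htl (res_cont hz) (res_bd hz) res_zero
  refine tendsto_nhds_unique ?_ lim1
  have hprob : ∀ k, IsProbabilityMeasure (dM (d k)) := fun k => dM_prob (hd0 k) (hdi k) (hd1 k)
  have key : ∀ k, ‖(∫ x, d k x • (1 / ((x : ℂ) - z))) - ∫ x : ℝ, 1 / ((x : ℂ) - z) ∂μ‖ ^ 2 *
      (z.im * ∑ j ∈ Finset.range (nn k), 1 / a j) ≤ 8 * (1 / z.im) ^ 2 := by
    intro k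
    have := hprob k
    have := cs_close h.ha (dn_ONm (b := b) h.ha hli (nn k)) (ONm_of_orth horth (nn k)) hz
    simp only [cs, opoly, Complex.ofReal_one, one_mul] at this
    change ‖(∫ x : ℝ, 1 / ((x : ℂ) - z) ∂(dM (d k))) - _‖ ^ 2 * _ ≤ _ at this
    rwa [dM_int (hdc k) (hd0 k)] at this
  have hnt : Tendsto nn atTop atTop := by
    refine tendsto_atTop_mono (fun k => ?_) tendsto_id
    have h2 := h.hN
    have : (k + 1) * 1 ≤ (k + 1) * N := Nat.mul_le_mul_left _ h2
    simp only [hnn, id]; omega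
  have hS := (h.hCarleman.comp hnt).const_mul_atTop hz
  rw [tendsto_iff_norm_sub_tendsto_zero]
  have hsq : Tendsto (fun k => ‖(∫ x, d k x • (1 / ((x : ℂ) - z))) -
      ∫ x : ℝ, 1 / ((x : ℂ) - z) ∂μ‖ ^ 2) atTop (𝓝 0) := by
    refine squeeze_zero' (g := fun k => 8 * (1 / z.im) ^ 2 / (z.im * ∑ j ∈ Finset.range (nn k), 1 / a j)) (Eventually.of_forall fun k => by positivity) ?_ ?_
    · filter_upwards [hS.eventually_gt_atTop 0] with k hk
      simp only [Function.comp] at hk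
      rw [le_div_iff₀ hk]
      exact key k
    · exact tendsto_const_nhds.div_atTop hS
  have := hsq.sqrt
  simpa using this

theorem prod_deriv {N r : ℕ} {a b : ℕ → ℝ} {α β : ℤ → ℝ} (h : JM N r a b α β) (n : ℕ) :
    ∀ i : Fin 2,
    HasDerivAt (fun x => prodDZ (fun j => frakB α β j x) 0 n i 0)
      (1 / α (-1) * (-(lm α β n i 0) * (∑ s ∈ Finset.range n, lm α β s 1 0 * lm α β s 1 1) +
        lm α β n i 1 * ∑ s ∈ Finset.range n, lm α β s 1 0 ^ 2)) 0 ∧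
    HasDerivAt (fun x => prodDZ (fun j => frakB α β j x) 0 n i 1)
      (1 / α (-1) * (-(lm α β n i 0) * (∑ s ∈ Finset.range n, lm α β s 1 1 ^ 2) +
        lm α β n i 1 * ∑ s ∈ Finset.range n, lm α β s 1 0 * lm α β s 1 1)) 0 := by
  induction n with
  | zero =>
    intro i
    simp only [prodDZ, Finset.range_zero, Finset.sum_empty, mul_zero, add_zero]
    exact ⟨hasDerivAt_const _ _, hasDerivAt_const _ _⟩
  | succ n ih =>
    have r0 : ∀ x j, prodDZ (fun j => frakB α β j x) 0 (n + 1) 0 j =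
        prodDZ (fun j => frakB α β j x) 0 n 1 j := by
      intro x j
      simp [prodDZ, Matrix.mul_apply, Fin.sum_univ_two, frakB]
    have r1 : ∀ x j, prodDZ (fun j => frakB α β j x) 0 (n + 1) 1 j =
        -(α (n - 1)) / α n * prodDZ (fun j => frakB α β j x) 0 n 0 j +
        (x - β n) / α n * prodDZ (fun j => frakB α β j x) 0 n 1 j := by
      intro x j
      simp [prodDZ, Matrix.mul_apply, Fin.sum_univ_two, frakB]
    have l0 : ∀ j, lm α β (n + 1) 0 j = lm α β n 1 j := fun j => r0 0 j
    have l1 : ∀ j, lm α β (n + 1) 1 j = -(α (n - 1)) / α n * lm α β n 0 j +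
        (0 - β n) / α n * lm α β n 1 j := fun j => r1 0 j
    have hdet := lm_det h (n + 1)
    rw [Matrix.det_fin_two, l0, l0] at hdet
    have hα1 := h.hα (-1)
    have hαn := h.hα n
    have e : ((n + 1 : ℕ) : ℤ) - 1 = n := by push_cast; ring
    rw [e] at hdet
    have hdet' : 1 / α (-1) * (lm α β n 1 0 * lm α β (n + 1) 1 1 - lm α β n 1 1 * lm α β (n + 1) 1 0) =
        1 / α n := by
      rw [hdet]; field_simp
    have hd : HasDerivAt (fun x : ℝ => (x - β n) / α n) (1 / α n) 0 :=
      ((hasDerivAt_id (0 : ℝ)).sub_const _).div_const _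
    intro i
    fin_cases i
    · simp only [Fin.zero_eta, r0, l0, Finset.sum_range_succ]
      refine ⟨(ih 1).1.congr_deriv ?_, (ih 1).2.congr_deriv ?_⟩ <;> ring
    · simp only [Fin.mk_one, r1, Finset.sum_range_succ]
      refine ⟨(((ih 0).1.const_mul _).add (hd.mul (ih 1).1)).congr_deriv ?_,
        (((ih 0).2.const_mul _).add (hd.mul (ih 1).2)).congr_deriv ?_⟩
      · change _ + (1 / α n * lm α β n 1 0 + _) = _
        linear_combination (-lm α β n 1 0) * hdet' - (1 / α (-1)) *
          (-(∑ s ∈ Finset.range n, lm α β s 1 0 * lm α β s 1 1) * l1 0 +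
          (∑ s ∈ Finset.range n, lm α β s 1 0 ^ 2) * l1 1)
      · change _ + (1 / α n * lm α β n 1 1 + _) = _
        linear_combination (-lm α β n 1 1) * hdet' - (1 / α (-1)) *
          (-(∑ s ∈ Finset.range n, lm α β s 1 1 ^ 2) * l1 0 +
          (∑ s ∈ Finset.range n, lm α β s 1 0 * lm α β s 1 1) * l1 1)

/-- coefficient of the limiting row on the vector `(1, l)` -/
def Wc (α β : ℤ → ℝ) (N s : ℕ) : ℂ := lm α β s 1 0 + lm α β s 1 1 * ell α β N

theorem tau_eq {N r : ℕ} {a b : ℕ → ℝ} {α β : ℤ → ℝ} (h : JM N r a b α β) :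
    tauC α β N * (2 * N * α (-1) * (ell α β N).im) =
      ∑ s ∈ Finset.range N, Complex.normSq (Wc α β N s) := by
  have h1 := prod_deriv h N
  have hder : HasDerivAt (fun y => Matrix.trace (frakX0 α β N y))
      (lm α β N 0 1 / α (-1) * ∑ s ∈ Finset.range N, Complex.normSq (Wc α β N s)) 0 := by
    simp only [Matrix.trace_fin_two]
    refine ((h1 0).1.add (h1 1).2).congr_deriv ?_
    have e : ∑ s ∈ Finset.range N, Complex.normSq (Wc α β N s) =
        (∑ s ∈ Finset.range N, lm α β s 1 0 ^ 2) +
        2 * (ell α β N).re * (∑ s ∈ Finset.range N, lm α β s 1 0 * lm α β s 1 1) +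
        ((ell α β N).re ^ 2 + (ell α β N).im ^ 2) * (∑ s ∈ Finset.range N, lm α β s 1 1 ^ 2) := by
      rw [Finset.mul_sum, Finset.mul_sum, ← Finset.sum_add_distrib, ← Finset.sum_add_distrib]
      refine Finset.sum_congr rfl fun s _ => ?_
      simp [Wc, Complex.normSq_apply]
      ring
    rw [e]
    have g1 := ellL_normSq h.det' h.tr'
    have g2 := ellL_re h.det' h.tr'
    change _ * ((ell α β N).re ^ 2 + (ell α β N).im ^ 2) = _ at g1
    change _ * (ell α β N).re = _ at g2
    linear_combination -(1 / α (-1)) * ((∑ s ∈ Finset.range N, lm α β s 1 1 ^ 2) * g1 +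
      (∑ s ∈ Finset.range N, lm α β s 1 0 * lm α β s 1 1) * g2)
  have hd : -discr (frakX0 α β N 0) = 4 - (lm α β N 0 0 + lm α β N 1 1) ^ 2 := by
    have : (frakX0 α β N 0).det = 1 := lm_det_N h
    rw [discr, this, Matrix.trace_fin_two]
    change -((lm α β N 0 0 + lm α β N 1 1) ^ 2 - 4 * 1) = _
    ring
  have g3 := ellL_im_mul h.det' h.tr'
  change _ * (ell α β N).im = _ at g3
  have hb := abs_pos.2 (ell_b_ne h.det' h.tr')
  have hi := h.ell_im
  have hα1 := h.hα (-1)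
  have hN : (0 : ℝ) < N := by exact_mod_cast h.hN
  have hS : 0 ≤ ∑ s ∈ Finset.range N, Complex.normSq (Wc α β N s) :=
    Finset.sum_nonneg fun _ _ => Complex.normSq_nonneg _
  have g4 : √(4 - (lm α β N 0 0 + lm α β N 1 1) ^ 2) = 2 * (|lm α β N 0 1| * (ell α β N).im) := by
    rw [g3]; ring
  rw [tauC, hder.deriv, hd, g4, abs_mul, abs_div, abs_of_nonneg hS, abs_of_pos hα1]
  field_simp

section fin
variable {N r : ℕ} {a b : ℕ → ℝ} {α β : ℤ → ℝ}

theorem tp_lim (h : JM N r a b α β) (x₀ : ℝ) (len : ℕ) (i j : Fin 2) :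
    Tendsto (fun p : ℕ × ℝ => tp a b N p.1 p.2 len i j) (atTop ×ˢ 𝓝 x₀) (𝓝 (lm α β len i j)) := by
  induction len generalizing i j with
  | zero => exact tendsto_const_nhds
  | succ len ih =>
    match i with
    | 0 => simp only [tp_zero_row, lm_zero_row]; exact ih 1 j
    | 1 =>
      simp only [tp_one_row, lm_one_row]
      have f1 : Tendsto (fun p : ℕ × ℝ => p.1) (atTop ×ˢ 𝓝 x₀) atTop := tendsto_fst
      have f2 : Tendsto (fun p : ℕ × ℝ => p.2) (atTop ×ˢ 𝓝 x₀) (𝓝 x₀) := tendsto_snd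
      have h1 := (h.lim_a len).comp f1
      have h2 := (f2.mul ((h.lim_inv len).comp f1)).sub ((h.lim_b len).comp f1)
      rw [mul_zero] at h2
      refine ((h1.neg.mul (ih 0 j)).add (h2.mul (ih 1 j))).congr fun p => ?_
      simp only [Function.comp]
      ring

theorem sq_formula (m0 m1 u0 u1 : ℝ) {l : ℂ} (hl : l.im ≠ 0) :
    (m0 * u0 + m1 * u1) ^ 2 = (Complex.normSq (m0 + m1 * l) * ‖(u1 : ℂ) - l * u0‖ ^ 2 -
      ((starRingEnd ℂ) (m0 + m1 * l) ^ 2 * ((u1 : ℂ) - l * u0) ^ 2).re) / (2 * l.im ^ 2) := by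
  rw [eq_div_iff (by positivity), ← Complex.normSq_eq_norm_sq]
  simp [Complex.normSq_apply, pow_two]
  ring

theorem lin_formula (n0 n1 : ℂ) (u0 u1 : ℝ) {l : ℂ} (hl : l.im ≠ 0) :
    n0 * u0 + n1 * u1 =
      (n0 + n1 * (starRingEnd ℂ) l) / ((starRingEnd ℂ) l - l) * ((u1 : ℂ) - l * u0) +
      -((n0 + n1 * l) / ((starRingEnd ℂ) l - l)) * (starRingEnd ℂ) ((u1 : ℂ) - l * u0) := by
  have hne : (starRingEnd ℂ) l - l ≠ 0 := by
    intro h0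
    have := congrArg Complex.im h0
    simp at this
    apply hl
    linarith
  simp only [map_sub, map_mul, Complex.conj_ofReal]
  field_simp
  ring

theorem ces {F : ℕ → ℝ → ℝ} {s : ℕ → ℝ} {x₀ : ℝ} (hs : ∀ k, 0 < s k)
    (hS : Tendsto (fun n => ∑ k ∈ Finset.range n, s k) atTop atTop)
    (hc : ∀ k, ContinuousAt (F k) x₀)
    (hF : Tendsto (fun p : ℕ × ℝ => F p.1 p.2 / s p.1) (atTop ×ˢ 𝓝 x₀) (𝓝 0)) :
    Tendsto (fun p : ℕ × ℝ => (∑ k ∈ Finset.range p.1, F k p.2) / ∑ k ∈ Finset.range p.1, s k)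
      (atTop ×ˢ 𝓝 x₀) (𝓝 0) := by
  rw [Metric.tendsto_nhds]
  intro ε hε
  have h1 := (Metric.tendsto_nhds.1 hF) (ε / 2) (by positivity)
  obtain ⟨pa, hpa, pb, hpb, hab⟩ := Filter.eventually_prod_iff.1 h1
  obtain ⟨K, hK⟩ := eventually_atTop.1 hpa
  have hcont : ContinuousAt (fun x => ∑ k ∈ Finset.range K, |F k x|) x₀ :=
    tendsto_finsetSum _ fun k _ => (hc k).abs
  set B := (∑ k ∈ Finset.range K, |F k x₀|) + 1 with hB
  have hB2 : ∀ᶠ x in 𝓝 x₀, ∑ k ∈ Finset.range K, |F k x| < B :=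
    hcont.eventually (gt_mem_nhds (lt_add_one _))
  have hn : ∀ᶠ n in atTop, 2 * B / ε < ∑ k ∈ Finset.range n, s k ∧ K ≤ n :=
    (hS.eventually_gt_atTop _).and (eventually_ge_atTop K)
  filter_upwards [hn.prod_mk (hB2.and hpb)] with ⟨n, x⟩ ⟨⟨hn1, hn2⟩, hx1, hx2⟩
  simp only at hn1 hn2 hx1 hx2 ⊢
  have hB0 : 0 ≤ B := by positivity
  have hSp : 0 < ∑ k ∈ Finset.range n, s k := lt_of_le_of_lt (by positivity) hn1
  rw [Real.dist_eq, sub_zero, abs_div, abs_of_pos hSp, div_lt_iff₀ hSp]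
  rw [div_lt_iff₀ hε] at hn1
  have h2 : |∑ k ∈ Finset.range n, F k x| ≤ (∑ k ∈ Finset.range K, |F k x|) +
      ∑ k ∈ Finset.Ico K n, ε / 2 * s k := by
    rw [← Finset.sum_range_add_sum_Ico _ hn2]
    refine (abs_add_le _ _).trans (add_le_add (Finset.abs_sum_le_sum_abs _ _)
      ((Finset.abs_sum_le_sum_abs _ _).trans (Finset.sum_le_sum fun k hk => ?_)))
    have := hab (hK k (Finset.mem_Ico.1 hk).1) hx2
    simp only [Real.dist_eq, sub_zero, abs_div, abs_of_pos (hs k)] at this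
    rw [div_lt_iff₀ (hs k)] at this
    exact this.le
  have h3 : ∑ k ∈ Finset.Ico K n, ε / 2 * s k ≤ ε / 2 * ∑ k ∈ Finset.range n, s k := by
    rw [← Finset.mul_sum]
    gcongr
    · exact fun _ _ _ => (hs _).le
    · intro k hk; simp at hk ⊢; omega
  linarith

/-- block base parameter -/
def AA (a : ℕ → ℝ) (N k : ℕ) : ℝ := a ((k + 1) * N - 1)

/-- block sum of squares -/
def GG (a b : ℕ → ℝ) (N k : ℕ) (x : ℝ) : ℝ := ∑ i ∈ Finset.range N, opoly a b ((k + 1) * N + i) x ^ 2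

/-- exact row coefficient -/
def Wk (a b : ℕ → ℝ) (α β : ℤ → ℝ) (N : ℕ) (p : ℕ × ℝ) (i : ℕ) : ℂ :=
  tp a b N p.1 p.2 i 1 0 + tp a b N p.1 p.2 i 1 1 * ell α β N

theorem Wk_lim (h : JM N r a b α β) (x₀ : ℝ) (i : ℕ) :
    Tendsto (fun p => Wk a b α β N p i) (atTop ×ˢ 𝓝 x₀) (𝓝 (Wc α β N i)) :=
  ((tp_lim h x₀ i 1 0).ofReal).add (((tp_lim h x₀ i 1 1).ofReal).mul_const _)

theorem p_sq (h : JM N r a b α β) (p : ℕ × ℝ) (i : ℕ) :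
    opoly a b ((p.1 + 1) * N + i) p.2 ^ 2 =
      (Complex.normSq (Wk a b α β N p i) * ‖yy a b α β N p.1 p.2‖ ^ 2 -
      ((starRingEnd ℂ) (Wk a b α β N p i) ^ 2 * yy a b α β N p.1 p.2 ^ 2).re) /
        (2 * (ell α β N).im ^ 2) := by
  rw [← (tp_mul h p.1 p.2 i).2]
  exact sq_formula _ _ _ _ h.ell_im.ne'

theorem y_step (h : JM N r a b α β) (x₀ : ℝ) : ∃ P Q : ℕ × ℝ → ℂ, ∃ κ : ℂ, κ ^ 2 ≠ 1 ∧
    (∀ p, yy a b α β N (p.1 + 1) p.2 =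
      P p * yy a b α β N p.1 p.2 + Q p * (starRingEnd ℂ) (yy a b α β N p.1 p.2)) ∧
    Tendsto P (atTop ×ˢ 𝓝 x₀) (𝓝 κ) ∧ Tendsto Q (atTop ×ˢ 𝓝 x₀) (𝓝 0) := by
  set l := ell α β N with hl
  have hli := h.ell_im.ne'
  have hne : (starRingEnd ℂ) l - l ≠ 0 := by
    intro h0
    have := congrArg Complex.im h0
    simp at this
    apply hli
    linarith
  set n0 : ℕ × ℝ → ℂ := fun p => tp a b N p.1 p.2 N 1 0 - l * tp a b N p.1 p.2 N 0 0 with hn0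
  set n1 : ℕ × ℝ → ℂ := fun p => tp a b N p.1 p.2 N 1 1 - l * tp a b N p.1 p.2 N 0 1 with hn1
  have t0 : Tendsto n0 (atTop ×ˢ 𝓝 x₀) (𝓝 (lm α β N 1 0 - l * lm α β N 0 0)) :=
    ((tp_lim h x₀ N 1 0).ofReal).sub (((tp_lim h x₀ N 0 0).ofReal).const_mul _)
  have t1 : Tendsto n1 (atTop ×ˢ 𝓝 x₀) (𝓝 (lm α β N 1 1 - l * lm α β N 0 1)) :=
    ((tp_lim h x₀ N 1 1).ofReal).sub (((tp_lim h x₀ N 0 1).ofReal).const_mul _)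
  have q := ellL_quad h.det' h.tr'
  change _ * l ^ 2 + _ * l - _ = 0 at q
  have qc := congrArg (starRingEnd ℂ) q
  simp only [map_sub, map_add, map_mul, map_pow, Complex.conj_ofReal, map_zero] at qc
  refine ⟨fun p => (n0 p + n1 p * (starRingEnd ℂ) l) / ((starRingEnd ℂ) l - l),
    fun p => -((n0 p + n1 p * l) / ((starRingEnd ℂ) l - l)),
    (starRingEnd ℂ) (lm α β N 0 0 + lm α β N 0 1 * l), ?_, ?_, ?_, ?_⟩
  · intro h0
    apply ellL_den_sq h.det' h.tr'
    have := congrArg (starRingEnd ℂ) h0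
    simpa [hl, ell] using this
  · intro p
    have := lin_formula (n0 p) (n1 p) (opoly a b ((p.1 + 1) * N - 1) p.2)
      (opoly a b ((p.1 + 1) * N) p.2) hli
    refine Eq.trans ?_ this
    have m := tp_mul h p.1 p.2 N
    rw [yy, show (p.1 + 1 + 1) * N = (p.1 + 1) * N + N by ring, ← m.1, ← m.2]
    simp only [hn0, hn1]
    push_cast
    ring
  · have := (t0.add (t1.mul_const ((starRingEnd ℂ) l))).div_const ((starRingEnd ℂ) l - l)
    convert this using 2
    rw [eq_div_iff hne]
    simp only [map_add, map_mul, Complex.conj_ofReal]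
    linear_combination qc
  · have := ((t0.add (t1.mul_const l)).div_const ((starRingEnd ℂ) l - l)).neg
    convert this using 2
    rw [eq_comm, neg_eq_zero, div_eq_zero_iff]
    left
    linear_combination -q
end fin

section fin
variable {N r : ℕ} {a b : ℕ → ℝ} {α β : ℤ → ℝ}

theorem block_lim (h : JM N r a b α β) {g : ℝ → ℝ}
    (hcc : CC (fun k x => a ((k + 1) * N - 1) * ‖yy a b α β N k x‖ ^ 2 / (ell α β N).im) g) (x₀ : ℝ) :
    ∃ C : ℂ, Tendsto (fun p : ℕ × ℝ => (GG a b N p.1 p.2 -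
        tauC α β N * g x₀ * (N * α (-1)) * (1 / AA a N p.1) +
        (C * (yy a b α β N p.1 p.2 ^ 2 - yy a b α β N (p.1 + 1) p.2 ^ 2)).re) / (1 / AA a N p.1))
      (atTop ×ˢ 𝓝 x₀) (𝓝 0) := by
  obtain ⟨P, Q, κ, hκ, hst, hP, hQ⟩ := y_step h x₀
  set l := ell α β N with hl
  have hli : 0 < l.im := h.ell_im
  set C₀ : ℂ := ∑ i ∈ Finset.range N, (starRingEnd ℂ) (Wc α β N i) ^ 2 / (2 * l.im ^ 2) with hC₀
  set C : ℂ := C₀ / (1 - κ ^ 2) with hC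
  have hκ' : 1 - κ ^ 2 ≠ 0 := sub_ne_zero.2 hκ.symm
  refine ⟨C, ?_⟩
  set Y : ℕ × ℝ → ℝ := fun p => AA a N p.1 * ‖yy a b α β N p.1 p.2‖ ^ 2 with hY
  set q : ℕ × ℝ → ℂ := fun p => AA a N p.1 * yy a b α β N p.1 p.2 ^ 2 with hq
  have hA : ∀ k, 0 < AA a N k := fun k => h.ha _
  have Ylim : Tendsto Y (atTop ×ˢ 𝓝 x₀) (𝓝 (g x₀ * l.im)) := by
    refine ((hcc x₀).mul_const l.im).congr fun p => ?_
    simp only [hY, AA]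
    field_simp
  have hqY : ∀ p, ‖q p‖ = Y p := fun p => by
    simp only [hq, hY, norm_mul, norm_pow, Complex.norm_real, Real.norm_of_nonneg (hA _).le]
  have qbd : IsBoundedUnder (· ≤ ·) (atTop ×ˢ 𝓝 x₀) (norm ∘ q) := by
    have := Ylim.isBoundedUnder_le
    simpa only [Function.comp_def, hqY] using this
  have T1 : Tendsto (fun p => (∑ i ∈ Finset.range N, Complex.normSq (Wk a b α β N p i)) *
      Y p / (2 * l.im ^ 2) - tauC α β N * g x₀ * (N * α (-1))) (atTop ×ˢ 𝓝 x₀) (𝓝 0) := by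
    have t := (((tendsto_finsetSum (Finset.range N) fun i _ =>
      (Complex.continuous_normSq.tendsto _).comp (Wk_lim h x₀ i)).mul Ylim).div_const
      (2 * l.im ^ 2)).sub_const (tauC α β N * g x₀ * (N * α (-1)))
    convert t using 2
    · rfl
    rw [← tau_eq h]
    field_simp
    ring
  have T2 : Tendsto (fun p => (C * (1 - P p ^ 2) - ∑ i ∈ Finset.range N,
      (starRingEnd ℂ) (Wk a b α β N p i) ^ 2 / (2 * l.im ^ 2)) * q p) (atTop ×ˢ 𝓝 x₀) (𝓝 0) := by
    refine Tendsto.zero_mul_isBoundedUnder_le ?_ qbd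
    have t := ((tendsto_const_nhds (x := (1 : ℂ)).sub (hP.pow 2)).const_mul C).sub
      (tendsto_finsetSum (Finset.range N) fun i _ =>
        ((((Complex.continuous_conj.tendsto _).comp (Wk_lim h x₀ i)).pow 2).div_const
          ((2 * l.im ^ 2 : ℂ))))
    convert t using 2
    · rfl
    change 0 = C * (1 - κ ^ 2) - C₀
    rw [hC, div_mul_cancel₀ _ hκ', sub_self]
  have T3 : Tendsto (fun p => C * (2 * P p * Q p * Y p + Q p * (Q p * (starRingEnd ℂ) (q p))))
      (atTop ×ˢ 𝓝 x₀) (𝓝 0) := by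
    have u1 := ((hP.const_mul 2).mul hQ).mul Ylim.ofReal
    have u2 : Tendsto (fun p => Q p * (starRingEnd ℂ) (q p)) (atTop ×ˢ 𝓝 x₀) (𝓝 0) := by
      refine Tendsto.zero_mul_isBoundedUnder_le hQ ?_
      simpa only [Function.comp_def, RCLike.norm_conj] using qbd
    have := (u1.add (hQ.mul u2)).const_mul C
    simpa using this
  have T := (T1.add ((Complex.continuous_re.tendsto _).comp T2)).sub
    ((Complex.continuous_re.tendsto _).comp T3)
  simp only [Complex.zero_re, add_zero, sub_zero] at T
  refine T.congr fun p => ?_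
  have hAp := (hA p.1).ne'
  have e1 : GG a b N p.1 p.2 * AA a N p.1 = (∑ i ∈ Finset.range N, Complex.normSq (Wk a b α β N p i)) *
      Y p / (2 * l.im ^ 2) - ((∑ i ∈ Finset.range N,
      (starRingEnd ℂ) (Wk a b α β N p i) ^ 2 / (2 * l.im ^ 2)) * q p).re := by
    rw [Finset.sum_mul, Finset.sum_mul, Complex.re_sum, Finset.sum_div, ← Finset.sum_sub_distrib, GG,
      Finset.sum_mul]
    refine Finset.sum_congr rfl fun i _ => ?_
    rw [p_sq h p i]
    have : ((starRingEnd ℂ) (Wk a b α β N p i) ^ 2 / (2 * (l.im : ℂ) ^ 2) * q p) =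
        ((AA a N p.1 / (2 * l.im ^ 2) : ℝ) : ℂ) *
        ((starRingEnd ℂ) (Wk a b α β N p i) ^ 2 * yy a b α β N p.1 p.2 ^ 2) := by
      simp only [hq]; push_cast; ring
    rw [this, Complex.re_ofReal_mul]
    simp only [hY]
    ring
  have e2 : (AA a N p.1 : ℂ) * (yy a b α β N (p.1 + 1) p.2 ^ 2) =
      P p ^ 2 * q p + (2 * P p * Q p * Y p + Q p * (Q p * (starRingEnd ℂ) (q p))) := by
    have e3 : (Y p : ℂ) = AA a N p.1 * (yy a b α β N p.1 p.2 * (starRingEnd ℂ) (yy a b α β N p.1 p.2)) := by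
      rw [Complex.mul_conj']
      simp only [hY]; push_cast; ring
    rw [hst p, e3]
    simp only [hq, map_mul, map_pow, Complex.conj_ofReal]
    ring
  have e4 : (C * (yy a b α β N p.1 p.2 ^ 2 - yy a b α β N (p.1 + 1) p.2 ^ 2)).re * AA a N p.1 =
      (C * (1 - P p ^ 2) * q p - C * (2 * P p * Q p * Y p + Q p * (Q p * (starRingEnd ℂ) (q p)))).re := by
    rw [mul_comm, ← Complex.re_ofReal_mul]
    congr 1
    simp only [hq] at e2 ⊢
    linear_combination (-C) * e2
  have e5 : ∀ X c D : ℝ, (X - c * (1 / AA a N p.1) + D) / (1 / AA a N p.1) =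
    X * AA a N p.1 - c + D * AA a N p.1 := by intro X c D; field_simp
  rw [e5, e1, e4]
  simp only [Function.comp, Complex.sub_re, sub_mul]
  ring
end fin

theorem block_sum (N : ℕ) (f : ℕ → ℝ) (K : ℕ) : ∑ j ∈ Finset.range ((K + 1) * N), f j =
    ∑ j ∈ Finset.range N, f j + ∑ k ∈ Finset.range K, ∑ i ∈ Finset.range N, f ((k + 1) * N + i) := by
  induction K with
  | zero => simp
  | succ K ih =>
    rw [show (K + 1 + 1) * N = (K + 1) * N + N by ring, Finset.sum_range_add, ih,
      Finset.sum_range_succ _ K]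
    ring

section fin
variable {N r : ℕ} {a b : ℕ → ℝ} {α β : ℤ → ℝ}

theorem α_min (h : JM N r a b α β) : ∃ m : ℝ, 0 < m ∧ ∀ j : ℕ, m ≤ α j := by
  obtain ⟨i, _, hmin⟩ := Finset.exists_min_image (Finset.range N) (fun j : ℕ => α j)
    ⟨0, Finset.mem_range.2 h.hN⟩
  refine ⟨α i, h.hα _, fun j => ?_⟩
  have h1 := hmin (j % N) (Finset.mem_range.2 (Nat.mod_lt _ h.hN))
  have h2 := h.αk (j / N) (j % N : ℕ)
  rw [← h2, ← Nat.cast_add, Nat.mul_comm, Nat.mod_add_div] at h1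
  exact h1

theorem rho_atTop (h : JM N r a b α β) :
    Tendsto (fun n => ∑ j ∈ Finset.range n, α (j : ℤ) / a j) atTop atTop := by
  obtain ⟨m, hm, hmin⟩ := α_min h
  refine tendsto_atTop_mono (fun n => ?_) (h.hCarleman.const_mul_atTop hm)
  rw [Finset.mul_sum]
  refine Finset.sum_le_sum fun j _ => ?_
  rw [mul_one_div]
  have := h.ha j
  gcongr
  exact hmin j

/-- block sum for rho -/
def RR (a : ℕ → ℝ) (α : ℤ → ℝ) (N k : ℕ) : ℝ :=
  ∑ i ∈ Finset.range N, α (((k + 1) * N + i : ℕ) : ℤ) / a ((k + 1) * N + i)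

theorem A_ratio (h : JM N r a b α β) (i : ℕ) :
    Tendsto (fun k => AA a N k / a ((k + 1) * N + i)) atTop (𝓝 (α (-1) / α i)) := by
  have f : Tendsto (fun k : ℕ => (k, (0 : ℝ))) atTop (atTop ×ˢ 𝓝 0) :=
    tendsto_id.prodMk tendsto_const_nhds
  have t := fun u v => (tp_lim h 0 (i + 1) u v).comp f
  have := ((t 0 0).mul (t 1 1)).sub ((t 0 1).mul (t 1 0))
  rw [← Matrix.det_fin_two, lm_det h] at this
  have e : ((i + 1 : ℕ) : ℤ) - 1 = i := by push_cast; ring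
  rw [e] at this
  refine this.congr fun k => ?_
  simp only [Function.comp]
  rw [← Matrix.det_fin_two, tp_det h]
  rfl

theorem RR_lim (h : JM N r a b α β) :
    Tendsto (fun k => RR a α N k * AA a N k) atTop (𝓝 (N * α (-1))) := by
  have t := tendsto_finsetSum (Finset.range N) fun i _ => (A_ratio h i).const_mul (α i)
  have e : ∑ i ∈ Finset.range N, α (i : ℤ) * (α (-1) / α i) = N * α (-1) := by
    rw [Finset.sum_congr rfl fun (i : ℕ) _ => mul_div_cancel₀ (α (-1)) (h.hα i).ne']
    simp
  rw [e] at t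
  refine t.congr fun k => ?_
  rw [RR, Finset.sum_mul]
  refine Finset.sum_congr rfl fun i _ => ?_
  have := h.αk (k + 1) i
  rw [← Nat.cast_add, add_comm] at this
  rw [this]
  ring

/-- partial sums of reciprocals -/
def SS (a : ℕ → ℝ) (N n : ℕ) : ℝ := ∑ k ∈ Finset.range n, 1 / AA a N k

theorem SS_atTop (h : JM N r a b α β) : Tendsto (SS a N) atTop atTop := by
  have hA : ∀ k, 0 < AA a N k := fun k => h.ha _
  have hR0 : ∀ k, 0 ≤ RR a α N k := fun k => Finset.sum_nonneg fun i _ =>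
    div_nonneg (h.hα _).le (h.ha _).le
  have hR : ¬ Summable (RR a α N) := by
    rw [not_summable_iff_tendsto_nat_atTop_of_nonneg hR0]
    have t := ((rho_atTop h).comp (h.kN 0)).atTop_add
      (tendsto_const_nhds (x := -∑ j ∈ Finset.range N, α (j : ℤ) / a j))
    refine t.congr fun K => ?_
    simp only [Function.comp, add_zero]
    rw [block_sum]
    simp only [RR]
    ring
  have hS : ¬ Summable (fun k => 1 / AA a N k) := by
    intro hs
    apply hR
    refine summable_of_isBigO_nat hs ?_
    have := (RR_lim h).isBigO_one ℝ
    have h2 := this.mul (Asymptotics.isBigO_refl (fun k => 1 / AA a N k) atTop)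
    refine (h2.congr_left fun k => ?_).congr_right fun k => one_mul _
    have := (hA k).ne'
    field_simp
  exact (not_summable_iff_tendsto_nat_atTop_of_nonneg fun k => (one_div_pos.2 (hA k)).le).1 hS

theorem invA_lim (h : JM N r a b α β) : Tendsto (fun k => 1 / AA a N k) atTop (𝓝 0) := by
  have := (tendsto_inv_atTop_zero.comp h.hmod_a).comp (h.kN1 0)
  simpa [Function.comp_def, AA] using this

theorem r_lim (h : JM N r a b α β) :
    Tendsto (fun K => (∑ j ∈ Finset.range ((K + 1) * N), α (j : ℤ) / a j) / SS a N K) atTop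
      (𝓝 (N * α (-1))) := by
  have hA : ∀ k, 0 < AA a N k := fun k => h.ha _
  have f : Tendsto (fun k : ℕ => (k, (0 : ℝ))) atTop (atTop ×ˢ 𝓝 0) :=
    tendsto_id.prodMk tendsto_const_nhds
  have c := (ces (F := fun k _ => RR a α N k - N * α (-1) * (1 / AA a N k)) (x₀ := 0)
    (fun k => one_div_pos.2 (hA k)) (SS_atTop h) (fun k => continuousAt_const) (by
      have t : Tendsto (fun p : ℕ × ℝ => p.1) (atTop ×ˢ 𝓝 (0 : ℝ)) atTop := tendsto_fst
      have t2 := ((RR_lim h).sub_const (N * α (-1))).comp t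
      rw [sub_self] at t2
      refine t2.congr fun p => ?_
      have := (hA p.1).ne'
      simp only [Function.comp]
      field_simp)).comp f
  have d := (tendsto_const_nhds (x := ∑ j ∈ Finset.range N, α (j : ℤ) / a j)).div_atTop (SS_atTop h)
  have e := (c.add d).add_const (N * α (-1))
  rw [add_zero, zero_add] at e
  refine e.congr' ?_
  filter_upwards [(SS_atTop h).eventually_gt_atTop 0] with K hK
  rw [block_sum]
  simp only [Function.comp, Finset.sum_sub_distrib, ← Finset.mul_sum]
  change (_ - N * α (-1) * SS a N K) / SS a N K + _ + _ = _
  simp only [RR]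
  field_simp
  ring

theorem B_lim (h : JM N r a b α β) {g : ℝ → ℝ}
    (hcc : CC (fun k x => a ((k + 1) * N - 1) * ‖yy a b α β N k x‖ ^ 2 / (ell α β N).im) g) (x₀ : ℝ) :
    Tendsto (fun p : ℕ × ℝ => (∑ j ∈ Finset.range ((p.1 + 1) * N), opoly a b j p.2 ^ 2) / SS a N p.1)
      (atTop ×ˢ 𝓝 x₀) (𝓝 (tauC α β N * g x₀ * (N * α (-1)))) := by
  have hA : ∀ k, 0 < AA a N k := fun k => h.ha _
  have hli := h.ell_im
  have hS := (SS_atTop h).comp (tendsto_fst (f := atTop) (g := 𝓝 x₀))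
  obtain ⟨C, hC⟩ := block_lim h hcc x₀
  have hyc : ∀ k, Continuous (yy a b α β N k) := fun k => by
    have h1 := opoly_cont a b ((k + 1) * N)
    have h2 := opoly_cont a b ((k + 1) * N - 1)
    unfold yy
    fun_prop
  have hGc : ∀ k, Continuous (GG a b N k) := fun k =>
    continuous_finsetSum _ fun i _ => (opoly_cont a b _).pow 2
  have c := ces (F := fun k x => GG a b N k x - tauC α β N * g x₀ * (N * α (-1)) * (1 / AA a N k) +
        (C * (yy a b α β N k x ^ 2 - yy a b α β N (k + 1) x ^ 2)).re) (x₀ := x₀)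
    (fun k => one_div_pos.2 (hA k)) (SS_atTop h) (fun k => by
      have := hyc k; have := hyc (k + 1); have := hGc k
      refine Continuous.continuousAt ?_
      refine Continuous.add (by fun_prop) (Complex.continuous_re.comp (by fun_prop))) hC
  have s0 : Continuous fun x => (∑ j ∈ Finset.range N, opoly a b j x ^ 2) -
      (C * yy a b α β N 0 x ^ 2).re := by
    have := hyc 0
    refine Continuous.sub (continuous_finsetSum _ fun i _ => (opoly_cont a b _).pow 2)
      (Complex.continuous_re.comp (by fun_prop))
  have d := ((s0.tendsto x₀).comp (tendsto_snd (f := (atTop : Filter ℕ)))).div_atTop hS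
  have y2 : Tendsto (fun p : ℕ × ℝ => (C * yy a b α β N p.1 p.2 ^ 2).re) (atTop ×ˢ 𝓝 x₀) (𝓝 0) := by
    have y3 : Tendsto (fun p : ℕ × ℝ => yy a b α β N p.1 p.2 ^ 2) (atTop ×ˢ 𝓝 x₀) (𝓝 0) := by
      rw [tendsto_zero_iff_norm_tendsto_zero]
      have := ((hcc x₀).mul_const (ell α β N).im).mul ((invA_lim h).comp (tendsto_fst (f := atTop) (g := 𝓝 x₀)))
      rw [mul_zero] at this
      refine this.congr fun p => ?_
      simp only [Function.comp]
      have := (hA p.1).ne'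
      unfold AA at *
      rw [norm_pow]
      field_simp
    have := (Complex.continuous_re.tendsto _).comp (y3.const_mul C)
    simpa [Function.comp_def] using this
  have d2 := y2.div_atTop hS
  have e := ((c.add d).add d2).add_const (tauC α β N * g x₀ * (N * α (-1)))
  rw [add_zero, add_zero, zero_add] at e
  refine e.congr' ?_
  filter_upwards [hS.eventually_gt_atTop 0] with p hp
  simp only [Function.comp] at hp
  rw [block_sum N (fun j => opoly a b j p.2 ^ 2)]
  have tel : ∑ k ∈ Finset.range p.1, (C * (yy a b α β N k p.2 ^ 2 - yy a b α β N (k + 1) p.2 ^ 2)).re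
      = (C * yy a b α β N 0 p.2 ^ 2).re - (C * yy a b α β N p.1 p.2 ^ 2).re := by
    rw [← Complex.re_sum, ← Finset.mul_sum, Finset.sum_range_sub', mul_sub, Complex.sub_re]
  simp only [Function.comp, Finset.sum_add_distrib, Finset.sum_sub_distrib, ← Finset.mul_sum]
  rw [Finset.mul_sum, tel, ← Finset.mul_sum]
  change (_ - _ * SS a N p.1 + _) / SS a N p.1 + _ / SS a N p.1 + _ + _ = _
  simp only [GG]
  field_simp
  ring

theorem final_lim (h : JM N r a b α β) {g : ℝ → ℝ}
    (hcc : CC (fun k x => a ((k + 1) * N - 1) * ‖yy a b α β N k x‖ ^ 2 / (ell α β N).im) g) :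
    CC (fun n x => (rho a α n)⁻¹ * ∑ j ∈ Finset.range (n + 1), opoly a b j x ^ 2)
      (fun x => tauC α β N * g x) := by
  intro x₀
  have hα1 := h.hα (-1)
  have hNp : (0 : ℝ) < N := by exact_mod_cast h.hN
  set d : ℝ := N * α (-1) with hd
  have hd0 : d ≠ 0 := by positivity
  set B : ℕ × ℝ → ℝ := fun p => ∑ j ∈ Finset.range ((p.1 + 1) * N), opoly a b j p.2 ^ 2 with hB
  set R : ℕ → ℝ := fun K => ∑ j ∈ Finset.range ((K + 1) * N), α (j : ℤ) / a j with hR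
  have hRpos : ∀ K, 0 < R K := fun K => Finset.sum_pos (fun j _ => div_pos (h.hα _) (h.ha _))
    ⟨0, Finset.mem_range.2 (h.kNpos K)⟩
  have f1 : Tendsto (fun p : ℕ × ℝ => p.1) (atTop ×ˢ 𝓝 x₀) atTop := tendsto_fst
  have sh : Tendsto (fun p : ℕ × ℝ => (p.1 + 1, p.2)) (atTop ×ˢ 𝓝 x₀) (atTop ×ˢ 𝓝 x₀) :=
    ((tendsto_add_atTop_nat 1).comp tendsto_fst).prodMk tendsto_snd
  have hBl := B_lim h hcc x₀
  have hRl := r_lim h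
  have hSr : Tendsto (fun K => SS a N (K + 1) / SS a N K) atTop (𝓝 1) := by
    have := ((invA_lim h).div_atTop (SS_atTop h)).const_add 1
    rw [add_zero] at this
    refine this.congr' ?_
    filter_upwards [(SS_atTop h).eventually_gt_atTop 0] with K hK
    have e : SS a N (K + 1) = SS a N K + 1 / AA a N K := Finset.sum_range_succ _ _
    rw [e, add_div, div_self hK.ne']
  have hSp : ∀ᶠ p : ℕ × ℝ in atTop ×ˢ 𝓝 x₀, 0 < SS a N p.1 :=
    f1.eventually ((SS_atTop h).eventually_gt_atTop 0)
  have hSp1 : ∀ᶠ p : ℕ × ℝ in atTop ×ˢ 𝓝 x₀, 0 < SS a N (p.1 + 1) :=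
    sh.eventually hSp
  have hU : Tendsto (fun p : ℕ × ℝ => B (p.1 + 1, p.2) / R p.1) (atTop ×ˢ 𝓝 x₀)
      (𝓝 (tauC α β N * g x₀)) := by
    have t := ((hBl.comp sh).mul (hSr.comp f1)).div (hRl.comp f1) hd0
    rw [mul_one, mul_div_cancel_right₀ _ hd0] at t
    refine t.congr' ?_
    filter_upwards [hSp, hSp1] with p h1 h2
    have h3 := (hRpos p.1).ne'
    simp only [Function.comp]
    change (B (p.1 + 1, p.2) / _ * _) / (R p.1 / _) = _
    field_simp
  have hL : Tendsto (fun p : ℕ × ℝ => B p / R (p.1 + 1)) (atTop ×ˢ 𝓝 x₀)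
      (𝓝 (tauC α β N * g x₀)) := by
    have t := (hBl.div (hSr.comp f1) one_ne_zero).div ((hRl.comp f1).comp sh) hd0
    rw [div_one, mul_div_cancel_right₀ _ hd0] at t
    refine t.congr' ?_
    filter_upwards [hSp, hSp1] with p h1 h2
    have h3 := (hRpos (p.1 + 1)).ne'
    simp only [Function.comp, Pi.div_apply]
    change (B p / _ / _) / (R (p.1 + 1) / _) = _
    field_simp
  have hK : Tendsto (fun n : ℕ => (n + 1) / N - 1) atTop atTop :=
    (tendsto_sub_atTop_nat 1).comp ((Nat.tendsto_div_const_atTop h.hN.ne').comp (tendsto_add_atTop_nat 1))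
  have hKp : Tendsto (fun p : ℕ × ℝ => ((p.1 + 1) / N - 1, p.2)) (atTop ×ˢ 𝓝 x₀) (atTop ×ˢ 𝓝 x₀) :=
    (hK.comp tendsto_fst).prodMk tendsto_snd
  have key : ∀ᶠ p : ℕ × ℝ in atTop ×ˢ 𝓝 x₀,
      (((p.1 + 1) / N - 1) + 1) * N ≤ p.1 + 1 ∧ p.1 + 1 ≤ (((p.1 + 1) / N - 1) + 1 + 1) * N := by
    filter_upwards [f1.eventually (eventually_ge_atTop N)] with p hp
    have h1 : 1 ≤ (p.1 + 1) / N := (Nat.one_le_div_iff h.hN).2 (by omega)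
    rw [Nat.sub_add_cancel h1]
    refine ⟨Nat.div_mul_le_self _ _, ?_⟩
    have h2 := Nat.div_add_mod (p.1 + 1) N
    have h3 := Nat.mod_lt (p.1 + 1) h.hN
    rw [Nat.add_mul, Nat.mul_comm]
    omega
  have monoB : ∀ (x : ℝ) {m n : ℕ}, m ≤ n → ∑ j ∈ Finset.range m, opoly a b j x ^ 2 ≤
      ∑ j ∈ Finset.range n, opoly a b j x ^ 2 := fun x m n hmn =>
    Finset.sum_le_sum_of_subset_of_nonneg (Finset.range_mono hmn) fun _ _ _ => sq_nonneg _
  have monoR : ∀ {m n : ℕ}, m ≤ n → ∑ j ∈ Finset.range m, α (j : ℤ) / a j ≤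
      ∑ j ∈ Finset.range n, α (j : ℤ) / a j := fun {m n} hmn =>
    Finset.sum_le_sum_of_subset_of_nonneg (Finset.range_mono hmn) fun _ _ _ =>
      div_nonneg (h.hα _).le (h.ha _).le
  have nonB : ∀ (x : ℝ) (m : ℕ), 0 ≤ ∑ j ∈ Finset.range m, opoly a b j x ^ 2 := fun x m =>
    Finset.sum_nonneg fun _ _ => sq_nonneg _
  refine tendsto_of_tendsto_of_tendsto_of_le_of_le' (hL.comp hKp) (hU.comp hKp) ?_ ?_
  · filter_upwards [key] with p hp
    simp only [Function.comp]
    rw [inv_mul_eq_div]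
    have hρ : 0 < rho a α p.1 := lt_of_lt_of_le (hRpos _) (monoR hp.1)
    exact div_le_div₀ (nonB _ _) (monoB _ hp.1) hρ (monoR hp.2)
  · filter_upwards [key] with p hp
    simp only [Function.comp]
    rw [inv_mul_eq_div]
    exact div_le_div₀ (nonB _ _) (monoB _ hp.2) (hRpos _) (monoR hp.1)
end fin

/-- Theorem 7 of the paper; resolves the Ignjatović conjecture for this
class. Asymptotics of the Christoffel function for `N`-periodically modulated Jacobi
parameters in the `𝒟_r` setting. -/
theorem christoffel_asymptotics_modulated_Dr
    (N : ℕ) (hN : 0 < N) (r : ℕ) (hr : 0 < r)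
    (a b : ℕ → ℝ) (ha : ∀ n, 0 < a n)
    (α β : ℤ → ℝ) (hα : ∀ n, 0 < α n)
    (hαper : ∀ n : ℤ, α (n + N) = α n) (hβper : ∀ n : ℤ, β (n + N) = β n)
    (hmod_a : Tendsto a atTop atTop)
    (hmod_r : Tendsto (fun n : ℕ =>
      |a n / a (n + 1) - α (n : ℤ) / α ((n : ℤ) + 1)|) atTop (𝓝 0))
    (hmod_b : Tendsto (fun n : ℕ =>
      |b n / a n - β (n : ℤ) / α (n : ℤ)|) atTop (𝓝 0))
    (hD1 : ∀ i < N, memD r (fun k => a ((k + 1) * N + i - 1) / a ((k + 1) * N + i)))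
    (hD2 : ∀ i < N, memD r (fun k => b ((k + 1) * N + i) / a ((k + 1) * N + i)))
    (hD3 : ∀ i < N, memD r (fun k => 1 / a ((k + 1) * N + i)))
    (hCarleman : Tendsto (fun n : ℕ => ∑ k ∈ Finset.range n, 1 / a k) atTop atTop)
    (htr : |Matrix.trace (frakX0 α β N 0)| < 2)
    (μ : Measure ℝ) (hμ : IsProbabilityMeasure μ)
    (horth : ∀ n m : ℕ, ∫ x, opoly a b n x * opoly a b m x ∂μ = if n = m then 1 else 0) :
    ∃ w : ℝ → ℝ, Continuous w ∧ (∀ x, 0 < w x) ∧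
      μ = volume.withDensity (fun x => ENNReal.ofReal (w x)) ∧
      TendstoLocallyUniformly
        (fun (n : ℕ) (x : ℝ) =>
          (rho a α n)⁻¹ * ∑ j ∈ Finset.range (n + 1), (opoly a b j x) ^ 2)
        (fun x => tauC α β N / (π * w x)) atTop := by
  have h : JM N r a b α β := ⟨hN, hr, ha, hα, hαper, hβper, hmod_a, hmod_r, hmod_b, hD1, hD2, hD3,
    hCarleman, htr⟩
  obtain ⟨g, hg, hg0, hcc⟩ := main_conv h
  refine ⟨fun x => 1 / (π * g x), ?_, fun x => ?_, ident h hg hg0 hcc μ horth, ?_⟩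
  · exact continuous_const.div (by fun_prop) fun x => by
      have := hg0 x
      positivity
  · have := hg0 x
    positivity
  · have e : (fun x => tauC α β N / (π * (1 / (π * g x)))) = fun x => tauC α β N * g x := by
      ext x
      have := hg0 x
      field_simp
    rw [e]
    exact (final_lim h hcc).to_tlu (continuous_const.mul hg)
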